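/- arXiv:0912.4913 — 5 statements merged into one kernel-verified Lean document; each statement's English description precedes it below -/
import Mathlib

section
/- Define H(x) = e^{−x/2} ∏_{n=1}^∞ [(1 − e^{−(8n−7)x})(1 − e^{−(8n−1)x})] / [(1 − e^{−(8n−5)x})(1 − e^{−(8n−3)x})] for real x > 0. Then H(π/2) = √(1 + 2√2 − 2√(2 + √2)). -/
open Real

/-- The Ramanujan–Göllnitz–Gordon continued fraction, given by its product
representation `H(x) = e^{-x/2} (q;q⁸)_∞ (q⁷;q⁸)_∞ / ((q³;q⁸)_∞ (q⁵;q⁸)_∞)`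
with `q = e^{-x}`. -/
noncomputable def H (x : ℝ) : ℝ :=
  Real.exp (-x / 2) *
    ∏' n : ℕ,
      (1 - Real.exp (-((8 * n + 1) * x))) * (1 - Real.exp (-((8 * n + 7) * x))) /
        ((1 - Real.exp (-((8 * n + 3) * x))) * (1 - Real.exp (-((8 * n + 5) * x))))

open Filter Topology

/-- The product `(Q; Q)_m` with `Q = w²`. -/
noncomputable def qFactorial (w : ℝ) (m : ℕ) : ℝ := ∏ i ∈ Finset.range m, (1 - w ^ (2 * (i + 1)))

/-- The reciprocal of `qFactorial`, extended by zero to negative integers. -/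
noncomputable def qFactorialInv (w : ℝ) (m : ℤ) : ℝ :=
  if 0 ≤ m then (qFactorial w m.toNat)⁻¹ else 0

theorem qFactorial_succ (w : ℝ) (m : ℕ) :
    qFactorial w (m + 1) = qFactorial w m * (1 - w ^ (2 * (m + 1))) := by
  simp [qFactorial, Finset.prod_range_succ]

theorem qFactorial_pos {w : ℝ} (hw : 0 < w) (hw1 : w < 1) (m : ℕ) : 0 < qFactorial w m :=
  Finset.prod_pos fun _ _ ↦ sub_pos.mpr (pow_lt_one₀ hw.le hw1 (by omega))

theorem qFactorial_antitone {w : ℝ} (hw : 0 < w) (hw1 : w < 1) : Antitone (qFactorial w) := by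
  refine antitone_nat_of_succ_le fun m ↦ ?_
  rw [qFactorial_succ]
  exact mul_le_of_le_one_right (qFactorial_pos hw hw1 m).le (sub_le_self _ (by positivity))

theorem exists_tendsto_qFactorial {w : ℝ} (hw : 0 < w) (hw1 : w < 1) :
    ∃ E : ℝ, 0 < E ∧ Tendsto (qFactorial w) atTop (𝓝 E) := by
  have hs : Summable fun i : ℕ ↦ ‖-w ^ (2 * (i + 1))‖ := by
    have : Summable fun i : ℕ ↦ w ^ 2 * (w ^ 2) ^ i :=
      (summable_geometric_of_lt_one (by positivity) (by nlinarith)).mul_left _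
    refine this.congr fun i ↦ ?_
    rw [norm_neg, Real.norm_of_nonneg (by positivity)]
    ring
  have hm := (multipliable_one_add_of_summable hs).hasProd.tendsto_prod_nat
  have hne : ∏' i : ℕ, (1 + -w ^ (2 * (i + 1))) ≠ 0 := by
    refine tprod_one_add_ne_zero_of_summable (fun i ↦ ?_) hs
    rw [← sub_eq_add_neg]
    exact (sub_pos.mpr (pow_lt_one₀ hw.le hw1 (by omega))).ne'
  have ht : Tendsto (qFactorial w) atTop (𝓝 (∏' i : ℕ, (1 + -w ^ (2 * (i + 1))))) := by
    refine hm.congr fun n ↦ ?_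
    simp [qFactorial, sub_eq_add_neg]
  exact ⟨_, lt_of_le_of_ne (ge_of_tendsto' ht fun n ↦ (qFactorial_pos hw hw1 n).le) hne.symm, ht⟩

theorem qFactorialInv_natCast (w : ℝ) (m : ℕ) : qFactorialInv w m = (qFactorial w m)⁻¹ := by
  simp [qFactorialInv]

theorem qFactorialInv_of_neg (w : ℝ) {m : ℤ} (hm : m < 0) : qFactorialInv w m = 0 := by
  simp [qFactorialInv, hm]

theorem qFactorialInv_sub_one {w : ℝ} (hw : 0 < w) (hw1 : w < 1) (m : ℤ) :
    qFactorialInv w (m - 1) = (1 - w ^ (2 * m)) * qFactorialInv w m := by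
  rcases lt_trichotomy m 0 with hm | rfl | hm
  · rw [qFactorialInv_of_neg w hm, qFactorialInv_of_neg w (by omega), mul_zero]
  · rw [qFactorialInv_of_neg w (by omega)]
    simp
  · obtain ⟨k, rfl⟩ : ∃ k : ℕ, m = ((k + 1 : ℕ) : ℤ) := ⟨(m - 1).toNat, by omega⟩
    have h1 : ((k + 1 : ℕ) : ℤ) - 1 = (k : ℤ) := by push_cast; ring
    have h2 : w ^ (2 * ((k + 1 : ℕ) : ℤ)) = w ^ (2 * (k + 1)) := by norm_cast
    have h3 : 1 - w ^ (2 * (k + 1)) ≠ 0 :=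
      (sub_pos.mpr (pow_lt_one₀ hw.le hw1 (by omega))).ne'
    have h4 := (qFactorial_pos hw hw1 k).ne'
    rw [h1, h2, qFactorialInv_natCast, qFactorialInv_natCast, qFactorial_succ]
    field_simp

theorem finite_jacobi_coeff_succ {w : ℝ} (hw : 0 < w) (hw1 : w < 1) (N : ℕ) (j : ℤ) :
    qFactorial w (2 * (N + 1)) * qFactorialInv w ((N + 1 : ℕ) + j) *
        qFactorialInv w ((N + 1 : ℕ) - j) * w ^ (j ^ 2) =
      (1 + w ^ (4 * N + 2)) *
          (qFactorial w (2 * N) * qFactorialInv w (N + j) * qFactorialInv w (N - j) *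
            w ^ (j ^ 2)) +
        w ^ (2 * N + 1) *
          (qFactorial w (2 * N) * qFactorialInv w (N + (j - 1)) * qFactorialInv w (N - (j - 1)) *
              w ^ ((j - 1) ^ 2) +
            qFactorial w (2 * N) * qFactorialInv w (N + (j + 1)) *
              qFactorialInv w (N - (j + 1)) * w ^ ((j + 1) ^ 2)) := by
  have hw0 := hw.ne'
  have e0 : ((N + 1 : ℕ) : ℤ) = (N : ℤ) + 1 := by push_cast; ring
  have e1 : (N : ℤ) + j = ((N : ℤ) + 1 + j) - 1 := by ring
  have e2 : (N : ℤ) + (j - 1) = ((N : ℤ) + 1 + j) - 1 - 1 := by ring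
  have e3 : (N : ℤ) - j = ((N : ℤ) + 1 - j) - 1 := by ring
  have e4 : (N : ℤ) - (j + 1) = ((N : ℤ) + 1 - j) - 1 - 1 := by ring
  have e5 : (N : ℤ) - (j - 1) = (N : ℤ) + 1 - j := by ring
  have e6 : (N : ℤ) + (j + 1) = (N : ℤ) + 1 + j := by ring
  rw [e0, e2, e4, e5, e6, e1, e3]
  simp only [qFactorialInv_sub_one hw hw1]
  generalize qFactorialInv w ((N : ℤ) + 1 + j) = X
  generalize qFactorialInv w ((N : ℤ) + 1 - j) = Y
  rw [show 2 * (N + 1) = 2 * N + 1 + 1 by ring, qFactorial_succ, qFactorial_succ]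
  have p1 : w ^ (2 * ((N : ℤ) + 1 + j)) = w ^ (2 * N + 2) * (w ^ j) ^ 2 := by
    rw [← zpow_natCast, ← zpow_natCast, ← zpow_mul, ← zpow_add₀ hw0]; push_cast; ring_nf
  have p2 : w ^ (2 * ((N : ℤ) + 1 - j)) = w ^ (2 * N + 2) / (w ^ j) ^ 2 := by
    rw [← zpow_natCast, ← zpow_natCast, ← zpow_mul, ← zpow_sub₀ hw0]; push_cast; ring_nf
  have p3 : w ^ (2 * ((N : ℤ) + 1 + j - 1)) = w ^ (2 * N) * (w ^ j) ^ 2 := by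
    rw [← zpow_natCast, ← zpow_natCast, ← zpow_mul, ← zpow_add₀ hw0]; push_cast; ring_nf
  have p4 : w ^ (2 * ((N : ℤ) + 1 - j - 1)) = w ^ (2 * N) / (w ^ j) ^ 2 := by
    rw [← zpow_natCast, ← zpow_natCast, ← zpow_mul, ← zpow_sub₀ hw0]; push_cast; ring_nf
  have p5 : w ^ ((j - 1) ^ 2) = w ^ (j ^ 2) * w / (w ^ j) ^ 2 := by
    rw [← zpow_natCast (w ^ j), ← zpow_mul, ← zpow_add_one₀ hw0, ← zpow_sub₀ hw0]
    push_cast; ring_nf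
  have p6 : w ^ ((j + 1) ^ 2) = w ^ (j ^ 2) * w * (w ^ j) ^ 2 := by
    rw [← zpow_natCast (w ^ j), ← zpow_mul, ← zpow_add_one₀ hw0, ← zpow_add₀ hw0]
    push_cast; ring_nf
  have hJ : w ^ j ≠ 0 := zpow_ne_zero _ hw0
  rw [p1, p2, p3, p4, p5, p6]
  generalize w ^ j = J at *
  generalize w ^ (j ^ 2) = K
  rw [show w ^ (2 * (2 * N + 1)) = (w ^ N) ^ 4 * w ^ 2 by ring,
    show w ^ (2 * (2 * N + 1 + 1)) = (w ^ N) ^ 4 * w ^ 4 by ring,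
    show w ^ (4 * N + 2) = (w ^ N) ^ 4 * w ^ 2 by ring,
    show w ^ (2 * N + 2) = (w ^ N) ^ 2 * w ^ 2 by ring,
    show w ^ (2 * N + 1) = (w ^ N) ^ 2 * w by ring,
    show w ^ (2 * N) = (w ^ N) ^ 2 by ring]
  field_simp
  ring

theorem hasSum_finite_jacobi {w z : ℝ} (hw : 0 < w) (hw1 : w < 1) (hz : z ≠ 0) (N : ℕ) :
    HasSum (fun j : ℤ ↦ qFactorial w (2 * N) * qFactorialInv w (N + j) *
        qFactorialInv w (N - j) * w ^ (j ^ 2) * z ^ j)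
      (∏ k ∈ Finset.range N, (1 + z * w ^ (2 * k + 1)) * (1 + z⁻¹ * w ^ (2 * k + 1))) := by
  induction N with
  | zero =>
    convert hasSum_single (0 : ℤ) (fun j hj ↦ ?_) using 1
    · simp [qFactorial, qFactorialInv]
    · rcases lt_or_gt_of_ne hj with h | h
      · rw [qFactorialInv_of_neg w (show ((0 : ℕ) : ℤ) + j < 0 by simpa using h)]; simp
      · rw [qFactorialInv_of_neg w (show ((0 : ℕ) : ℤ) - j < 0 by simpa using h)]; simp
  | succ N ih =>
    have hm := (Equiv.subRight (1 : ℤ)).hasSum_iff.mpr ih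
    have hp := (Equiv.addRight (1 : ℤ)).hasSum_iff.mpr ih
    convert (ih.mul_left (1 + w ^ (4 * N + 2))).add
      ((hm.mul_left (z * w ^ (2 * N + 1))).add (hp.mul_left (z⁻¹ * w ^ (2 * N + 1)))) using 1
    · rfl
    · funext j
      rw [finite_jacobi_coeff_succ hw hw1]
      simp only [Function.comp_apply, Equiv.subRight_apply, Equiv.coe_addRight]
      rw [zpow_sub_one₀ hz, zpow_add_one₀ hz]
      field_simp
    · rw [Finset.prod_range_succ]
      field_simp
      ring

/-- **Jacobi triple product**, as a limit of partial products. -/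
theorem tendsto_jacobi_prod {w z : ℝ} (hw : 0 < w) (hw1 : w < 1) (hz : z ≠ 0)
    (hs : Summable fun j : ℤ ↦ ‖w ^ (j ^ 2) * z ^ j‖) {E : ℝ} (hE : 0 < E)
    (ht : Tendsto (qFactorial w) atTop (𝓝 E)) :
    Tendsto (fun N ↦ ∏ k ∈ Finset.range N,
        (1 + z * w ^ (2 * k + 1)) * (1 + z⁻¹ * w ^ (2 * k + 1))) atTop
      (𝓝 (E⁻¹ * ∑' j : ℤ, w ^ (j ^ 2) * z ^ j)) := by
  have hle (m : ℕ) : E ≤ qFactorial w m := (qFactorial_antitone hw hw1).le_of_tendsto ht m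
  have hinv0 (m : ℤ) : 0 ≤ qFactorialInv w m := by
    unfold qFactorialInv
    split_ifs
    · exact inv_nonneg.mpr (qFactorial_pos hw hw1 _).le
    · rfl
  have hinv (m : ℤ) : qFactorialInv w m ≤ E⁻¹ := by
    unfold qFactorialInv
    split_ifs
    · exact inv_anti₀ hE (hle _)
    · exact (inv_pos.mpr hE).le
  have h1 (m : ℕ) : qFactorial w m ≤ 1 := by
    simpa [qFactorial] using qFactorial_antitone hw hw1 (Nat.zero_le m)
  have hlim : Tendsto (qFactorialInv w) atTop (𝓝 E⁻¹) := by
    have htn : Tendsto Int.toNat atTop atTop := tendsto_atTop.mpr fun b ↦ by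
      filter_upwards [eventually_ge_atTop (b : ℤ)] with m hm
      omega
    have h := (ht.inv₀ hE.ne').comp htn
    refine h.congr' ?_
    filter_upwards [eventually_ge_atTop 0] with m hm
    simp [qFactorialInv, hm]
  have hfin (N : ℕ) := (hasSum_finite_jacobi hw hw1 hz N).tsum_eq
  simp_rw [← hfin, ← tsum_mul_left]
  refine tendsto_tsum_of_dominated_convergence
    (bound := fun j ↦ E⁻¹ * E⁻¹ * ‖w ^ (j ^ 2) * z ^ j‖) (hs.mul_left _) (fun j ↦ ?_)
    (Eventually.of_forall fun N j ↦ ?_)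
  · have ha : Tendsto (fun N : ℕ ↦ qFactorial w (2 * N)) atTop (𝓝 E) :=
      ht.comp (tendsto_id.const_mul_atTop' (by norm_num))
    have hb : Tendsto (fun N : ℕ ↦ qFactorialInv w (N + j)) atTop (𝓝 E⁻¹) :=
      hlim.comp (tendsto_atTop_add_const_right _ _ tendsto_natCast_atTop_atTop)
    have hc : Tendsto (fun N : ℕ ↦ qFactorialInv w (N - j)) atTop (𝓝 E⁻¹) := by
      simp only [sub_eq_add_neg]
      exact hlim.comp (tendsto_atTop_add_const_right _ (-j) tendsto_natCast_atTop_atTop)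
    convert (((ha.mul hb).mul hc).mul_const (w ^ (j ^ 2))).mul_const (z ^ j) using 2
    field_simp
  · rw [mul_assoc _ (w ^ (j ^ 2)), norm_mul]
    refine mul_le_mul_of_nonneg_right ?_ (norm_nonneg _)
    rw [Real.norm_of_nonneg
      (mul_nonneg (mul_nonneg (qFactorial_pos hw hw1 _).le (hinv0 _)) (hinv0 _))]
    refine mul_le_mul ?_ (hinv _) (hinv0 _) (inv_pos.mpr hE).le
    calc _ ≤ 1 * E⁻¹ := mul_le_mul (h1 _) (hinv _) (hinv0 _) zero_le_one
      _ = E⁻¹ := one_mul _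

theorem summable_exp_quadratic {a : ℝ} (ha : 0 < a) (b c : ℝ) :
    Summable fun n : ℤ ↦ exp (-(a * (n : ℝ) ^ 2 + b * n + c)) := by
  have h := ((summable_jacobiTheta₂_term_iff ⟨0, b / (2 * π)⟩ ⟨0, a / π⟩).mpr
    (div_pos ha pi_pos)).norm.mul_left (exp (-c))
  refine h.congr fun n ↦ ?_
  rw [norm_jacobiTheta₂_term, ← exp_add]
  congr 1
  field_simp
  ring

theorem neg_one_zpow_add (m n : ℤ) : (-1 : ℝ) ^ (m + n) = (-1) ^ m * (-1) ^ n :=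
  zpow_add₀ (by norm_num) m n

theorem neg_one_zpow_sub (m n : ℤ) : (-1 : ℝ) ^ (m - n) = (-1) ^ m * (-1) ^ n := by
  rw [sub_eq_add_neg, neg_one_zpow_add, zpow_neg, ← inv_zpow]
  norm_num

theorem summable_norm_signed_exp_quadratic {a : ℝ} (ha : 0 < a) (b c : ℝ) :
    Summable fun n : ℤ ↦ ‖(-1 : ℝ) ^ n * exp (-(a * (n : ℝ) ^ 2 + b * n + c))‖ := by
  refine (summable_exp_quadratic ha b c).congr fun n ↦ ?_
  rw [norm_mul, Real.norm_eq_abs, abs_neg_one_zpow, one_mul, Real.norm_eq_abs, abs_exp]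

theorem summable_norm_exp_quadratic {a : ℝ} (ha : 0 < a) (b c : ℝ) :
    Summable fun n : ℤ ↦ ‖exp (-(a * (n : ℝ) ^ 2 + b * n + c))‖ :=
  (summable_exp_quadratic ha b c).norm

/-- Splitting a double series according to the parity of the sum of the indices. -/
theorem tsum_int_prod_parity {g : ℤ × ℤ → ℝ} (hg : Summable g) :
    ∑' p, g p = ∑' p : ℤ × ℤ, g (p.1 + p.2, p.1 - p.2) +
      ∑' p : ℤ × ℤ, g (p.1 + p.2 + 1, p.1 - p.2) := by
  have h₁ : Function.Injective fun p : ℤ × ℤ ↦ (p.1 + p.2, p.1 - p.2) := by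
    rintro ⟨a, b⟩ ⟨c, d⟩ h
    simp only [Prod.mk.injEq] at h ⊢
    omega
  have h₂ : Function.Injective fun p : ℤ × ℤ ↦ (p.1 + p.2 + 1, p.1 - p.2) := by
    rintro ⟨a, b⟩ ⟨c, d⟩ h
    simp only [Prod.mk.injEq] at h ⊢
    omega
  have hc : IsCompl (Set.range fun p : ℤ × ℤ ↦ (p.1 + p.2, p.1 - p.2))
      (Set.range fun p : ℤ × ℤ ↦ (p.1 + p.2 + 1, p.1 - p.2)) := by
    constructor
    · rw [Set.disjoint_iff]
      rintro _ ⟨⟨⟨a, b⟩, rfl⟩, ⟨⟨c, d⟩, h⟩⟩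
      simp only [Prod.mk.injEq] at h
      omega
    · rw [codisjoint_iff_le_sup]
      rintro ⟨u, v⟩ -
      rcases Int.even_or_odd' (u + v) with ⟨k, hk | hk⟩
      · exact Or.inl ⟨(k, u - k), by simp only [Prod.mk.injEq]; omega⟩
      · exact Or.inr ⟨(k, u - k - 1), by simp only [Prod.mk.injEq]; omega⟩
  exact ((h₁.hasSum_range_iff.mpr (hg.comp_injective h₁).hasSum).add_isCompl hc
    (h₂.hasSum_range_iff.mpr (hg.comp_injective h₂).hasSum)).tsum_eq

theorem tsum_mul_tsum_parity {f₁ f₂ u₁ v₁ u₂ v₂ : ℤ → ℝ}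
    (hf₁ : Summable fun n ↦ ‖f₁ n‖) (hf₂ : Summable fun n ↦ ‖f₂ n‖)
    (hu₁ : Summable fun n ↦ ‖u₁ n‖) (hv₁ : Summable fun n ↦ ‖v₁ n‖)
    (hu₂ : Summable fun n ↦ ‖u₂ n‖) (hv₂ : Summable fun n ↦ ‖v₂ n‖)
    (h₁ : ∀ m n, f₁ (m + n) * f₂ (m - n) = u₁ m * v₁ n)
    (h₂ : ∀ m n, f₁ (m + n + 1) * f₂ (m - n) = u₂ m * v₂ n) :
    (∑' n, f₁ n) * ∑' n, f₂ n = (∑' n, u₁ n) * (∑' n, v₁ n) + (∑' n, u₂ n) * ∑' n, v₂ n := by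
  rw [tsum_mul_tsum_of_summable_norm hf₁ hf₂, tsum_mul_tsum_of_summable_norm hu₁ hv₁,
    tsum_mul_tsum_of_summable_norm hu₂ hv₂,
    tsum_int_prod_parity (summable_mul_of_summable_norm hf₁ hf₂)]
  simp only [h₁, h₂]

theorem tsum_int_even_add_odd {f : ℤ → ℝ} (hf : Summable f) :
    ∑' n, f n = ∑' n, f (2 * n) + ∑' n, f (2 * n + 1) := by
  have h₁ : Function.Injective fun n : ℤ ↦ 2 * n := fun a b h ↦ by simpa using h
  have h₂ : Function.Injective fun n : ℤ ↦ 2 * n + 1 := fun a b h ↦ by simpa using h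
  have hc : IsCompl (Set.range fun n : ℤ ↦ 2 * n) (Set.range fun n : ℤ ↦ 2 * n + 1) := by
    constructor
    · rw [Set.disjoint_iff]
      rintro _ ⟨⟨a, rfl⟩, ⟨c, h⟩⟩
      dsimp only at h
      omega
    · rw [codisjoint_iff_le_sup]
      rintro u -
      rcases Int.even_or_odd' u with ⟨k, hk | hk⟩
      · exact Or.inl ⟨k, hk.symm⟩
      · exact Or.inr ⟨k, hk.symm⟩
  exact ((h₁.hasSum_range_iff.mpr (hf.comp_injective h₁).hasSum).add_isCompl hc
    (h₂.hasSum_range_iff.mpr (hf.comp_injective h₂).hasSum)).tsum_eq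

/-- The series `∑ e^{-x (n + s)²}`. -/
noncomputable def thetaShift (x s : ℝ) : ℝ := ∑' n : ℤ, exp (-(x * (n + s) ^ 2))

/-- The series `∑ (-1)ⁿ e^{-x (n + s)²}`. -/
noncomputable def thetaSigned (x s : ℝ) : ℝ :=
  ∑' n : ℤ, (-1 : ℝ) ^ n * exp (-(x * (n + s) ^ 2))

theorem summable_norm_thetaShift {x : ℝ} (hx : 0 < x) (s : ℝ) :
    Summable fun n : ℤ ↦ ‖exp (-(x * (n + s) ^ 2))‖ := by
  convert summable_norm_exp_quadratic hx (2 * x * s) (x * s ^ 2) using 5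
  ring

theorem summable_norm_thetaSigned {x : ℝ} (hx : 0 < x) (s : ℝ) :
    Summable fun n : ℤ ↦ ‖(-1 : ℝ) ^ n * exp (-(x * (n + s) ^ 2))‖ := by
  convert summable_norm_signed_exp_quadratic hx (2 * x * s) (x * s ^ 2) using 6
  ring

theorem thetaShift_pos {x : ℝ} (hx : 0 < x) (s : ℝ) : 0 < thetaShift x s :=
  (summable_norm_thetaShift hx s).of_norm.tsum_pos (fun _ ↦ (exp_pos _).le) 0 (exp_pos _)

theorem thetaSigned_one_sub (x s : ℝ) : thetaSigned x (1 - s) = -thetaSigned x s := by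
  unfold thetaSigned
  rw [← (Equiv.subLeft (-1 : ℤ)).tsum_eq, ← tsum_neg]
  refine tsum_congr fun n ↦ ?_
  rw [Equiv.subLeft_apply, neg_one_zpow_sub]
  push_cast
  rw [show (-1 - (n : ℝ) + (1 - s)) ^ 2 = (n + s) ^ 2 by ring]
  norm_num

theorem thetaShift_sq {x : ℝ} (hx : 0 < x) :
    thetaShift x 0 ^ 2 = thetaShift (2 * x) 0 ^ 2 + thetaShift (2 * x) (1 / 2) ^ 2 := by
  have h2 : 0 < 2 * x := by positivity
  rw [pow_two, pow_two, pow_two]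
  refine tsum_mul_tsum_parity (summable_norm_thetaShift hx 0) (summable_norm_thetaShift hx 0)
    (summable_norm_thetaShift h2 0) (summable_norm_thetaShift h2 0)
    (summable_norm_thetaShift h2 _) (summable_norm_thetaShift h2 _) (fun m n ↦ ?_) fun m n ↦ ?_
  all_goals
    rw [← exp_add, ← exp_add]
    push_cast
    ring_nf

theorem thetaSigned_sq {x : ℝ} (hx : 0 < x) :
    thetaSigned x 0 ^ 2 = thetaShift (2 * x) 0 ^ 2 - thetaShift (2 * x) (1 / 2) ^ 2 := by
  have h2 : 0 < 2 * x := by positivity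
  have hs (m n : ℤ) : (-1 : ℝ) ^ (m + n) * (-1) ^ (m - n) = 1 := by
    rw [← neg_one_zpow_add, show m + n + (m - n) = 2 * m by ring, zpow_mul]
    norm_num
  have key := tsum_mul_tsum_parity (v₂ := fun n ↦ -exp (-((2 * x) * (n + (1 / 2 : ℝ)) ^ 2)))
    (summable_norm_thetaSigned hx 0)
    (summable_norm_thetaSigned hx 0)
    (summable_norm_thetaShift h2 0) (summable_norm_thetaShift h2 0)
    (summable_norm_thetaShift h2 (1 / 2))
    (by simpa only [norm_neg] using summable_norm_thetaShift h2 (1 / 2))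
    (fun m n ↦ ?_) fun m n ↦ ?_
  · rw [tsum_neg, mul_neg, ← sub_eq_add_neg] at key
    rw [pow_two, pow_two, pow_two]
    exact key
  · rw [mul_mul_mul_comm, hs, one_mul, ← exp_add, ← exp_add]
    push_cast
    ring_nf
  · rw [mul_mul_mul_comm, neg_one_zpow_add _ 1, mul_right_comm _ _ ((-1 : ℝ) ^ (m - n)), hs,
      zpow_one, one_mul, ← exp_add, mul_neg, neg_one_mul, ← exp_add]
    push_cast
    ring_nf

theorem thetaShift_eq_add {x : ℝ} (hx : 0 < x) :
    thetaShift x 0 = thetaShift (4 * x) 0 + thetaShift (4 * x) (1 / 2) := by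
  unfold thetaShift
  rw [tsum_int_even_add_odd (summable_norm_thetaShift hx 0).of_norm]
  push_cast
  congr 2 <;> ext n <;> ring_nf

theorem thetaSigned_eq_sub {x : ℝ} (hx : 0 < x) :
    thetaSigned x 0 = thetaShift (4 * x) 0 - thetaShift (4 * x) (1 / 2) := by
  unfold thetaSigned thetaShift
  rw [tsum_int_even_add_odd (summable_norm_thetaSigned hx 0).of_norm, sub_eq_add_neg, ← tsum_neg]
  have he (n : ℤ) : (-1 : ℝ) ^ (2 * n) = 1 := by rw [zpow_mul]; norm_num
  simp only [neg_one_zpow_add, he, zpow_one, one_mul, neg_one_mul]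
  push_cast
  congr 2 <;> ext n <;> ring_nf

/-- The transformation `x ↦ π² / x` at `x = π / 2`. -/
theorem thetaShift_pi_div_two : thetaShift (π / 2) 0 = √2 * thetaShift (4 * (π / 2)) 0 := by
  have h := Real.tsum_exp_neg_mul_int_sq (a := 1 / 2) (by norm_num)
  rw [← Real.sqrt_eq_rpow, Real.sqrt_div zero_le_one, Real.sqrt_one, one_div_one_div] at h
  unfold thetaShift
  refine (tsum_congr fun n ↦ ?_).trans (h.trans (congrArg _ (tsum_congr fun n ↦ ?_))) <;> ring_nf

theorem thetaShift_pi_sq : thetaShift π 0 ^ 2 = √2 * thetaShift π (1 / 2) ^ 2 := by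
  have hx : 0 < π / 2 := by positivity
  have h1 := thetaShift_sq hx
  have h2 := thetaSigned_sq hx
  have h3 := thetaShift_eq_add hx
  have h4 := thetaSigned_eq_sub hx
  have h5 := thetaShift_pi_div_two
  rw [show 2 * (π / 2) = π by ring] at h1 h2
  have h6 : thetaSigned (π / 2) 0 = (2 - √2) * thetaShift (4 * (π / 2)) 0 := by
    linear_combination h4 + h3 - h5
  rw [h5] at h1
  rw [h6] at h2
  have hsq : √2 ^ 2 = 2 := Real.sq_sqrt (by norm_num)
  linear_combination -((1 - √2) / 2) * h1 - ((1 + √2) / 2) * h2 -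
    thetaShift (4 * (π / 2)) 0 ^ 2 * hsq

theorem thetaSigned_mul_thetaShift_zero {x : ℝ} (hx : 0 < x) :
    thetaSigned (2 * x) (1 / 4) * thetaShift (2 * x) 0 =
      thetaSigned (4 * x) (1 / 8) ^ 2 - thetaSigned (4 * x) (3 / 8) ^ 2 := by
  have h2 : 0 < 2 * x := by positivity
  have h4 : 0 < 4 * x := by positivity
  have key := tsum_mul_tsum_parity
    (v₂ := fun n ↦ -((-1 : ℝ) ^ n * exp (-((4 * x) * (n + (5 / 8 : ℝ)) ^ 2))))
    (summable_norm_thetaSigned h2 (1 / 4)) (summable_norm_thetaShift h2 0)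
    (summable_norm_thetaSigned h4 (1 / 8)) (summable_norm_thetaSigned h4 (1 / 8))
    (summable_norm_thetaSigned h4 (5 / 8))
    (by simpa only [norm_neg] using summable_norm_thetaSigned h4 (5 / 8))
    (fun m n ↦ ?_) fun m n ↦ ?_
  · rw [tsum_neg, mul_neg, ← sub_eq_add_neg] at key
    have h := thetaSigned_one_sub (4 * x) (3 / 8)
    rw [show (1 : ℝ) - 3 / 8 = 5 / 8 by norm_num] at h
    rw [← neg_sq (thetaSigned (4 * x) (3 / 8)), ← h, pow_two, pow_two]
    exact key
  · rw [mul_mul_mul_comm, mul_assoc, neg_one_zpow_add, ← exp_add, ← exp_add]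
    push_cast
    ring_nf
  · rw [mul_neg, mul_mul_mul_comm, mul_assoc, neg_one_zpow_add, neg_one_zpow_add, zpow_one,
      ← exp_add, ← exp_add, mul_neg_one, neg_mul]
    push_cast
    ring_nf

theorem thetaShift_half_mul_thetaSigned {x : ℝ} (hx : 0 < x) :
    thetaShift (2 * x) (1 / 2) * thetaSigned (2 * x) (1 / 4) =
      2 * (thetaSigned (4 * x) (3 / 8) * thetaSigned (4 * x) (1 / 8)) := by
  have h2 : 0 < 2 * x := by positivity
  have h4 : 0 < 4 * x := by positivity
  have key := tsum_mul_tsum_parity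
    (summable_norm_thetaShift h2 (1 / 2)) (summable_norm_thetaSigned h2 (1 / 4))
    (summable_norm_thetaSigned h4 (3 / 8)) (summable_norm_thetaSigned h4 (1 / 8))
    (summable_norm_thetaSigned h4 (7 / 8)) (summable_norm_thetaSigned h4 (5 / 8))
    (fun m n ↦ ?_) fun m n ↦ ?_
  · have h₁ := thetaSigned_one_sub (4 * x) (1 / 8)
    have h₃ := thetaSigned_one_sub (4 * x) (3 / 8)
    rw [show (1 : ℝ) - 1 / 8 = 7 / 8 by norm_num] at h₁
    rw [show (1 : ℝ) - 3 / 8 = 5 / 8 by norm_num] at h₃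
    unfold thetaSigned at h₁ h₃
    rw [h₁, h₃] at key
    refine key.trans ?_
    unfold thetaSigned
    ring
  all_goals
    rw [mul_left_comm, mul_mul_mul_comm, neg_one_zpow_sub, ← exp_add, ← exp_add]
    push_cast
    ring_nf

theorem exp_intCast_mul (x : ℝ) (n : ℤ) : exp (n * x) = exp x ^ n := by
  rw [mul_comm, exp_mul, rpow_intCast]

theorem exists_tendsto_prod_thetaSigned {x : ℝ} (hx : 0 < x) :
    ∃ E : ℝ, 0 < E ∧ ∀ s : ℝ, Tendsto (fun N ↦ ∏ k ∈ Finset.range N,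
        (1 - exp (-((8 * k + (4 - 8 * s)) * x))) * (1 - exp (-((8 * k + (4 + 8 * s)) * x))))
      atTop (𝓝 (E * exp (4 * x * s ^ 2) * thetaSigned (4 * x) s)) := by
  have hw1 : exp (-(4 * x)) < 1 := exp_lt_one_iff.mpr (by linarith)
  obtain ⟨E, hE, ht⟩ := exists_tendsto_qFactorial (exp_pos (-(4 * x))) hw1
  refine ⟨E⁻¹, inv_pos.mpr hE, fun s ↦ ?_⟩
  have hterm (n : ℤ) : exp (-(4 * x)) ^ (n ^ 2) * (-exp (-(8 * s * x))) ^ n =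
      exp (4 * x * s ^ 2) * ((-1) ^ n * exp (-(4 * x * (n + s) ^ 2))) := by
    rw [neg_eq_neg_one_mul (exp (-(8 * s * x))), mul_zpow, ← exp_intCast_mul, ← exp_intCast_mul,
      mul_left_comm, mul_left_comm (exp _) _ (exp _), ← exp_add, ← exp_add]
    push_cast
    ring_nf
  have hs : Summable fun n : ℤ ↦ ‖exp (-(4 * x)) ^ (n ^ 2) * (-exp (-(8 * s * x))) ^ n‖ := by
    simp only [hterm, norm_mul (exp _) (_ * _)]
    exact (summable_norm_thetaSigned (by positivity) s).mul_left _
  have h := tendsto_jacobi_prod (exp_pos _) hw1 (neg_ne_zero.mpr (exp_ne_zero _)) hs hE ht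
  simp only [hterm, tsum_mul_left] at h
  rw [mul_assoc]
  refine h.congr fun N ↦ Finset.prod_congr rfl fun k _ ↦ ?_
  rw [inv_neg, ← exp_neg, ← exp_nat_mul, neg_mul, neg_mul, ← exp_add, ← exp_add, mul_comm,
    ← sub_eq_add_neg, ← sub_eq_add_neg]
  push_cast
  ring_nf

theorem summable_norm_exp_eight_mul {x : ℝ} (hx : 0 < x) (c : ℝ) :
    Summable fun n : ℕ ↦ ‖-exp (-((8 * n + c) * x))‖ := by
  have h : Summable fun n : ℕ ↦ exp (-(c * x)) * exp (-(8 * x)) ^ n :=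
    (summable_geometric_of_lt_one (exp_pos _).le (exp_lt_one_iff.mpr (by linarith))).mul_left _
  refine h.congr fun n ↦ ?_
  rw [norm_neg, Real.norm_eq_abs, abs_exp, ← exp_nat_mul, ← exp_add]
  ring_nf

theorem multipliable_one_sub_exp {x : ℝ} (hx : 0 < x) (c : ℝ) :
    Multipliable fun n : ℕ ↦ 1 - exp (-((8 * n + c) * x)) := by
  simpa only [sub_eq_add_neg] using
    multipliable_one_add_of_summable (summable_norm_exp_eight_mul hx c)

theorem one_sub_exp_pos {x : ℝ} (hx : 0 < x) {c : ℝ} (hc : 0 < c) (n : ℕ) :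
    0 < 1 - exp (-((8 * n + c) * x)) :=
  sub_pos.mpr (exp_lt_one_iff.mpr (neg_neg_of_pos (by positivity)))

theorem tprod_one_sub_exp_ne_zero {x : ℝ} (hx : 0 < x) {c : ℝ} (hc : 0 < c) :
    ∏' n : ℕ, (1 - exp (-((8 * n + c) * x))) ≠ 0 := by
  simp only [sub_eq_add_neg]
  refine tprod_one_add_ne_zero_of_summable (fun n ↦ ?_) (summable_norm_exp_eight_mul hx c)
  simpa only [sub_eq_add_neg] using (one_sub_exp_pos hx hc n).ne'

theorem H_nonneg_and_mul_eq {x : ℝ} (hx : 0 < x) :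
    0 ≤ H x ∧ thetaSigned (4 * x) (1 / 8) ≠ 0 ∧
      H x * thetaSigned (4 * x) (1 / 8) = thetaSigned (4 * x) (3 / 8) := by
  obtain ⟨E, hE, ht⟩ := exists_tendsto_prod_thetaSigned hx
  have m₁ := (multipliable_one_sub_exp hx 1).mul (multipliable_one_sub_exp hx 7)
  have m₃ := (multipliable_one_sub_exp hx 3).mul (multipliable_one_sub_exp hx 5)
  have hne : ∏' n : ℕ, (1 - exp (-((8 * n + 3) * x))) * (1 - exp (-((8 * n + 5) * x))) ≠ 0 := by
    rw [(multipliable_one_sub_exp hx 3).tprod_mul (multipliable_one_sub_exp hx 5)]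
    exact mul_ne_zero (tprod_one_sub_exp_ne_zero hx (by norm_num))
      (tprod_one_sub_exp_ne_zero hx (by norm_num))
  have e₁ : ∏' n : ℕ, (1 - exp (-((8 * n + 1) * x))) * (1 - exp (-((8 * n + 7) * x))) =
      E * exp (4 * x * (3 / 8) ^ 2) * thetaSigned (4 * x) (3 / 8) := by
    refine tendsto_nhds_unique m₁.hasProd.tendsto_prod_nat ?_
    convert ht (3 / 8) using 7 <;> norm_num
  have e₃ : ∏' n : ℕ, (1 - exp (-((8 * n + 3) * x))) * (1 - exp (-((8 * n + 5) * x))) =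
      E * exp (4 * x * (1 / 8) ^ 2) * thetaSigned (4 * x) (1 / 8) := by
    refine tendsto_nhds_unique m₃.hasProd.tendsto_prod_nat ?_
    convert ht (1 / 8) using 7 <;> norm_num
  have hb : thetaSigned (4 * x) (1 / 8) ≠ 0 := by
    rw [e₃] at hne
    exact right_ne_zero_of_mul hne
  have hH : H x = exp (-x / 2) * (E * exp (4 * x * (3 / 8) ^ 2) * thetaSigned (4 * x) (3 / 8) /
      (E * exp (4 * x * (1 / 8) ^ 2) * thetaSigned (4 * x) (1 / 8))) := by
    rw [H, m₁.tprod_div₀ m₃ hne, e₁, e₃]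
  refine ⟨?_, hb, ?_⟩
  · rw [H]
    refine mul_nonneg (exp_pos _).le
      (ge_of_tendsto' (m₁.div₀ m₃ hne).hasProd.tendsto_prod_nat fun N ↦
        Finset.prod_nonneg fun n _ ↦ ?_)
    have h₁ := one_sub_exp_pos hx (c := 1) (by norm_num) n
    have h₃ := one_sub_exp_pos hx (c := 3) (by norm_num) n
    have h₅ := one_sub_exp_pos hx (c := 5) (by norm_num) n
    have h₇ := one_sub_exp_pos hx (c := 7) (by norm_num) n
    positivity
  · have hexp : exp (4 * x * (1 / 8) ^ 2) = exp (-x / 2) * exp (4 * x * (3 / 8) ^ 2) := by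
      rw [← exp_add]
      ring_nf
    rw [hH, hexp]
    generalize thetaSigned (4 * x) (1 / 8) = b at hb
    field_simp

/-- The relation `1 / H - H = φ(q²) / (q^{1/2} ψ(q⁴))`. -/
theorem one_sub_H_sq_mul {x : ℝ} (hx : 0 < x) :
    (1 - H x ^ 2) * thetaShift (2 * x) (1 / 2) = 2 * H x * thetaShift (2 * x) 0 := by
  obtain ⟨-, hb, ha⟩ := H_nonneg_and_mul_eq hx
  have h₀ := thetaSigned_mul_thetaShift_zero hx
  have h₁ := thetaShift_half_mul_thetaSigned hx
  rw [← ha] at h₀ h₁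
  refine mul_right_cancel₀ (mul_ne_zero hb hb) ?_
  linear_combination -thetaShift (2 * x) (1 / 2) * h₀ + thetaShift (2 * x) 0 * h₁

theorem H_pi_div_two :
    H (π / 2) = Real.sqrt (1 + 2 * Real.sqrt 2 - 2 * Real.sqrt (2 + Real.sqrt 2)) := by
  have hx : 0 < π / 2 := by positivity
  have h := one_sub_H_sq_mul hx
  have hH := (H_nonneg_and_mul_eq hx).1
  rw [show 2 * (π / 2) = π by ring] at h
  have hs := thetaShift_pos pi_pos 0
  have ht := thetaShift_pos pi_pos (1 / 2)
  have hst := thetaShift_pi_sq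
  have hr : √2 ^ 2 = 2 := Real.sq_sqrt (by norm_num)
  have hr0 : 0 ≤ √2 := Real.sqrt_nonneg 2
  have hu : √(2 + √2) ^ 2 = 2 + √2 := Real.sq_sqrt (by positivity)
  have hu0 : 0 ≤ √(2 + √2) := Real.sqrt_nonneg _
  have hle : H (π / 2) ^ 2 ≤ 1 := by
    have : 0 ≤ (1 - H (π / 2) ^ 2) * thetaShift π (1 / 2) := by rw [h]; positivity
    linarith [nonneg_of_mul_nonneg_left this ht]
  have hquad : (1 - H (π / 2) ^ 2) ^ 2 = 4 * √2 * H (π / 2) ^ 2 := by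
    refine mul_right_cancel₀ (pow_pos ht 2).ne' ?_
    rw [← mul_pow, h, mul_pow, hst]
    ring
  have hroot : 1 + 2 * √2 - H (π / 2) ^ 2 = 2 * √(2 + √2) := by
    refine (pow_left_inj₀ (by linarith) (by positivity) two_ne_zero).mp ?_
    linear_combination hquad + 4 * hr - 4 * hu
  rw [← hroot, sub_sub_cancel, Real.sqrt_sq hH]
end

section
/- Define H(x) = e^{−x/2} ∏_{n=1}^∞ [(1 − e^{−(8n−7)x})(1 − e^{−(8n−1)x})] / [(1 − e^{−(8n−5)x})(1 − e^{−(8n−3)x})] for real x > 0. Then H(π√2/2) = √(3 + 2√2 − 2√(4 + 3√2)). -/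
open Real

open Filter Topology Finset

/-- The reciprocal `1 / (p; p)_m` of the finite `q`-Pochhammer symbol, extended by `0` to
negative `m`. -/
noncomputable def qPochInv (p : ℝ) (m : ℤ) : ℝ :=
  if m < 0 then 0 else (∏ k ∈ range m.toNat, (1 - p ^ (k + 1)))⁻¹

lemma one_sub_pow_succ_pos {p : ℝ} (h0 : 0 < p) (h1 : p < 1) (k : ℕ) : 0 < 1 - p ^ (k + 1) :=
  sub_pos.2 (pow_lt_one₀ h0.le h1 k.succ_ne_zero)

lemma qPochInv_sub_one {p : ℝ} (h0 : 0 < p) (h1 : p < 1) (m : ℤ) :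
    qPochInv p (m - 1) = (1 - p ^ m) * qPochInv p m := by
  rcases lt_trichotomy m 0 with hm | rfl | hm
  · simp [qPochInv, hm, show m - 1 < 0 by lia]
  · simp [qPochInv]
  · obtain ⟨k, rfl⟩ : ∃ k : ℕ, m = k + 1 := ⟨(m - 1).toNat, by lia⟩
    have hk : ((k : ℤ) + 1).toNat = k + 1 := by lia
    have hk' : ¬ ((k : ℤ) + 1 < 0) := by lia
    have hz : p ^ ((k : ℤ) + 1) = p ^ (k + 1) := by exact_mod_cast zpow_natCast p (k + 1)
    have hpos := (one_sub_pow_succ_pos h0 h1 k).ne'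
    simp only [qPochInv, add_sub_cancel_right, hk, hk', if_false, prod_range_succ, hz, mul_inv,
      Int.toNat_natCast]
    rw [if_neg (by lia)]
    field_simp

/-- MacMahon's finite form of the Jacobi triple product. -/
lemma hasSum_finite_triple_product {r a : ℝ} (h0 : 0 < r) (h1 : r < 1) (ha : a ≠ 0) (n : ℕ) :
    HasSum (fun j : ℤ ↦ a ^ j * r ^ (j * (j - 1)) *
        ((∏ k ∈ range (2 * n), (1 - (r ^ 2) ^ (k + 1))) *
          (qPochInv (r ^ 2) (n - j) * qPochInv (r ^ 2) (n + j))))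
      (∏ k ∈ range n, ((1 + a * (r ^ 2) ^ k) * (1 + (r ^ 2) ^ (k + 1) / a))) := by
  have hp0 : 0 < r ^ 2 := by positivity
  have hp1 : r ^ 2 < 1 := pow_lt_one₀ h0.le h1 two_ne_zero
  induction n with
  | zero =>
    convert hasSum_single (0 : ℤ) ?_ using 1
    · simp [qPochInv]
    · intro j hj
      rcases lt_or_gt_of_ne hj with h | h
      · simp [qPochInv, h]
      · simp [qPochInv, h]
  | succ n ih =>
    have hm := (Equiv.subRight (1 : ℤ)).hasSum_iff.2 ih
    have hp := (Equiv.addRight (1 : ℤ)).hasSum_iff.2 ih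
    have key := ((ih.mul_left (1 + (r ^ 2) ^ (2 * n + 1))).add
      (hm.mul_left (a * (r ^ 2) ^ n))).add (hp.mul_left ((r ^ 2) ^ (n + 1) / a))
    refine (congrArg₂ (fun f s ↦ HasSum f s) (funext fun j ↦ ?_) ?_).mpr key
    · simp only [Function.comp, Equiv.subRight_apply, Equiv.coe_addRight]
      have hmul : 2 * (n + 1) = 2 * n + 1 + 1 := by ring
      have e1 : ((n + 1 : ℕ) : ℤ) - j = n + 1 - j := by push_cast; ring
      have e2 : ((n + 1 : ℕ) : ℤ) + j = n + 1 + j := by push_cast; ring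
      have e3 : (n : ℤ) - (j - 1) = n + 1 - j := by ring
      have e4 : (n : ℤ) + (j - 1) = n + 1 + j - 1 - 1 := by ring
      have e5 : (n : ℤ) - (j + 1) = n + 1 - j - 1 - 1 := by ring
      have e6 : (n : ℤ) + (j + 1) = n + 1 + j := by ring
      have e7 : (n : ℤ) - j = n + 1 - j - 1 := by ring
      have e8 : (n : ℤ) + j = n + 1 + j - 1 := by ring
      rw [hmul, prod_range_succ, prod_range_succ, e1, e2, e3, e4, e5, e6, e7, e8]
      simp only [qPochInv_sub_one hp0 hp1]
      generalize qPochInv (r ^ 2) (n + 1 - j) = U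
      generalize qPochInv (r ^ 2) (n + 1 + j) = V
      generalize ∏ k ∈ range (2 * n), (1 - (r ^ 2) ^ (k + 1)) = W
      have hr := h0.ne'
      have q1 : r ^ ((j - 1) * (j - 1 - 1)) = r ^ (j * (j - 1)) * (r ^ j)⁻¹ ^ 2 * r ^ 2 := by
        rw [← zpow_neg, ← zpow_natCast, ← zpow_natCast, ← zpow_mul, ← zpow_add₀ hr,
          ← zpow_add₀ hr]
        congr 1; push_cast; ring
      have q2 : r ^ ((j + 1) * (j + 1 - 1)) = r ^ (j * (j - 1)) * (r ^ j) ^ 2 := by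
        rw [← zpow_natCast, ← zpow_mul, ← zpow_add₀ hr]
        congr 1; push_cast; ring
      rw [q1, q2]
      generalize r ^ (j * (j - 1)) = R
      have z1 : ∀ m : ℤ, (r ^ 2) ^ m = (r ^ m) ^ 2 := fun m ↦ by
        rw [← zpow_natCast, ← zpow_natCast, ← zpow_mul, ← zpow_mul, mul_comm]
      simp only [z1, zpow_add₀ hr, zpow_sub₀ hr, zpow_add₀ ha, zpow_sub₀ ha, zpow_one,
        zpow_natCast]
      have hj : r ^ j ≠ 0 := zpow_ne_zero _ hr
      generalize r ^ j = J at *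
      generalize a ^ j = A
      field_simp
      ring
    · rw [prod_range_succ]
      field_simp
      ring

lemma summable_zpow_mul_zpow {r a : ℝ} (h0 : 0 < r) (h1 : r < 1) (ha : a ≠ 0) :
    Summable (fun j : ℤ ↦ a ^ j * r ^ (j * (j - 1))) := by
  have aux : ∀ b : ℝ, b ≠ 0 → Summable (fun n : ℕ ↦ b ^ n * r ^ ((n : ℤ) * (n - 1))) := by
    intro b hb
    refine summable_of_ratio_test_tendsto_lt_one (l := 0) one_pos ?_ ?_
    · exact .of_forall fun n ↦ mul_ne_zero (pow_ne_zero _ hb) (zpow_ne_zero _ h0.ne')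
    · have : Tendsto (fun n : ℕ ↦ |b| * (r ^ 2) ^ n) atTop (𝓝 (|b| * 0)) :=
        (tendsto_pow_atTop_nhds_zero_of_lt_one (by positivity)
          (pow_lt_one₀ h0.le h1 two_ne_zero)).const_mul _
      rw [mul_zero] at this
      refine this.congr fun n ↦ ?_
      have hz : r ^ (((n + 1 : ℕ) : ℤ) * ((n + 1 : ℕ) - 1)) =
          r ^ ((n : ℤ) * (n - 1)) * (r ^ 2) ^ n := by
        rw [← pow_mul, ← zpow_natCast r (2 * n), ← zpow_add₀ h0.ne']
        congr 1; push_cast; ring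
      rw [hz]
      have : r ^ ((n : ℤ) * (n - 1)) ≠ 0 := zpow_ne_zero _ h0.ne'
      simp only [norm_mul, norm_pow, norm_eq_abs, abs_of_pos h0,
        abs_of_pos (zpow_pos h0 ((n : ℤ) * (n - 1)))]
      have hb' := abs_pos.2 hb
      field_simp
      ring
  refine Summable.of_nat_of_neg (by simpa using aux a ha) ?_
  refine (aux (a⁻¹ * r ^ 2) (by positivity)).congr fun n ↦ ?_
  rw [mul_pow, mul_assoc, ← pow_mul, ← zpow_natCast r (2 * n), ← zpow_add₀ h0.ne', zpow_neg,
    zpow_natCast, inv_pow]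
  congr 2; push_cast; ring

lemma summable_norm_mul_pow {r : ℝ} (h0 : 0 < r) (h1 : r < 1) (c : ℝ) :
    Summable (fun k : ℕ ↦ ‖c * r ^ k‖) := by
  simpa [abs_mul, abs_of_pos h0] using
    (summable_geometric_of_lt_one h0.le h1).mul_left |c|

lemma multipliable_one_add_mul_pow {p : ℝ} (h0 : 0 < p) (h1 : p < 1) (c : ℝ) :
    Multipliable (fun k : ℕ ↦ 1 + c * p ^ k) :=
  multipliable_one_add_of_summable (summable_norm_mul_pow h0 h1 c)

lemma multipliable_one_sub_mul_pow {p : ℝ} (h0 : 0 < p) (h1 : p < 1) (c : ℝ) :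
    Multipliable (fun k : ℕ ↦ 1 - c * p ^ k) := by
  simpa [sub_eq_add_neg] using multipliable_one_add_mul_pow h0 h1 (-c)

lemma tprod_one_sub_mul_pow_pos {p c : ℝ} (h0 : 0 < p) (h1 : p < 1) (hc0 : 0 < c) (hc1 : c < 1) :
    0 < ∏' k : ℕ, (1 - c * p ^ k) := by
  have hpos : ∀ k : ℕ, 0 < 1 - c * p ^ k := fun k ↦ by
    have := pow_le_one₀ h0.le h1.le (n := k)
    have := pow_pos h0 k
    nlinarith
  have hne : ∏' k : ℕ, (1 + -c * p ^ k) ≠ 0 :=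
    tprod_one_add_ne_zero_of_summable (fun k ↦ by have := hpos k; linarith)
      (summable_norm_mul_pow h0 h1 (-c))
  refine lt_of_le_of_ne ?_ (by simpa [sub_eq_add_neg] using hne.symm)
  exact ge_of_tendsto' (multipliable_one_sub_mul_pow h0 h1 c).tendsto_prod_tprod_nat
    fun n ↦ prod_nonneg fun k _ ↦ (hpos k).le

/-- The Jacobi triple product identity. -/
lemma tsum_eq_triple_product {r a : ℝ} (h0 : 0 < r) (h1 : r < 1) (ha : a ≠ 0) :
    ∑' j : ℤ, a ^ j * r ^ (j * (j - 1)) =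
      (∏' k : ℕ, (1 + a * (r ^ 2) ^ k)) * (∏' k : ℕ, (1 + r ^ 2 / a * (r ^ 2) ^ k)) *
        ∏' k : ℕ, (1 - r ^ 2 * (r ^ 2) ^ k) := by
  set p := r ^ 2
  have hp0 : 0 < p := by positivity
  have hp1 : p < 1 := pow_lt_one₀ h0.le h1 two_ne_zero
  set P := ∏' k : ℕ, (1 - p * p ^ k)
  have hPpos : 0 < P := tprod_one_sub_mul_pow_pos hp0 hp1 hp0 hp1
  have hlim : Tendsto (fun n : ℕ ↦ ∏ k ∈ range n, (1 - p ^ (k + 1))) atTop (𝓝 P) := by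
    simpa only [pow_succ'] using
      (multipliable_one_sub_mul_pow hp0 hp1 p).tendsto_prod_tprod_nat
  have hanti : Antitone (fun n : ℕ ↦ ∏ k ∈ range n, (1 - p ^ (k + 1))) := by
    refine antitone_nat_of_succ_le fun n ↦ ?_
    rw [prod_range_succ]
    refine mul_le_of_le_one_right (prod_nonneg fun k _ ↦ (one_sub_pow_succ_pos hp0 hp1 k).le) ?_
    have := pow_pos hp0 (n + 1)
    linarith
  have hu0 : ∀ m, 0 ≤ qPochInv p m := fun m ↦ by
    unfold qPochInv
    split_ifs
    · rfl
    · exact inv_nonneg.2 (prod_nonneg fun k _ ↦ (one_sub_pow_succ_pos hp0 hp1 k).le)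
  have hu1 : ∀ m, qPochInv p m ≤ P⁻¹ := fun m ↦ by
    unfold qPochInv
    split_ifs
    · exact (inv_pos.2 hPpos).le
    · exact inv_anti₀ hPpos (hanti.le_of_tendsto hlim _)
  have hulim : Tendsto (qPochInv p) atTop (𝓝 P⁻¹) := by
    have h2 : Tendsto (fun m : ℤ ↦ (∏ k ∈ range m.toNat, (1 - p ^ (k + 1)))⁻¹) atTop (𝓝 P⁻¹) := by
      refine (hlim.comp ?_).inv₀ hPpos.ne'
      exact tendsto_atTop_atTop.2 fun b ↦ ⟨b, fun m hm ↦ by lia⟩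
    refine h2.congr' ?_
    filter_upwards [eventually_ge_atTop 0] with m hm
    simp [qPochInv, not_lt.2 hm]
  have hc : Tendsto (fun n : ℕ ↦ (n : ℤ)) atTop atTop := tendsto_natCast_atTop_atTop
  have hfin : Tendsto (fun n : ℕ ↦ ∑' j : ℤ, a ^ j * r ^ (j * (j - 1)) *
        ((∏ k ∈ range (2 * n), (1 - p ^ (k + 1))) *
          (qPochInv p (n - j) * qPochInv p (n + j)))) atTop
      (𝓝 (∑' j : ℤ, a ^ j * r ^ (j * (j - 1)) * (P * (P⁻¹ * P⁻¹)))) := by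
    refine tendsto_tsum_of_dominated_convergence
      (bound := fun j : ℤ ↦ ‖a ^ j * r ^ (j * (j - 1))‖ * (1 * (P⁻¹ * P⁻¹)))
      ((summable_zpow_mul_zpow h0 h1 ha).norm.mul_right _) (fun j ↦ ?_) (.of_forall fun n j ↦ ?_)
    · refine Tendsto.const_mul _ (Tendsto.mul ?_ (Tendsto.mul ?_ ?_))
      · exact hlim.comp (tendsto_id.const_mul_atTop' two_pos)
      · exact hulim.comp (by simpa [sub_eq_add_neg] using tendsto_atTop_add_const_right _ (-j) hc)
      · exact hulim.comp (tendsto_atTop_add_const_right _ j hc)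
    · have hW0 := prod_nonneg (s := range (2 * n))
        (fun k _ ↦ (one_sub_pow_succ_pos hp0 hp1 k).le)
      have hW1 := hanti (Nat.zero_le (2 * n))
      simp only [range_zero, prod_empty] at hW1
      rw [norm_mul]
      refine mul_le_mul_of_nonneg_left ?_ (norm_nonneg _)
      rw [norm_of_nonneg (mul_nonneg hW0 (mul_nonneg (hu0 _) (hu0 _)))]
      gcongr
      all_goals first | exact mul_nonneg (hu0 _) (hu0 _) | exact hu0 _ | exact hu1 _
  have hprod : Tendsto (fun n : ℕ ↦
      ∏ k ∈ range n, ((1 + a * p ^ k) * (1 + p ^ (k + 1) / a))) atTop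
      (𝓝 ((∏' k : ℕ, (1 + a * p ^ k)) * ∏' k : ℕ, (1 + p / a * p ^ k))) := by
    simp only [prod_mul_distrib]
    refine (multipliable_one_add_mul_pow hp0 hp1 a).tendsto_prod_tprod_nat.mul ?_
    refine (multipliable_one_add_mul_pow hp0 hp1 (p / a)).tendsto_prod_tprod_nat.congr fun n ↦ ?_
    exact prod_congr rfl fun k _ ↦ by ring
  have := tendsto_nhds_unique hprod
    (hfin.congr fun n ↦ (hasSum_finite_triple_product h0 h1 ha n).tsum_eq)
  rw [this, tsum_mul_right]
  field_simp

/-- Splitting a double series over `ℤ × ℤ` along the parity of `i + j`, with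
`(i, j) = (k - l, k + l)` or `(i, j) = (k - l, k + l + 1)`. -/
lemma tsum_mul_tsum_eq_of_parity {g h s t : ℤ → ℝ} {c : ℝ} (hg : Summable g) (hh : Summable h)
    (hs : Summable s) (ht : Summable t)
    (heven : ∀ k l, g (k - l) * h (k + l) = s k * s l)
    (hodd : ∀ k l, g (k - l) * h (k + l + 1) = c * (t (-k) * t (-l))) :
    (∑' k, g k) * ∑' k, h k = (∑' k, s k) ^ 2 + c * (∑' k, t k) ^ 2 := by
  have prod_hasSum : ∀ {u v : ℤ → ℝ}, Summable u → Summable v →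
      HasSum (fun z : ℤ × ℤ ↦ u z.1 * v z.2) ((∑' k, u k) * ∑' k, v k) := fun hu hv ↦
    hu.hasSum.mul hv.hasSum (summable_mul_of_summable_norm hu.norm hv.norm)
  have ht' : Summable (fun k ↦ t (-k)) := (Equiv.neg ℤ).summable_iff.2 ht
  have htt : ∑' k, t (-k) = ∑' k, t k := (Equiv.neg ℤ).tsum_eq t
  set f : ℤ × ℤ → ℝ := fun z ↦ g z.1 * h z.2
  let e₀ : ℤ × ℤ → ℤ × ℤ := fun z ↦ (z.1 - z.2, z.1 + z.2)
  let e₁ : ℤ × ℤ → ℤ × ℤ := fun z ↦ (z.1 - z.2, z.1 + z.2 + 1)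
  have he₀ : Function.Injective e₀ := by
    rintro ⟨a, b⟩ ⟨c, d⟩ h
    simp only [e₀, Prod.mk.injEq] at h ⊢
    lia
  have he₁ : Function.Injective e₁ := by
    rintro ⟨a, b⟩ ⟨c, d⟩ h
    simp only [e₁, Prod.mk.injEq] at h ⊢
    lia
  have h₀ : HasSum (f ∘ e₀) ((∑' k, s k) ^ 2) := by
    rw [sq]
    exact (prod_hasSum hs hs).congr_fun fun z ↦ heven z.1 z.2
  have h₁ : HasSum (f ∘ e₁) (c * (∑' k, t k) ^ 2) := by
    rw [sq, ← htt]
    exact ((prod_hasSum ht' ht').mul_left c).congr_fun fun z ↦ hodd z.1 z.2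
  have hcompl : IsCompl (Set.range e₀) (Set.range e₁) := by
    refine ⟨Set.disjoint_left.2 ?_, codisjoint_iff_le_sup.2 ?_⟩
    · rintro _ ⟨⟨k, l⟩, rfl⟩ ⟨⟨k', l'⟩, h⟩
      simp only [e₀, e₁, Prod.mk.injEq] at h
      lia
    · rintro ⟨i, j⟩ -
      rcases Int.even_or_odd' (i + j) with ⟨m, hm | hm⟩
      · exact Or.inl ⟨(m, m - i), Prod.ext (by simp [e₀]) (by simp only [e₀]; lia)⟩
      · exact Or.inr ⟨(m, m - i), Prod.ext (by simp [e₁]) (by simp only [e₁]; lia)⟩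
  exact (prod_hasSum hg hh).unique
    ((he₀.hasSum_range_iff.2 h₀).add_isCompl hcompl (he₁.hasSum_range_iff.2 h₁))

/-- Ramanujan's theta series `∑ a ^ j r ^ (j (j - 1))` over the integers. -/
noncomputable def thetaSeries (r a : ℝ) : ℝ := ∑' j : ℤ, a ^ j * r ^ (j * (j - 1))

lemma sign_mul_pow_zpow_mul_zpow {q : ℝ} (h0 : 0 < q) (σ : ℝ) (α β : ℕ) (j : ℤ) :
    (σ * q ^ α) ^ j * (q ^ β) ^ (j * (j - 1)) = σ ^ j * q ^ (α * j + β * (j * (j - 1))) := by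
  rw [mul_zpow, ← zpow_natCast, ← zpow_natCast, ← zpow_mul, ← zpow_mul, mul_assoc,
    ← zpow_add₀ h0.ne']

lemma neg_one_zpow_neg (k : ℤ) : (-1 : ℝ) ^ (-k) = (-1) ^ k := by
  rw [zpow_neg, ← inv_zpow, inv_neg_one]

lemma summable_sign_mul_pow {q : ℝ} (h0 : 0 < q) (h1 : q < 1) {σ : ℝ} (hσ : σ ≠ 0) (α : ℕ)
    {β : ℕ} (hβ : β ≠ 0) :
    Summable (fun j : ℤ ↦ (σ * q ^ α) ^ j * (q ^ β) ^ (j * (j - 1))) :=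
  summable_zpow_mul_zpow (by positivity) (pow_lt_one₀ h0.le h1 hβ) (by positivity)

/-- In Ramanujan's notation, `φ(q)² = φ(q²)² + 4 q ψ(q⁴)²`. -/
lemma thetaSeries_self_sq {q : ℝ} (h0 : 0 < q) (h1 : q < 1) :
    thetaSeries q q ^ 2 =
      thetaSeries (q ^ 2) (q ^ 2) ^ 2 + q * thetaSeries (q ^ 2) 1 ^ 2 := by
  have key := tsum_mul_tsum_eq_of_parity (c := q)
    (summable_sign_mul_pow h0 h1 one_ne_zero 1 one_ne_zero)
    (summable_sign_mul_pow h0 h1 one_ne_zero 1 one_ne_zero)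
    (summable_sign_mul_pow h0 h1 one_ne_zero 2 two_ne_zero)
    (summable_sign_mul_pow h0 h1 one_ne_zero 0 two_ne_zero) (fun k l ↦ ?_) (fun k l ↦ ?_)
  · simpa [thetaSeries, ← sq] using key
  · simp only [sign_mul_pow_zpow_mul_zpow h0]
    simp only [one_zpow, one_mul, ← zpow_add₀ h0.ne']
    congr 1; push_cast; ring
  · simp only [sign_mul_pow_zpow_mul_zpow h0]
    simp only [one_zpow, one_mul, ← zpow_add₀ h0.ne',
      ← zpow_one_add₀ h0.ne']
    congr 1; push_cast; ring

/-- In Ramanujan's notation, `φ(q²) ψ(-q) = f(-q³, -q⁵)² - q f(-q, -q⁷)²`. -/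
lemma thetaSeries_mul_thetaSeries {q : ℝ} (h0 : 0 < q) (h1 : q < 1) :
    thetaSeries (q ^ 2) (q ^ 2) * thetaSeries (q ^ 2) (-q) =
      thetaSeries (q ^ 4) (-q ^ 3) ^ 2 - q * thetaSeries (q ^ 4) (-q) ^ 2 := by
  have hneg : (-1 : ℝ) ≠ 0 := by norm_num
  have key := tsum_mul_tsum_eq_of_parity (c := -q)
    (summable_sign_mul_pow h0 h1 one_ne_zero 2 two_ne_zero)
    (summable_sign_mul_pow h0 h1 hneg 1 two_ne_zero)
    (summable_sign_mul_pow h0 h1 hneg 3 four_ne_zero)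
    (summable_sign_mul_pow h0 h1 hneg 1 four_ne_zero) (fun k l ↦ ?_) (fun k l ↦ ?_)
  · simpa [thetaSeries, sub_eq_add_neg] using key
  · simp only [sign_mul_pow_zpow_mul_zpow h0]
    simp only [one_zpow, one_mul]
    rw [zpow_add₀ hneg, mul_left_comm, ← zpow_add₀ h0.ne', mul_mul_mul_comm, ← zpow_add₀ h0.ne']
    congr 2; push_cast; ring
  · simp only [sign_mul_pow_zpow_mul_zpow h0]
    simp only [one_zpow, one_mul]
    rw [zpow_add₀ hneg, zpow_add₀ hneg, zpow_one, mul_left_comm, ← zpow_add₀ h0.ne',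
      mul_mul_mul_comm, ← zpow_add₀ h0.ne', neg_one_zpow_neg, neg_one_zpow_neg, neg_mul q,
      mul_left_comm q, ← zpow_one_add₀ h0.ne', mul_neg_one, neg_mul]
    congr 3; push_cast; ring

lemma tprod_one_sub_even_mul_odd {p : ℝ} (h0 : 0 < p) (h1 : p < 1) (c : ℝ) :
    ∏' k : ℕ, (1 - c * p ^ k) =
      (∏' k : ℕ, (1 - c * (p ^ 2) ^ k)) * ∏' k : ℕ, (1 - c * p * (p ^ 2) ^ k) := by
  have hp0 : 0 < p ^ 2 := by positivity
  have hp1 : p ^ 2 < 1 := pow_lt_one₀ h0.le h1 two_ne_zero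
  rw [← tprod_even_mul_odd (f := fun k ↦ 1 - c * p ^ k)]
  · simp only [pow_mul, pow_succ', mul_assoc]
  · simpa only [pow_mul] using multipliable_one_sub_mul_pow hp0 hp1 c
  · simpa only [pow_mul, pow_succ', mul_assoc] using multipliable_one_sub_mul_pow hp0 hp1 (c * p)

/-- In Ramanujan's notation, `f(-q, -q⁷) = (q; q⁸)_∞ (q⁷; q⁸)_∞ (q⁸; q⁸)_∞` and its analogue for
`f(-q³, -q⁵)`. -/
lemma thetaSeries_pow_four_eq_tprod {q : ℝ} (h0 : 0 < q) (h1 : q < 1) {i j : ℕ}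
    (hij : i + j = 8) :
    thetaSeries (q ^ 4) (-q ^ i) =
      (∏' k : ℕ, (1 - q ^ i * (q ^ 8) ^ k)) * (∏' k : ℕ, (1 - q ^ j * (q ^ 8) ^ k)) *
        ∏' k : ℕ, (1 - q ^ 8 * (q ^ 8) ^ k) := by
  have hd : (q ^ 4) ^ 2 / -q ^ i = -q ^ j := by
    rw [← pow_mul, show 4 * 2 = j + i by lia, pow_add, div_neg, mul_div_cancel_right₀]
    positivity
  rw [thetaSeries, tsum_eq_triple_product (by positivity) (pow_lt_one₀ h0.le h1 four_ne_zero)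
    (by simp [h0.ne']), hd]
  simp only [neg_mul, ← sub_eq_add_neg, ← pow_mul, Nat.reduceMul]

lemma thetaSeries_sq_neg_eq_tprod {q : ℝ} (h0 : 0 < q) (h1 : q < 1) :
    thetaSeries (q ^ 2) (-q) =
      (∏' k : ℕ, (1 - q * (q ^ 4) ^ k)) * (∏' k : ℕ, (1 - q ^ 3 * (q ^ 4) ^ k)) *
        ∏' k : ℕ, (1 - q ^ 4 * (q ^ 4) ^ k) := by
  have hd : (q ^ 2) ^ 2 / -q = -q ^ 3 := by field_simp
  rw [thetaSeries, tsum_eq_triple_product (by positivity) (pow_lt_one₀ h0.le h1 two_ne_zero)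
    (by simp [h0.ne']), hd]
  simp only [neg_mul, ← sub_eq_add_neg, ← pow_mul, Nat.reduceMul]

lemma tprod_one_add_mul_tprod_one_sub {p : ℝ} (h0 : 0 < p) (h1 : p < 1) :
    (∏' k : ℕ, (1 + p * p ^ k)) * ∏' k : ℕ, (1 - p * p ^ k) =
      ∏' k : ℕ, (1 - p ^ 2 * (p ^ 2) ^ k) := by
  rw [← (multipliable_one_add_mul_pow h0 h1 p).tprod_mul (multipliable_one_sub_mul_pow h0 h1 p)]
  exact tprod_congr fun k ↦ by ring

lemma tprod_one_add_pow {p : ℝ} (h0 : 0 < p) (h1 : p < 1) :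
    ∏' k : ℕ, (1 + p ^ k) = 2 * ∏' k : ℕ, (1 + p * p ^ k) := by
  have hm : Multipliable fun k : ℕ ↦ 1 + p ^ (k + 1) := by
    simpa only [pow_succ'] using multipliable_one_add_mul_pow h0 h1 p
  rw [tprod_eq_zero_mul' (f := fun k : ℕ ↦ 1 + p ^ k) hm]
  simp only [pow_succ', pow_zero, one_add_one_eq_two]

/-- In Ramanujan's notation, `ψ(q⁴) = (-q⁴; q⁴)_∞ (q⁸; q⁸)_∞`. -/
lemma thetaSeries_sq_one_eq_tprod {q : ℝ} (h0 : 0 < q) (h1 : q < 1) :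
    thetaSeries (q ^ 2) 1 =
      2 * (∏' k : ℕ, (1 + q ^ 4 * (q ^ 4) ^ k)) * ∏' k : ℕ, (1 - q ^ 8 * (q ^ 8) ^ k) := by
  have hp0 : 0 < q ^ 4 := by positivity
  have hp1 : q ^ 4 < 1 := pow_lt_one₀ h0.le h1 four_ne_zero
  have hshift := tprod_one_add_pow hp0 hp1
  have hmul := tprod_one_add_mul_tprod_one_sub hp0 hp1
  rw [thetaSeries, tsum_eq_triple_product (by positivity) (pow_lt_one₀ h0.le h1 two_ne_zero)
    one_ne_zero]
  simp only [div_one, one_mul, ← pow_mul q 2 2, ← pow_mul q 4 2, Nat.reduceMul] at hmul ⊢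
  rw [hshift, mul_assoc, hmul]

/-- In Ramanujan's notation, `ψ(-q) ψ(q⁴) = f(-q, -q⁷) f(-q³, -q⁵)`. -/
lemma thetaSeries_neg_mul_thetaSeries_one {q : ℝ} (h0 : 0 < q) (h1 : q < 1) :
    thetaSeries (q ^ 2) (-q) * thetaSeries (q ^ 2) 1 =
      2 * (thetaSeries (q ^ 4) (-q) * thetaSeries (q ^ 4) (-q ^ 3)) := by
  have hp0 : 0 < q ^ 4 := by positivity
  have hp1 : q ^ 4 < 1 := pow_lt_one₀ h0.le h1 four_ne_zero
  have h17 := thetaSeries_pow_four_eq_tprod h0 h1 (i := 1) (j := 7) rfl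
  have h35 := thetaSeries_pow_four_eq_tprod h0 h1 (i := 3) (j := 5) rfl
  have s1 := tprod_one_sub_even_mul_odd hp0 hp1 q
  have s3 := tprod_one_sub_even_mul_odd hp0 hp1 (q ^ 3)
  have hmul := tprod_one_add_mul_tprod_one_sub hp0 hp1
  simp only [pow_one] at h17
  have e5 : q * q ^ 4 = q ^ 5 := by ring
  have e7 : q ^ 3 * q ^ 4 = q ^ 7 := by ring
  simp only [← pow_mul q 4 2, Nat.reduceMul, e5, e7] at s1 s3 hmul
  rw [thetaSeries_sq_neg_eq_tprod h0 h1, thetaSeries_sq_one_eq_tprod h0 h1, h17, h35]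
  rw [s1, s3, ← hmul]
  ring

lemma exp_neg_mul_eq_pow (x : ℝ) (i n : ℕ) :
    rexp (-((8 * n + i) * x)) = rexp (-x) ^ i * (rexp (-x) ^ 8) ^ n := by
  rw [← pow_mul, ← pow_add, ← exp_nat_mul]
  congr 1; push_cast; ring

lemma H_mul_thetaSeries {x : ℝ} (hx : 0 < x) :
    H x * thetaSeries (rexp (-x) ^ 4) (-rexp (-x) ^ 3) =
      rexp (-x / 2) * thetaSeries (rexp (-x) ^ 4) (-rexp (-x)) := by
  have h0 := exp_pos (-x)
  have h1 : rexp (-x) < 1 := exp_lt_one_iff.2 (by linarith)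
  have e1 := fun n ↦ exp_neg_mul_eq_pow x 1 n
  have e3 := fun n ↦ exp_neg_mul_eq_pow x 3 n
  have e5 := fun n ↦ exp_neg_mul_eq_pow x 5 n
  have e7 := fun n ↦ exp_neg_mul_eq_pow x 7 n
  have h17 := thetaSeries_pow_four_eq_tprod h0 h1 (i := 1) (j := 7) rfl
  have h35 := thetaSeries_pow_four_eq_tprod h0 h1 (i := 3) (j := 5) rfl
  push_cast at e1 e3 e5 e7
  simp only [H, e1, e3, e5, e7]
  generalize rexp (-x) = q at *
  rw [pow_one] at h17
  rw [h17, h35]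
  have hp0 : 0 < q ^ 8 := by positivity
  have hp1 : q ^ 8 < 1 := pow_lt_one₀ h0.le h1 (by norm_num)
  have hm := multipliable_one_sub_mul_pow hp0 hp1
  have hpos := fun i : ℕ ↦ fun hi : i ≠ 0 ↦
    (tprod_one_sub_mul_pow_pos hp0 hp1 (pow_pos h0 i) (pow_lt_one₀ h0.le h1 hi)).ne'
  have h3 := hpos 3 (by norm_num)
  have h5 := hpos 5 (by norm_num)
  rw [Multipliable.tprod_div₀ ((hm _).mul (hm _)) ((hm _).mul (hm _)), (hm _).tprod_mul (hm _),
    (hm _).tprod_mul (hm _), pow_one]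
  · field_simp
  · rw [(hm _).tprod_mul (hm _)]
    exact mul_ne_zero h3 h5

lemma thetaSeries_pow_four_pos {q : ℝ} (h0 : 0 < q) (h1 : q < 1) {i j : ℕ}
    (hij : i + j = 8) (hi : i ≠ 0) (hj : j ≠ 0) :
    0 < thetaSeries (q ^ 4) (-q ^ i) := by
  have hp1 : q ^ 8 < 1 := pow_lt_one₀ h0.le h1 (by norm_num)
  have hpos := fun i : ℕ ↦ fun hi : i ≠ 0 ↦
    tprod_one_sub_mul_pow_pos (pow_pos h0 8) hp1 (pow_pos h0 i) (pow_lt_one₀ h0.le h1 hi)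
  rw [thetaSeries_pow_four_eq_tprod h0 h1 hij]
  exact mul_pos (mul_pos (hpos i hi) (hpos j hj)) (hpos 8 (by norm_num))

lemma thetaSeries_self_nonneg {q : ℝ} (h0 : 0 < q) : 0 ≤ thetaSeries q q :=
  tsum_nonneg fun _ ↦ by positivity

lemma thetaSeries_exp_self (y : ℝ) :
    thetaSeries (rexp (-y)) (rexp (-y)) = ∑' n : ℤ, rexp (-y * (n : ℝ) ^ 2) := by
  refine tsum_congr fun n ↦ ?_
  rw [← zpow_add₀ (exp_pos _).ne', ← rpow_intCast, ← exp_mul]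
  congr 1; push_cast; ring

/-- The inversion formula for the theta function `φ` at the nome `e^(-π / √2)`. -/
lemma thetaSeries_inversion :
    thetaSeries (rexp (-(π * √2 / 2))) (rexp (-(π * √2 / 2))) ^ 2 =
      √2 * thetaSeries (rexp (-(π * √2 / 2)) ^ 2) (rexp (-(π * √2 / 2)) ^ 2) ^ 2 := by
  have hs : √2 ^ 2 = 2 := sq_sqrt zero_le_two
  have hs0 : 0 < √2 := by positivity
  have hsq : rexp (-(π * √2 / 2)) ^ 2 = rexp (-(π * √2)) := by
    rw [← exp_nat_mul]
    congr 1; push_cast; ring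
  rw [hsq, thetaSeries_exp_self, thetaSeries_exp_self]
  have key := Real.tsum_exp_neg_mul_int_sq hs0
  have e1 : -π * √2 = -(π * √2) := by ring
  have e2 : -π / √2 = -(π * √2 / 2) := by
    field_simp
    linarith
  rw [e1, e2, ← sqrt_eq_rpow] at key
  rw [key, mul_pow, div_pow, sq_sqrt hs0.le]
  field_simp

theorem H_pi_sqrt_two_div_two :
    H (π * Real.sqrt 2 / 2) =
      Real.sqrt (3 + 2 * Real.sqrt 2 - 2 * Real.sqrt (4 + 3 * Real.sqrt 2)) := by
  have hs : √2 ^ 2 = 2 := sq_sqrt zero_le_two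
  have hs0 : 0 < √2 := by positivity
  have hx : 0 < π * √2 / 2 := by positivity
  have hH := H_mul_thetaSeries hx
  have hinv := thetaSeries_inversion
  have hw : rexp (-(π * √2 / 2) / 2) ^ 2 = rexp (-(π * √2 / 2)) := by
    rw [← exp_nat_mul]
    congr 1; push_cast; ring
  have hw0 := exp_pos (-(π * √2 / 2) / 2)
  have h0 := exp_pos (-(π * √2 / 2))
  have h1 : rexp (-(π * √2 / 2)) < 1 := exp_lt_one_iff.2 (by linarith)
  generalize H (π * √2 / 2) = h at *
  generalize rexp (-(π * √2 / 2) / 2) = w at *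
  generalize rexp (-(π * √2 / 2)) = q at *
  have hf1 := thetaSeries_pow_four_pos h0 h1 (i := 1) (j := 7) rfl (by norm_num) (by norm_num)
  have hf3 := thetaSeries_pow_four_pos h0 h1 (i := 3) (j := 5) rfl (by norm_num) (by norm_num)
  rw [pow_one] at hf1
  have hφ := thetaSeries_self_sq h0 h1
  have hAD := thetaSeries_mul_thetaSeries h0 h1
  have hDB := thetaSeries_neg_mul_thetaSeries_one h0 h1
  have hA := thetaSeries_self_nonneg (pow_pos h0 2)
  have hB : 0 ≤ thetaSeries (q ^ 2) 1 := tsum_nonneg fun _ ↦ by positivity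
  rw [hinv] at hφ
  generalize thetaSeries (q ^ 4) (-q) = f at *
  generalize thetaSeries (q ^ 4) (-q ^ 3) = g at *
  generalize thetaSeries (q ^ 2) (-q) = D at *
  generalize thetaSeries (q ^ 2) 1 = B at *
  generalize thetaSeries (q ^ 2) (q ^ 2) = A at *
  subst hw
  have hh : 0 < h := pos_of_mul_pos_left (hH ▸ mul_pos hw0 hf1) hf3.le
  have hB0 : 0 < B := lt_of_le_of_ne hB fun hB' ↦ by
    rw [← hB', mul_zero] at hDB
    nlinarith [mul_pos hf1 hf3]
  have hA0 : 0 < A := lt_of_le_of_ne hA fun hA' ↦ by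
    have : 0 < w ^ 2 * B ^ 2 := by positivity
    rw [← hA'] at hφ
    linarith
  have hlin : (1 - h ^ 2) * (w * B) = 2 * A * h := by
    have : (1 - h ^ 2) * (w * B) * g ^ 2 = 2 * A * h * g ^ 2 := by
      calc (1 - h ^ 2) * (w * B) * g ^ 2 = w * B * (g ^ 2 - (h * g) ^ 2) := by ring
        _ = w * B * (g ^ 2 - w ^ 2 * f ^ 2) := by rw [hH]; ring
        _ = w * A * (D * B) := by rw [← hAD]; ring
        _ = 2 * A * (w * f) * g := by rw [hDB]; ring
        _ = 2 * A * h * g ^ 2 := by rw [← hH]; ring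
    exact mul_right_cancel₀ (by positivity) this
  have hlt : h ^ 2 < 1 := by
    have : 0 < (1 - h ^ 2) * (w * B) := by rw [hlin]; positivity
    linarith [pos_of_mul_pos_left this (by positivity)]
  have hquad : (1 - h ^ 2) ^ 2 = 4 * (√2 + 1) * h ^ 2 := by
    have hsB : A ^ 2 = (√2 + 1) * (w * B) ^ 2 := by
      linear_combination (√2 + 1) * hφ - A ^ 2 * hs
    have : (1 - h ^ 2) ^ 2 * (w * B) ^ 2 = 4 * (√2 + 1) * h ^ 2 * (w * B) ^ 2 := by
      rw [← mul_pow, hlin]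
      linear_combination 4 * h ^ 2 * hsB
    exact mul_right_cancel₀ (by positivity) this
  have hroot : √(4 + 3 * √2) = (3 + 2 * √2 - h ^ 2) / 2 := by
    rw [sqrt_eq_iff_mul_self_eq (by positivity) (by linarith)]
    linear_combination -hquad / 4 - hs
  rw [hroot]
  rw [show 3 + 2 * √2 - 2 * ((3 + 2 * √2 - h ^ 2) / 2) = h ^ 2 by ring, sqrt_sq hh.le]
end

section
/- With q = e^{−π}, one has (q^{1/24} · (2π^{3/4}/Γ(1/4)) · ∑_{k ∈ ℤ} q^{k(3k−1)/2})⁸ = 14/27 + 8/(3√3) + (1/2)·√(2048/243 + 3584/(243√3)), where Γ is the Gamma function and the bilateral sum ∑_{k∈ℤ} e^{−π k(3k−1)/2} converges absolutely. -/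
open Real

/-- The Gaussian sum `∑ w(n) exp(-π t n²)` over the integers, with weight `w`. -/
noncomputable def weightedTheta (w : ℤ → ℝ) (t : ℝ) : ℝ :=
  ∑' n : ℤ, w n * exp (-π * t * (n : ℝ) ^ 2)

/-- The theta constant `∑ exp(-π t n²)`. -/
noncomputable def theta (t : ℝ) : ℝ := weightedTheta (fun _ => 1) t

/-- The indicator function of a residue class. -/
def residueIndicator (m : ℕ) (i : ZMod m) (n : ℤ) : ℝ := if (n : ZMod m) = i then 1 else 0

lemma summable_exp_neg_pi_mul_sq {t : ℝ} (ht : 0 < t) :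
    Summable fun n : ℤ => exp (-π * t * (n : ℝ) ^ 2) := by
  have h := summable_pow_mul_jacobiTheta₂_term_bound 0 ht 0
  refine h.congr fun n => ?_
  simp
  ring_nf

lemma norm_weighted_le {w : ℤ → ℝ} (hw : ∀ n, |w n| ≤ 1) (t : ℝ) (n : ℤ) :
    ‖w n * exp (-π * t * (n : ℝ) ^ 2)‖ ≤ exp (-π * t * (n : ℝ) ^ 2) := by
  rw [norm_mul, norm_eq_abs, norm_of_nonneg (exp_pos _).le]
  exact mul_le_of_le_one_left (exp_pos _).le (hw n)

lemma summable_norm_weighted {w : ℤ → ℝ} (hw : ∀ n, |w n| ≤ 1) {t : ℝ} (ht : 0 < t) :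
    Summable fun n : ℤ => ‖w n * exp (-π * t * (n : ℝ) ^ 2)‖ :=
  (summable_exp_neg_pi_mul_sq ht).of_nonneg_of_le (fun _ => norm_nonneg _)
    (norm_weighted_le hw t)

lemma summable_weighted {w : ℤ → ℝ} (hw : ∀ n, |w n| ≤ 1) {t : ℝ} (ht : 0 < t) :
    Summable fun n : ℤ => w n * exp (-π * t * (n : ℝ) ^ 2) :=
  (summable_norm_weighted hw ht).of_norm

lemma abs_residueIndicator_le (m : ℕ) (i : ZMod m) (n : ℤ) : |residueIndicator m i n| ≤ 1 := by
  unfold residueIndicator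
  split_ifs <;> simp

lemma abs_mul_le_one {a b : ℝ} (ha : |a| ≤ 1) (hb : |b| ≤ 1) : |a * b| ≤ 1 := by
  rw [abs_mul]
  exact mul_le_one₀ ha (abs_nonneg _) hb

lemma hasSum_weighted_two {w₁ w₂ : ℤ → ℝ} (h₁ : ∀ n, |w₁ n| ≤ 1) (h₂ : ∀ n, |w₂ n| ≤ 1)
    {t₁ t₂ : ℝ} (ht₁ : 0 < t₁) (ht₂ : 0 < t₂) :
    HasSum (fun p : ℤ × ℤ => w₁ p.1 * w₂ p.2 *
      exp (-π * (t₁ * (p.1 : ℝ) ^ 2 + t₂ * (p.2 : ℝ) ^ 2)))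
      (weightedTheta w₁ t₁ * weightedTheta w₂ t₂) := by
  have s₁ := summable_norm_weighted h₁ ht₁
  have s₂ := summable_norm_weighted h₂ ht₂
  have h := (summable_mul_of_summable_norm s₁ s₂).hasSum
  rw [← tsum_mul_tsum_of_summable_norm s₁ s₂] at h
  refine Eq.mp (congrArg (HasSum · _) (funext fun p => ?_)) h
  rw [mul_mul_mul_comm, ← exp_add]
  ring_nf

lemma hasSum_weighted_three {w₁ w₂ w₃ : ℤ → ℝ} (h₁ : ∀ n, |w₁ n| ≤ 1) (h₂ : ∀ n, |w₂ n| ≤ 1)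
    (h₃ : ∀ n, |w₃ n| ≤ 1) {t₁ t₂ t₃ : ℝ} (ht₁ : 0 < t₁) (ht₂ : 0 < t₂) (ht₃ : 0 < t₃) :
    HasSum (fun p : ℤ × ℤ × ℤ => w₁ p.1 * w₂ p.2.1 * w₃ p.2.2 *
      exp (-π * (t₁ * (p.1 : ℝ) ^ 2 + t₂ * (p.2.1 : ℝ) ^ 2 + t₃ * (p.2.2 : ℝ) ^ 2)))
      (weightedTheta w₁ t₁ * weightedTheta w₂ t₂ * weightedTheta w₃ t₃) := by
  have s₁ := summable_norm_weighted h₁ ht₁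
  have s₂ := summable_norm_weighted h₂ ht₂
  have s₃ := summable_norm_weighted h₃ ht₃
  have s₂₃ := summable_mul_of_summable_norm s₂ s₃
  have h := (summable_mul_of_summable_norm s₁ s₂₃.norm).hasSum
  rw [← tsum_mul_tsum_of_summable_norm s₁ s₂₃.norm, ← tsum_mul_tsum_of_summable_norm s₂ s₃,
    ← mul_assoc] at h
  refine Eq.mp (congrArg (HasSum · _) (funext fun p => ?_)) h
  have e : exp (-π * (t₁ * (p.1 : ℝ) ^ 2 + t₂ * (p.2.1 : ℝ) ^ 2 + t₃ * (p.2.2 : ℝ) ^ 2)) =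
    exp (-π * t₁ * (p.1 : ℝ) ^ 2) * (exp (-π * t₂ * (p.2.1 : ℝ) ^ 2) *
      exp (-π * t₃ * (p.2.2 : ℝ) ^ 2)) := by
    rw [← exp_add, ← exp_add]
    ring_nf
  rw [e]
  ring

lemma sum_residueIndicator_mul_neg (m : ℕ) [NeZero m] (a b : ℤ) :
    ∑ i : ZMod m, residueIndicator m i a * residueIndicator m (-i) b =
      if ((a + b : ℤ) : ZMod m) = 0 then 1 else 0 := by
  simp only [residueIndicator, ite_mul, one_mul, zero_mul, Finset.sum_ite_eq, Finset.mem_univ,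
    if_true, Int.cast_add, add_eq_zero_iff_eq_neg']

theorem weightedTheta_sq {ε : ℤ → ℝ} (hε : ∀ n, |ε n| ≤ 1)
    (hadd : ∀ m n, ε (m + n) = ε m * ε n) {t : ℝ} (ht : 0 < t) :
    weightedTheta ε t ^ 2 = ∑ i : ZMod 2,
      weightedTheta (fun n => ε n * residueIndicator 2 i n) (t / 2) *
        weightedTheta (residueIndicator 2 (-i)) (t / 2) := by
  have hL := hasSum_weighted_two hε hε ht ht
  have hR := hasSum_sum fun (i : ZMod 2) (_ : i ∈ Finset.univ) =>
    hasSum_weighted_two (fun n => abs_mul_le_one (hε n) (abs_residueIndicator_le 2 i n))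
      (abs_residueIndicator_le 2 (-i)) (half_pos ht) (half_pos ht)
  rw [sq, ← hL.tsum_eq, ← hR.tsum_eq]
  have hinj : Function.Injective fun p : ℤ × ℤ => (p.1 + p.2, p.1 - p.2) := by
    rintro ⟨a, b⟩ ⟨c, d⟩ h
    simp only [Prod.mk.injEq] at h ⊢
    omega
  have hF : ∀ p : ℤ × ℤ, ∑ i : ZMod 2, ε p.1 * residueIndicator 2 i p.1 *
      residueIndicator 2 (-i) p.2 * exp (-π * (t / 2 * (p.1 : ℝ) ^ 2 + t / 2 * (p.2 : ℝ) ^ 2)) =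
      ε p.1 * (if ((p.1 + p.2 : ℤ) : ZMod 2) = 0 then 1 else 0) *
        exp (-π * (t / 2 * (p.1 : ℝ) ^ 2 + t / 2 * (p.2 : ℝ) ^ 2)) := fun p => by
    rw [← sum_residueIndicator_mul_neg, Finset.mul_sum, Finset.sum_mul]
    simp only [mul_assoc]
  simp only [hF]
  symm
  rw [← hinj.tsum_eq]
  · refine tsum_congr fun p => ?_
    have : ((p.1 + p.2 + (p.1 - p.2) : ℤ) : ZMod 2) = 0 := by
      rw [ZMod.intCast_zmod_eq_zero_iff_dvd]
      omega
    simp only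
    rw [if_pos this, hadd]
    push_cast
    ring_nf
  · rintro ⟨u, v⟩ h
    have h2 : ((u + v : ℤ) : ZMod 2) = 0 := by
      by_contra hne
      exact h (by simp only [if_neg hne, mul_zero, zero_mul])
    rw [ZMod.intCast_zmod_eq_zero_iff_dvd] at h2
    refine ⟨((u + v) / 2, (u - v) / 2), ?_⟩
    simp only [Prod.mk.injEq]
    omega

theorem weightedTheta_cube {ε : ℤ → ℝ} (hε : ∀ n, |ε n| ≤ 1)
    (hadd : ∀ m n, ε (m + n) = ε m * ε n) {t : ℝ} (ht : 0 < t) :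
    weightedTheta ε t ^ 3 = ∑ i : ZMod 3, ∑ j : ZMod 2,
      weightedTheta (fun n => ε n * residueIndicator 3 i n) (t / 3) *
        weightedTheta (fun n => residueIndicator 2 j n * residueIndicator 3 (-i) n) (t / 6) *
          weightedTheta (residueIndicator 2 (-j)) (t / 2) := by
  have hL := hasSum_weighted_three hε hε hε ht ht ht
  have hR := hasSum_sum fun (i : ZMod 3) (_ : i ∈ Finset.univ) =>
    hasSum_sum fun (j : ZMod 2) (_ : j ∈ Finset.univ) =>
    hasSum_weighted_three (fun n => abs_mul_le_one (hε n) (abs_residueIndicator_le 3 i n))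
      (fun n => abs_mul_le_one (abs_residueIndicator_le 2 j n) (abs_residueIndicator_le 3 (-i) n))
      (abs_residueIndicator_le 2 (-j)) (t₁ := t / 3) (t₂ := t / 6) (t₃ := t / 2)
      (by positivity) (by positivity) (by positivity)
  rw [pow_three', ← hL.tsum_eq, ← hR.tsum_eq]
  have hinj : Function.Injective fun p : ℤ × ℤ × ℤ =>
      (p.1 + p.2.1 + p.2.2, 2 * p.1 - p.2.1 - p.2.2, p.2.1 - p.2.2) := by
    rintro ⟨a, b, c⟩ ⟨a', b', c'⟩ h
    simp only [Prod.mk.injEq] at h ⊢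
    omega
  have hF : ∀ p : ℤ × ℤ × ℤ, ∑ i : ZMod 3, ∑ j : ZMod 2, ε p.1 * residueIndicator 3 i p.1 *
      (residueIndicator 2 j p.2.1 * residueIndicator 3 (-i) p.2.1) *
      residueIndicator 2 (-j) p.2.2 *
        exp (-π * (t / 3 * (p.1 : ℝ) ^ 2 + t / 6 * (p.2.1 : ℝ) ^ 2 + t / 2 * (p.2.2 : ℝ) ^ 2)) =
      ε p.1 * (if ((p.1 + p.2.1 : ℤ) : ZMod 3) = 0 then 1 else 0) *
        (if ((p.2.1 + p.2.2 : ℤ) : ZMod 2) = 0 then 1 else 0) *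
        exp (-π * (t / 3 * (p.1 : ℝ) ^ 2 + t / 6 * (p.2.1 : ℝ) ^ 2 + t / 2 * (p.2.2 : ℝ) ^ 2)) :=
    fun p => by
    rw [← sum_residueIndicator_mul_neg, ← sum_residueIndicator_mul_neg, mul_assoc (ε p.1),
      Finset.sum_mul_sum, Finset.mul_sum, Finset.sum_mul]
    refine Finset.sum_congr rfl fun i _ => ?_
    rw [Finset.mul_sum, Finset.sum_mul]
    exact Finset.sum_congr rfl fun j _ => by ring
  simp only [hF]
  symm
  rw [← hinj.tsum_eq]
  · refine tsum_congr fun p => ?_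
    have h3 : ((p.1 + p.2.1 + p.2.2 + (2 * p.1 - p.2.1 - p.2.2) : ℤ) : ZMod 3) = 0 := by
      rw [ZMod.intCast_zmod_eq_zero_iff_dvd]
      omega
    have h2 : ((2 * p.1 - p.2.1 - p.2.2 + (p.2.1 - p.2.2) : ℤ) : ZMod 2) = 0 := by
      rw [ZMod.intCast_zmod_eq_zero_iff_dvd]
      omega
    simp only
    rw [if_pos h3, if_pos h2, hadd, hadd]
    push_cast
    ring_nf
  · rintro ⟨s, d, v⟩ h
    have h3 : ((s + d : ℤ) : ZMod 3) = 0 := by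
      by_contra hne
      exact h (by simp only [if_neg hne, mul_zero, zero_mul])
    have h2 : ((d + v : ℤ) : ZMod 2) = 0 := by
      by_contra hne
      exact h (by simp only [if_neg hne, mul_zero, zero_mul])
    rw [ZMod.intCast_zmod_eq_zero_iff_dvd] at h2 h3
    refine ⟨((s + d) / 3, (s - (s + d) / 3 + v) / 2, (s - (s + d) / 3 - v) / 2), ?_⟩
    simp only [Prod.mk.injEq]
    omega

lemma weightedTheta_mul_residueIndicator_zero (w : ℤ → ℝ) {m : ℕ} (hm : m ≠ 0) (t : ℝ) :
    weightedTheta (fun n => w n * residueIndicator m 0 n) t =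
      weightedTheta (fun n => w (m * n)) ((m : ℝ) ^ 2 * t) := by
  have hinj : Function.Injective fun n : ℤ => (m : ℤ) * n :=
    mul_right_injective₀ (by exact_mod_cast hm)
  unfold weightedTheta
  rw [← hinj.tsum_eq]
  · refine tsum_congr fun n => ?_
    simp only [residueIndicator, Int.cast_mul, Int.cast_natCast, CharP.cast_eq_zero, zero_mul,
      if_true, mul_one]
    ring_nf
  · intro n h
    have h0 : (n : ZMod m) = 0 := by
      by_contra hne
      exact h (by simp only [residueIndicator, if_neg hne, mul_zero, zero_mul])
    obtain ⟨k, rfl⟩ := (ZMod.intCast_zmod_eq_zero_iff_dvd _ _).mp h0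
    exact ⟨k, rfl⟩

lemma weightedTheta_add {w₁ w₂ : ℤ → ℝ} (h₁ : ∀ n, |w₁ n| ≤ 1) (h₂ : ∀ n, |w₂ n| ≤ 1)
    {t : ℝ} (ht : 0 < t) :
    weightedTheta (fun n => w₁ n + w₂ n) t = weightedTheta w₁ t + weightedTheta w₂ t := by
  unfold weightedTheta
  rw [← (summable_weighted h₁ ht).tsum_add (summable_weighted h₂ ht)]
  simp only [add_mul]

lemma weightedTheta_neg (w : ℤ → ℝ) (t : ℝ) :
    weightedTheta (fun n => -w n) t = -weightedTheta w t := by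
  simp only [weightedTheta, neg_mul, tsum_neg]

lemma weightedTheta_comp_neg (w : ℤ → ℝ) (t : ℝ) :
    weightedTheta (fun n => w (-n)) t = weightedTheta w t := by
  unfold weightedTheta
  rw [← (Equiv.neg ℤ).tsum_eq]
  simp

/-- The theta constant `∑ exp(-π t (n + 1/2)²)`, expressed through `theta`. -/
noncomputable def theta₂ (t : ℝ) : ℝ := theta (t / 4) - theta t

/-- The theta constant `∑ (-1)ⁿ exp(-π t n²)`, expressed through `theta`. -/
noncomputable def theta₄ (t : ℝ) : ℝ := 2 * theta (4 * t) - theta t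

lemma weightedTheta_even (t : ℝ) : weightedTheta (residueIndicator 2 0) t = theta (4 * t) := by
  have h := weightedTheta_mul_residueIndicator_zero (fun _ => 1) two_ne_zero t
  simp only [one_mul] at h
  refine h.trans ?_
  norm_num [theta]

lemma sum_zmod_two (f : ZMod 2 → ℝ) : ∑ i, f i = f 0 + f 1 := Fin.sum_univ_two f

lemma sum_zmod_three (f : ZMod 3 → ℝ) : ∑ i, f i = f 0 + f 1 + f 2 := Fin.sum_univ_three f

lemma sum_residueIndicator (m : ℕ) [NeZero m] (n : ℤ) :
    ∑ i : ZMod m, residueIndicator m i n = 1 := by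
  simp [residueIndicator]

lemma residueIndicator_two_add (n : ℤ) :
    residueIndicator 2 0 n + residueIndicator 2 1 n = 1 := by
  rw [← sum_zmod_two fun i => residueIndicator 2 i n, sum_residueIndicator]

lemma weightedTheta_odd {t : ℝ} (ht : 0 < t) :
    weightedTheta (residueIndicator 2 1) t = theta₂ (4 * t) := by
  have h := weightedTheta_add (abs_residueIndicator_le 2 0) (abs_residueIndicator_le 2 1) ht
  simp only [residueIndicator_two_add] at h
  rw [weightedTheta_even] at h
  rw [theta₂, mul_div_cancel_left₀ t four_ne_zero, theta, h]
  ring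

lemma neg_one_zpow_eq (n : ℤ) :
    (-1 : ℝ) ^ n = residueIndicator 2 0 n + -residueIndicator 2 1 n := by
  rcases Int.even_or_odd n with h | h
  · have h0 : (n : ZMod 2) = 0 := (ZMod.intCast_eq_zero_iff_even).mpr h
    simp [residueIndicator, h.neg_one_zpow, h0]
  · have h1 : (n : ZMod 2) = 1 := (ZMod.intCast_eq_one_iff_odd).mpr h
    simp [residueIndicator, h.neg_one_zpow, h1]

lemma abs_neg_one_zpow_le (n : ℤ) : |(-1 : ℝ) ^ n| ≤ 1 := by
  simp [abs_zpow]

lemma neg_one_zpow_mul_even (n : ℤ) :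
    (-1 : ℝ) ^ n * residueIndicator 2 0 n = residueIndicator 2 0 n := by
  rcases Int.even_or_odd n with h | h
  · rw [h.neg_one_zpow, one_mul]
  · have h1 : (n : ZMod 2) = 1 := (ZMod.intCast_eq_one_iff_odd).mpr h
    simp [residueIndicator, h1]

lemma neg_one_zpow_mul_odd (n : ℤ) :
    (-1 : ℝ) ^ n * residueIndicator 2 1 n = -residueIndicator 2 1 n := by
  rcases Int.even_or_odd n with h | h
  · have h0 : (n : ZMod 2) = 0 := (ZMod.intCast_eq_zero_iff_even).mpr h
    simp [residueIndicator, h0]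
  · rw [h.neg_one_zpow, neg_one_mul]

lemma weightedTheta_alternating {t : ℝ} (ht : 0 < t) :
    weightedTheta (fun n => (-1 : ℝ) ^ n) t = theta₄ t := by
  simp only [neg_one_zpow_eq]
  rw [weightedTheta_add (abs_residueIndicator_le 2 0)
    (fun n => by rw [abs_neg]; exact abs_residueIndicator_le 2 1 n) ht, weightedTheta_neg,
    weightedTheta_even, weightedTheta_odd ht, theta₂, mul_div_cancel_left₀ t four_ne_zero, theta₄]
  ring

theorem theta_sq {t : ℝ} (ht : 0 < t) :
    theta t ^ 2 = theta (2 * t) ^ 2 + theta₂ (2 * t) ^ 2 := by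
  have h := weightedTheta_sq (ε := fun _ => 1) (by simp) (by simp) ht
  rw [sum_zmod_two, show (-(0 : ZMod 2)) = 0 from rfl, show (-(1 : ZMod 2)) = 1 from rfl] at h
  simp only [one_mul] at h
  change _ = weightedTheta (residueIndicator 2 0) _ * _ +
    weightedTheta (residueIndicator 2 1) _ * _ at h
  rw [weightedTheta_even, weightedTheta_odd (half_pos ht),
    show 4 * (t / 2) = 2 * t by ring] at h
  rw [theta, h]
  ring

theorem theta₄_sq {t : ℝ} (ht : 0 < t) :
    theta₄ t ^ 2 = theta (2 * t) ^ 2 - theta₂ (2 * t) ^ 2 := by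
  have h := weightedTheta_sq abs_neg_one_zpow_le
    (fun m n => zpow_add₀ (by norm_num : (-1 : ℝ) ≠ 0) m n) ht
  rw [sum_zmod_two, show (-(0 : ZMod 2)) = 0 from rfl, show (-(1 : ZMod 2)) = 1 from rfl] at h
  simp only [neg_one_zpow_mul_even, neg_one_zpow_mul_odd] at h
  rw [weightedTheta_neg] at h
  change _ = weightedTheta (residueIndicator 2 0) _ * _ +
    -weightedTheta (residueIndicator 2 1) _ * _ at h
  rw [weightedTheta_even, weightedTheta_odd (half_pos ht),
    show 4 * (t / 2) = 2 * t by ring, weightedTheta_alternating ht] at h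
  rw [h]
  ring

lemma residueIndicator_three_add (n : ℤ) :
    residueIndicator 3 0 n + (residueIndicator 3 1 n + residueIndicator 3 2 n) = 1 := by
  rw [← add_assoc, ← sum_zmod_three fun i => residueIndicator 3 i n, sum_residueIndicator]

lemma residueIndicator_neg (m : ℕ) (i : ZMod m) (n : ℤ) :
    residueIndicator m i (-n) = residueIndicator m (-i) n := by
  simp only [residueIndicator, Int.cast_neg, neg_eq_iff_eq_neg]

lemma weightedTheta_mod_three_zero {ε : ℤ → ℝ} (hthree : ∀ n, ε (3 * n) = ε n) (t : ℝ) :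
    weightedTheta (fun n => ε n * residueIndicator 3 0 n) t = weightedTheta ε (9 * t) := by
  rw [weightedTheta_mul_residueIndicator_zero ε three_ne_zero t]
  norm_num [hthree]

lemma weightedTheta_mod_three_two {ε : ℤ → ℝ} (heven : ∀ n, ε (-n) = ε n) (t : ℝ) :
    weightedTheta (fun n => ε n * residueIndicator 3 2 n) t =
      weightedTheta (fun n => ε n * residueIndicator 3 1 n) t := by
  rw [← weightedTheta_comp_neg]
  simp only [heven, residueIndicator_neg]
  rfl

lemma weightedTheta_mod_three_one {ε : ℤ → ℝ} (hε : ∀ n, |ε n| ≤ 1)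
    (heven : ∀ n, ε (-n) = ε n) (hthree : ∀ n, ε (3 * n) = ε n) {t : ℝ} (ht : 0 < t) :
    weightedTheta (fun n => ε n * residueIndicator 3 1 n) t =
      (weightedTheta ε t - weightedTheta ε (9 * t)) / 2 := by
  have hb (i : ZMod 3) (n : ℤ) : |ε n * residueIndicator 3 i n| ≤ 1 :=
    abs_mul_le_one (hε n) (abs_residueIndicator_le 3 i n)
  have h : weightedTheta (fun n => ε n * residueIndicator 3 0 n +
      (ε n * residueIndicator 3 1 n + ε n * residueIndicator 3 2 n)) t = weightedTheta ε t := by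
    simp only [← mul_add, residueIndicator_three_add, mul_one]
  have hs := weightedTheta_add (hb 1) (hb 2) ht
  have hb' (n : ℤ) : |ε n * residueIndicator 3 1 n + ε n * residueIndicator 3 2 n| ≤ 1 := by
    rw [← mul_add]
    refine abs_mul_le_one (hε n) ?_
    rw [← sub_eq_of_eq_add' (residueIndicator_three_add n).symm]
    unfold residueIndicator
    split_ifs <;> simp
  rw [weightedTheta_add (hb 0) hb' ht, hs, weightedTheta_mod_three_zero hthree,
    weightedTheta_mod_three_two heven] at h
  linarith

lemma residueIndicator_two_neg (i : ZMod 2) (n : ℤ) :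
    residueIndicator 2 i (-n) = residueIndicator 2 i n := by
  rw [residueIndicator_neg, ZMod.neg_eq_self_mod_two]

lemma residueIndicator_two_three_mul (i : ZMod 2) (n : ℤ) :
    residueIndicator 2 i (3 * n) = residueIndicator 2 i n := by
  have : ((3 * n : ℤ) : ZMod 2) = n := by
    push_cast
    rw [show (3 : ZMod 2) = 1 from rfl, one_mul]
  rw [residueIndicator, residueIndicator, this]

/-- The Borwein theta function of the hexagonal lattice, expressed through theta constants. -/
noncomputable def hexTheta (t : ℝ) : ℝ := theta t * theta (3 * t) + theta₂ t * theta₂ (3 * t)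

theorem weightedTheta_cube_eq {ε : ℤ → ℝ} (hε : ∀ n, |ε n| ≤ 1)
    (hadd : ∀ m n, ε (m + n) = ε m * ε n) (heven : ∀ n, ε (-n) = ε n)
    (hthree : ∀ n, ε (3 * n) = ε n) {t : ℝ} (ht : 0 < t) :
    weightedTheta ε t ^ 3 = weightedTheta ε (3 * t) * hexTheta (2 * t) +
      (weightedTheta ε (t / 3) - weightedTheta ε (3 * t)) / 2 *
        (hexTheta (2 * t / 3) - hexTheta (2 * t)) := by
  have ht6 : 0 < t / 6 := by positivity
  have h := weightedTheta_cube hε hadd ht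
  rw [sum_zmod_three, sum_zmod_two, sum_zmod_two, sum_zmod_two,
    show (-(0 : ZMod 2)) = 0 from rfl, show (-(1 : ZMod 2)) = 1 from rfl,
    show (-(0 : ZMod 3)) = 0 from rfl, show (-(1 : ZMod 3)) = 2 from rfl,
    show (-(2 : ZMod 3)) = 1 from rfl] at h
  simp only [weightedTheta_mod_three_two heven,
    weightedTheta_mod_three_two (residueIndicator_two_neg _),
    weightedTheta_mod_three_zero hthree,
    weightedTheta_mod_three_zero (residueIndicator_two_three_mul _)] at h
  rw [weightedTheta_mod_three_one hε heven hthree (by positivity : 0 < t / 3),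
    weightedTheta_mod_three_one (abs_residueIndicator_le 2 0) (residueIndicator_two_neg _)
      (residueIndicator_two_three_mul _) ht6,
    weightedTheta_mod_three_one (abs_residueIndicator_le 2 1) (residueIndicator_two_neg _)
      (residueIndicator_two_three_mul _) ht6, weightedTheta_even, weightedTheta_even,
    weightedTheta_even, weightedTheta_odd ht6, weightedTheta_odd (half_pos ht),
    weightedTheta_odd (by positivity : 0 < 9 * (t / 6)),
    show 9 * (t / 3) = 3 * t by ring, show 4 * (t / 2) = 2 * t by ring,
    show 4 * (t / 6) = 2 * t / 3 by ring, show 4 * (9 * (t / 6)) = 3 * (2 * t) by ring] at h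
  rw [h, hexTheta, hexTheta, show 3 * (2 * t / 3) = 2 * t by ring]
  ring

theorem theta_cube {t : ℝ} (ht : 0 < t) :
    theta t ^ 3 = theta (3 * t) * hexTheta (2 * t) +
      (theta (t / 3) - theta (3 * t)) / 2 * (hexTheta (2 * t / 3) - hexTheta (2 * t)) :=
  weightedTheta_cube_eq (ε := fun _ => 1) (by simp) (by simp) (by simp) (by simp) ht

theorem theta₄_cube {t : ℝ} (ht : 0 < t) :
    theta₄ t ^ 3 = theta₄ (3 * t) * hexTheta (2 * t) +
      (theta₄ (t / 3) - theta₄ (3 * t)) / 2 * (hexTheta (2 * t / 3) - hexTheta (2 * t)) := by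
  have h := weightedTheta_cube_eq abs_neg_one_zpow_le
    (fun m n => zpow_add₀ (by norm_num : (-1 : ℝ) ≠ 0) m n)
    (fun n => by rw [zpow_neg, ← inv_zpow, inv_neg_one])
    (fun n => by rw [zpow_mul]; norm_num) ht
  rwa [weightedTheta_alternating ht, weightedTheta_alternating (by positivity : 0 < 3 * t),
    weightedTheta_alternating (by positivity : 0 < t / 3)] at h

theorem theta_mul_theta₄ {t : ℝ} (ht : 0 < t) : theta t * theta₄ t = theta₄ (2 * t) ^ 2 := by
  rw [theta₄_sq (by positivity : 0 < 2 * t), theta₄, theta₂,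
    show 2 * (2 * t) = 4 * t by ring, mul_div_cancel_left₀ t four_ne_zero]
  ring

/-- The quartic identity of Jacobi. -/
theorem theta_pow_four {t : ℝ} (ht : 0 < t) : theta t ^ 4 = theta₂ t ^ 4 + theta₄ t ^ 4 := by
  have h := theta_mul_theta₄ (half_pos ht)
  have h₁ := theta_sq (half_pos ht)
  have h₂ := theta₄_sq (half_pos ht)
  rw [mul_div_cancel₀ t two_ne_zero] at h h₁ h₂
  have : theta₄ t ^ 4 = theta (t / 2) ^ 2 * theta₄ (t / 2) ^ 2 := by
    rw [← mul_pow, h]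
    ring
  rw [this, h₁, h₂]
  ring

theorem theta_inv {t : ℝ} (ht : 0 < t) : theta t⁻¹ = √t * theta t := by
  have h := Real.tsum_exp_neg_mul_int_sq (inv_pos.mpr ht)
  simp only [theta, weightedTheta, one_mul]
  rw [h, div_inv_eq_mul, ← sqrt_eq_rpow, sqrt_inv, one_div, inv_inv]

theorem theta₂_inv {t : ℝ} (ht : 0 < t) : theta₂ t⁻¹ = √t * theta₄ t := by
  have h := theta_inv (by positivity : 0 < 4 * t)
  rw [theta₂, theta₄, theta_inv ht, show t⁻¹ / 4 = (4 * t)⁻¹ by rw [mul_inv]; ring, h,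
    sqrt_mul (by norm_num), show (4 : ℝ) = 2 ^ 2 by norm_num, sqrt_sq (by norm_num)]
  ring

theorem theta₄_inv {t : ℝ} (ht : 0 < t) : theta₄ t⁻¹ = √t * theta₂ t := by
  have h := theta₂_inv (inv_pos.mpr ht)
  rw [inv_inv] at h
  rw [h, ← mul_assoc, ← sqrt_mul ht.le, mul_inv_cancel₀ ht.ne', sqrt_one, one_mul]

lemma hexTheta_four_mul (t : ℝ) :
    hexTheta (4 * t) = (theta t * theta (3 * t) + theta₄ t * theta₄ (3 * t)) / 2 := by
  rw [hexTheta, theta₂, theta₂, theta₄, theta₄, show 3 * (4 * t) = 4 * (3 * t) by ring,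
    mul_div_cancel_left₀ _ four_ne_zero, mul_div_cancel_left₀ _ four_ne_zero]
  ring

lemma hexTheta_two_thirds : hexTheta (2 / 3) = √3 * hexTheta 2 := by
  have h := hexTheta_four_mul (1 / 6)
  have h6 : (0 : ℝ) < 6 := by norm_num
  have h2 : (0 : ℝ) < 2 := by norm_num
  rw [show (4 * (1 / 6) : ℝ) = 2 / 3 by norm_num, show (3 * (1 / 6) : ℝ) = 2⁻¹ by norm_num,
    show (1 / 6 : ℝ) = 6⁻¹ by norm_num, theta_inv h6, theta_inv h2, theta₄_inv h6,
    theta₄_inv h2] at h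
  rw [h, hexTheta, show (3 * 2 : ℝ) = 6 by norm_num, show √6 = √2 * √3 by
      rw [← sqrt_mul h2.le]; norm_num]
  linear_combination (√3 * (theta 6 * theta 2 + theta₂ 6 * theta₂ 2) / 2) * sq_sqrt h2.le

lemma theta_pos {t : ℝ} (ht : 0 < t) : 0 < theta t := by
  have h := summable_weighted (w := fun _ => 1) (by simp) ht
  exact h.tsum_pos (fun _ => by positivity) 0 (by positivity)

lemma theta₂_pos {t : ℝ} (ht : 0 < t) : 0 < theta₂ t := by
  have h4 : 0 < t / 4 := by positivity
  have h := weightedTheta_odd h4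
  rw [mul_div_cancel₀ t four_ne_zero] at h
  rw [← h]
  have hs := summable_weighted (abs_residueIndicator_le 2 1) h4
  refine hs.tsum_pos (fun n => mul_nonneg ?_ (exp_pos _).le) 1 ?_
  · unfold residueIndicator
    split_ifs <;> norm_num
  · simp [residueIndicator, exp_pos]

lemma theta₄_pos {t : ℝ} (ht : 0 < t) : 0 < theta₄ t := by
  have h := theta₄_inv (inv_pos.mpr ht)
  rw [inv_inv] at h
  rw [h]
  have := theta₂_pos (inv_pos.mpr ht)
  positivity

section

open MeasureTheory Set Filter Topology

/-- The complete elliptic integral `∫₀^∞ dx / √((x² + a²)(x² + b²))`. -/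
noncomputable def ellipticIntegral (a b : ℝ) : ℝ :=
  ∫ x in Ioi (0 : ℝ), 1 / √((x ^ 2 + a ^ 2) * (x ^ 2 + b ^ 2))

lemma image_half_sub_div_Ioi {g : ℝ} (hg : 0 < g) :
    (fun x : ℝ => (x - g ^ 2 / x) / 2) '' Ioi 0 = univ := by
  refine eq_univ_of_forall fun u => ?_
  have hlt : |u| < √(u ^ 2 + g ^ 2) := by
    rw [← sqrt_sq_eq_abs]
    exact sqrt_lt_sqrt (sq_nonneg u) (by nlinarith)
  have hpos : 0 < u + √(u ^ 2 + g ^ 2) := by linarith [neg_abs_le u]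
  refine ⟨u + √(u ^ 2 + g ^ 2), hpos, ?_⟩
  have hs : √(u ^ 2 + g ^ 2) ^ 2 = u ^ 2 + g ^ 2 := sq_sqrt (by positivity)
  field_simp
  linear_combination hs

lemma injOn_half_sub_div {g : ℝ} : InjOn (fun x : ℝ => (x - g ^ 2 / x) / 2) (Ioi 0) := by
  refine StrictMonoOn.injOn fun x hx y _ hxy => ?_
  have : g ^ 2 / y ≤ g ^ 2 / x := div_le_div_of_nonneg_left (sq_nonneg g) hx hxy.le
  linarith

/-- The quadratic substitution of Gauss for the complete elliptic integral. -/
theorem ellipticIntegral_eq_integral_quartic {a g : ℝ} (hg : 0 < g) :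
    ellipticIntegral a g =
      ∫ x in Ioi (0 : ℝ), 1 / √(x ^ 4 + (4 * a ^ 2 - 2 * g ^ 2) * x ^ 2 + g ^ 4) := by
  have hsub := integral_image_eq_integral_abs_deriv_smul measurableSet_Ioi
    (f := fun x : ℝ => (x - g ^ 2 / x) / 2) (f' := fun x => (1 + g ^ 2 / x ^ 2) / 2)
    (fun x hx => ?_) injOn_half_sub_div
    (fun u => 1 / √((u ^ 2 + a ^ 2) * (u ^ 2 + g ^ 2)))
  · have habs := integral_comp_abs (f := fun u => 1 / √((u ^ 2 + a ^ 2) * (u ^ 2 + g ^ 2)))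
    simp only [sq_abs] at habs
    rw [image_half_sub_div_Ioi hg, setIntegral_univ, habs] at hsub
    have hpt : ∀ x ∈ Ioi (0 : ℝ), |(1 + g ^ 2 / x ^ 2) / 2| • (1 / √((((x - g ^ 2 / x) / 2) ^ 2 +
        a ^ 2) * (((x - g ^ 2 / x) / 2) ^ 2 + g ^ 2))) =
        2 * (1 / √(x ^ 4 + (4 * a ^ 2 - 2 * g ^ 2) * x ^ 2 + g ^ 4)) := fun x hx => by
      have hx0 : (0 : ℝ) < x := hx
      have e : (((x - g ^ 2 / x) / 2) ^ 2 + a ^ 2) * (((x - g ^ 2 / x) / 2) ^ 2 + g ^ 2) =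
          ((x ^ 2 + g ^ 2) / (4 * x ^ 2)) ^ 2 *
            (x ^ 4 + (4 * a ^ 2 - 2 * g ^ 2) * x ^ 2 + g ^ 4) := by
        field_simp
        ring
      rw [e, sqrt_mul (sq_nonneg _), sqrt_sq (by positivity), abs_of_pos (by positivity),
        smul_eq_mul, one_div, mul_inv, one_div, ← mul_assoc]
      congr 1
      field_simp
      ring
    rw [setIntegral_congr_fun measurableSet_Ioi hpt, integral_const_mul] at hsub
    exact mul_left_cancel₀ two_ne_zero hsub
  · have hx0 : x ≠ 0 := ne_of_gt hx
    have h := (((hasDerivAt_id x).sub ((hasDerivAt_inv hx0).const_mul (g ^ 2))).div_const 2)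
    refine (h.congr_deriv ?_).hasDerivWithinAt
    field_simp
    ring

theorem ellipticIntegral_agm {a b : ℝ} (ha : 0 < a) (hb : 0 < b) :
    ellipticIntegral ((a + b) / 2) √(a * b) = ellipticIntegral a b := by
  have hab : √(a * b) ^ 2 = a * b := sq_sqrt (by positivity)
  rw [ellipticIntegral_eq_integral_quartic (by positivity), ellipticIntegral]
  congr! 4 with x
  rw [show √(a * b) ^ 4 = (√(a * b) ^ 2) ^ 2 by ring, hab]
  ring

lemma integrableOn_inv_sq_add_sq {c : ℝ} (hc : 0 < c) :
    Integrable (fun x : ℝ => 1 / (x ^ 2 + c ^ 2)) ∧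
      ∫ x in Ioi (0 : ℝ), 1 / (x ^ 2 + c ^ 2) = π / (2 * c) := by
  have e : (fun x : ℝ => 1 / (x ^ 2 + c ^ 2)) =
      fun x => (c ^ 2)⁻¹ * (1 + (c⁻¹ * x) ^ 2)⁻¹ := by
    funext x
    field_simp
    ring
  have hc' : c⁻¹ ≠ 0 := inv_ne_zero hc.ne'
  constructor
  · rw [e]
    exact (integrable_inv_one_add_sq.comp_mul_left' hc').const_mul _
  · rw [e, integral_const_mul, integral_comp_mul_left_Ioi (fun x => (1 + x ^ 2)⁻¹) 0
      (inv_pos.mpr hc), mul_zero, integral_Ioi_inv_one_add_sq]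
    simp
    field_simp

lemma ellipticIntegral_bounds {a b m M : ℝ} (hm : 0 < m) (hma : m ≤ a) (hmb : m ≤ b)
    (haM : a ≤ M) (hbM : b ≤ M) :
    π / (2 * M) ≤ ellipticIntegral a b ∧ ellipticIntegral a b ≤ π / (2 * m) := by
  have hM : 0 < M := by linarith
  have lower (x : ℝ) : 1 / (x ^ 2 + M ^ 2) ≤ 1 / √((x ^ 2 + a ^ 2) * (x ^ 2 + b ^ 2)) := by
    have ha : 0 < a := by linarith
    have hb : 0 < b := by linarith
    refine one_div_le_one_div_of_le (by positivity) ?_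
    rw [← sqrt_sq (by positivity : 0 ≤ x ^ 2 + M ^ 2), sq (x ^ 2 + M ^ 2)]
    gcongr
  have upper (x : ℝ) : 1 / √((x ^ 2 + a ^ 2) * (x ^ 2 + b ^ 2)) ≤ 1 / (x ^ 2 + m ^ 2) := by
    refine one_div_le_one_div_of_le (by positivity) ?_
    rw [← sqrt_sq (by positivity : 0 ≤ x ^ 2 + m ^ 2), sq (x ^ 2 + m ^ 2)]
    gcongr
  obtain ⟨im, em⟩ := integrableOn_inv_sq_add_sq hm
  obtain ⟨iM, eM⟩ := integrableOn_inv_sq_add_sq hM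
  have i : Integrable fun x : ℝ => 1 / √((x ^ 2 + a ^ 2) * (x ^ 2 + b ^ 2)) := by
    refine im.mono' (by measurability) (ae_of_all _ fun x => ?_)
    rw [norm_of_nonneg (by positivity)]
    exact upper x
  rw [← eM, ← em]
  exact ⟨setIntegral_mono iM.integrableOn i.integrableOn lower,
    setIntegral_mono i.integrableOn im.integrableOn upper⟩

lemma tendsto_theta_atTop : Tendsto theta atTop (𝓝 1) := by
  have h : Tendsto theta atTop (𝓝 (∑' n : ℤ, if n = 0 then 1 else 0)) := by
    refine tendsto_tsum_of_dominated_convergence (summable_exp_neg_pi_mul_sq one_pos)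
      (fun n => ?_) ?_
    · rcases eq_or_ne n 0 with rfl | hn
      · simp
      · simp only [if_neg hn, one_mul]
        refine tendsto_exp_atBot.comp ?_
        have : 0 < π * (n : ℝ) ^ 2 := by positivity
        refine (tendsto_neg_atTop_atBot.comp (tendsto_id.const_mul_atTop this)).congr fun t => ?_
        simp only [Function.comp_apply, id]
        ring
    · filter_upwards [eventually_ge_atTop 1] with t ht n
      rw [one_mul, norm_of_nonneg (exp_pos _).le, exp_le_exp]
      have : 0 ≤ π * (n : ℝ) ^ 2 := by positivity
      nlinarith
  simpa using h

lemma tendsto_theta₄_atTop : Tendsto theta₄ atTop (𝓝 1) := by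
  have h := ((tendsto_theta_atTop.comp (tendsto_id.const_mul_atTop four_pos)).const_mul 2).sub
    tendsto_theta_atTop
  norm_num at h
  exact h

theorem ellipticIntegral_theta {t : ℝ} (ht : 0 < t) :
    ellipticIntegral (theta t ^ 2) (theta₄ t ^ 2) = π / 2 := by
  have step : ∀ s : ℝ, 0 < s → ellipticIntegral (theta (2 * s) ^ 2) (theta₄ (2 * s) ^ 2) =
      ellipticIntegral (theta s ^ 2) (theta₄ s ^ 2) := fun s hs => by
    have h := ellipticIntegral_agm (pow_pos (theta_pos hs) 2) (pow_pos (theta₄_pos hs) 2)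
    rw [← mul_pow, sqrt_sq (mul_pos (theta_pos hs) (theta₄_pos hs)).le, theta_mul_theta₄ hs] at h
    rw [← h]
    congr 1
    linarith [theta_sq hs, theta₄_sq hs]
  have iter : ∀ n : ℕ, ellipticIntegral (theta (2 ^ n * t) ^ 2) (theta₄ (2 ^ n * t) ^ 2) =
      ellipticIntegral (theta t ^ 2) (theta₄ t ^ 2) := fun n => by
    induction n with
    | zero => simp
    | succ n ih => rw [pow_succ' 2, mul_assoc, step _ (by positivity), ih]
  have htop : Tendsto (fun n : ℕ => (2 : ℝ) ^ n * t) atTop atTop :=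
    (tendsto_pow_atTop_atTop_of_one_lt one_lt_two).atTop_mul_const ht
  have h₁ := (tendsto_theta_atTop.comp htop).pow 2
  have h₂ := (tendsto_theta₄_atTop.comp htop).pow 2
  have hmin := h₁.min h₂
  have hmax := h₁.max h₂
  simp only [one_pow, min_self, max_self, Function.comp_apply] at hmin hmax
  have hlow := tendsto_const_nhds (x := π).div (hmax.const_mul 2) (by norm_num)
  have hupp := tendsto_const_nhds (x := π).div (hmin.const_mul 2) (by norm_num)
  rw [mul_one] at hlow hupp
  have hb (n : ℕ) := ellipticIntegral_bounds
    (lt_min (pow_pos (theta_pos (by positivity : 0 < 2 ^ n * t)) 2)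
      (pow_pos (theta₄_pos (by positivity : 0 < 2 ^ n * t)) 2))
    (min_le_left _ _) (min_le_right _ _) (le_max_left _ _) (le_max_right _ _)
  simp only [iter] at hb
  exact tendsto_nhds_unique tendsto_const_nhds
    (tendsto_of_tendsto_of_tendsto_of_le_of_le hlow hupp (fun n => (hb n).1) fun n => (hb n).2)

lemma integral_Ioo_rpow_neg_three_quarters :
    ∫ x in Ioo (0 : ℝ) 1, x ^ (-3 / 4 : ℝ) * (1 - x) ^ (-3 / 4 : ℝ) =
      Real.Gamma (1 / 4) ^ 2 / √π := by
  have h := Complex.betaIntegral_eq_Gamma_mul_div ((1 / 4 : ℝ) : ℂ) ((1 / 4 : ℝ) : ℂ)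
    (by norm_num) (by norm_num)
  rw [← Complex.ofReal_add, Complex.Gamma_ofReal, Complex.Gamma_ofReal,
    show (1 / 4 + 1 / 4 : ℝ) = 1 / 2 by norm_num, Real.Gamma_one_half_eq, Complex.betaIntegral,
    intervalIntegral.integral_of_le zero_le_one, integral_Ioc_eq_integral_Ioo] at h
  have hpt : ∀ x ∈ Ioo (0 : ℝ) 1,
      (x : ℂ) ^ (((1 / 4 : ℝ) : ℂ) - 1) * (1 - (x : ℂ)) ^ (((1 / 4 : ℝ) : ℂ) - 1) =
        ((x ^ (-3 / 4 : ℝ) * (1 - x) ^ (-3 / 4 : ℝ) : ℝ) : ℂ) := fun x hx => by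
    rw [Complex.ofReal_mul, Complex.ofReal_cpow hx.1.le,
      Complex.ofReal_cpow (sub_nonneg.mpr hx.2.le)]
    push_cast
    norm_num
  rw [setIntegral_congr_fun measurableSet_Ioo hpt, integral_complex_ofReal] at h
  rw [sq]
  exact_mod_cast h

lemma image_inv_one_add_pow_four_Ioi :
    (fun y : ℝ => (1 + y ^ 4)⁻¹) '' Ioi 0 = Ioo 0 1 := by
  ext x
  constructor
  · rintro ⟨y, hy, rfl⟩
    have : 0 < y ^ 4 := pow_pos hy 4
    exact ⟨by positivity, inv_lt_one_of_one_lt₀ (by linarith)⟩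
  · rintro ⟨h0, h1⟩
    have hpos : 0 < x⁻¹ - 1 := sub_pos.mpr ((one_lt_inv₀ h0).mpr h1)
    refine ⟨(x⁻¹ - 1) ^ (1 / 4 : ℝ), rpow_pos_of_pos hpos _, ?_⟩
    simp only
    rw [← rpow_natCast, ← rpow_mul hpos.le]
    norm_num

theorem integral_Ioi_inv_sqrt_pow_four_add_one :
    ∫ x in Ioi (0 : ℝ), 1 / √(x ^ 4 + 1) = Real.Gamma (1 / 4) ^ 2 / (4 * √π) := by
  have hinj : InjOn (fun y : ℝ => (1 + y ^ 4)⁻¹) (Ioi 0) := fun x hx y hy h => by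
    have h4 : x ^ 4 = y ^ 4 := by
      have := inv_injective h
      linarith
    exact (pow_left_inj₀ (le_of_lt hx) (le_of_lt hy) four_ne_zero).mp h4
  have hsub := integral_image_eq_integral_abs_deriv_smul measurableSet_Ioi
    (f := fun y : ℝ => (1 + y ^ 4)⁻¹) (f' := fun y => -(4 * y ^ 3) / (1 + y ^ 4) ^ 2)
    (fun y hy => ?_) hinj (fun x => x ^ (-3 / 4 : ℝ) * (1 - x) ^ (-3 / 4 : ℝ))
  · rw [image_inv_one_add_pow_four_Ioi, integral_Ioo_rpow_neg_three_quarters] at hsub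
    have hpt : ∀ y ∈ Ioi (0 : ℝ), |-(4 * y ^ 3) / (1 + y ^ 4) ^ 2| •
        (((1 + y ^ 4)⁻¹) ^ (-3 / 4 : ℝ) * (1 - (1 + y ^ 4)⁻¹) ^ (-3 / 4 : ℝ)) =
        4 * (1 / √(y ^ 4 + 1)) := fun y hy => by
      have hy0 : (0 : ℝ) < y := hy
      have hw : 0 < 1 + y ^ 4 := by positivity
      have e : 1 - (1 + y ^ 4)⁻¹ = y ^ 4 * (1 + y ^ 4)⁻¹ := by
        field_simp
        ring
      have e4 : (y ^ 4) ^ (-3 / 4 : ℝ) = (y ^ 3)⁻¹ := by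
        rw [← rpow_natCast, ← rpow_mul hy0.le, ← rpow_natCast, ← rpow_neg hy0.le]
        norm_num
      have ew : ∀ w : ℝ, 0 < w →
          (w⁻¹) ^ (-3 / 4 : ℝ) * (w⁻¹) ^ (-3 / 4 : ℝ) = w ^ 2 / √w := fun w hw => by
        rw [inv_rpow hw.le, ← rpow_neg hw.le, ← rpow_add hw, sqrt_eq_rpow, ← rpow_natCast,
          ← rpow_sub hw]
        norm_num
      rw [e, mul_rpow (by positivity) (by positivity), e4, mul_left_comm, ew _ hw, abs_div, abs_neg,
        abs_of_pos (by positivity : 0 < 4 * y ^ 3),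
        abs_of_pos (by positivity : 0 < (1 + y ^ 4) ^ 2),
        smul_eq_mul, add_comm (y ^ 4) 1]
      field_simp
    rw [setIntegral_congr_fun measurableSet_Ioi hpt, integral_const_mul] at hsub
    rw [mul_comm 4 √π, ← div_div, hsub]
    ring
  · have hw : 1 + y ^ 4 ≠ 0 := by positivity
    have h := ((hasDerivAt_pow 4 y).const_add 1).inv hw
    refine (h.congr_deriv ?_).hasDerivWithinAt
    norm_num

lemma theta_one_pow_four : theta 1 ^ 4 = 2 * theta₄ 1 ^ 4 := by
  have h := theta₄_inv one_pos
  rw [inv_one, sqrt_one, one_mul] at h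
  rw [theta_pow_four one_pos, h]
  ring

theorem theta_one_sq : theta 1 ^ 2 = Real.Gamma (1 / 4) ^ 2 / (2 * π * √π) := by
  have hT := theta_pos one_pos
  have h := ellipticIntegral_theta one_pos
  have hcomm : ellipticIntegral (theta 1 ^ 2) (theta₄ 1 ^ 2) =
      ellipticIntegral (theta₄ 1 ^ 2) (theta 1 ^ 2) := by
    simp only [ellipticIntegral, mul_comm]
  rw [hcomm, ellipticIntegral_eq_integral_quartic (by positivity)] at h
  have hpt : ∀ x : ℝ, 1 / √(x ^ 4 + (4 * (theta₄ 1 ^ 2) ^ 2 - 2 * (theta 1 ^ 2) ^ 2) * x ^ 2 +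
      (theta 1 ^ 2) ^ 4) = (theta 1 ^ 4)⁻¹ * (1 / √(((theta 1 ^ 2)⁻¹ * x) ^ 4 + 1)) := fun x => by
    have e : x ^ 4 + (4 * (theta₄ 1 ^ 2) ^ 2 - 2 * (theta 1 ^ 2) ^ 2) * x ^ 2 +
        (theta 1 ^ 2) ^ 4 = (theta 1 ^ 4) ^ 2 * (((theta 1 ^ 2)⁻¹ * x) ^ 4 + 1) := by
      have := theta_one_pow_four
      field_simp
      linear_combination (-2 * x ^ 2) * this
    rw [e, sqrt_mul (sq_nonneg _), sqrt_sq (by positivity), one_div, mul_inv, one_div]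
  simp only [hpt] at h
  rw [integral_const_mul, integral_comp_mul_left_Ioi (fun x => 1 / √(x ^ 4 + 1)) 0
    (by positivity), mul_zero, integral_Ioi_inv_sqrt_pow_four_add_one, inv_inv, smul_eq_mul] at h
  have hπ : 0 < √π := sqrt_pos.mpr pi_pos
  field_simp at h ⊢
  linear_combination (-1 / 2) * h

end

lemma hexTheta_two_sq : hexTheta 2 ^ 2 =
    (theta 1 ^ 2 * theta 3 ^ 2 + theta₄ 1 ^ 2 * (theta₂ 3 ^ 2 + theta₄ 3 ^ 2)) / 2 := by
  have h₁ := theta_sq one_pos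
  have h₂ := theta₄_sq one_pos
  have h₃ := theta_sq three_pos
  have h₄ := theta₄_sq three_pos
  rw [mul_one] at h₁ h₂
  have hD : theta₂ 1 = theta₄ 1 := by
    have h := theta₄_inv one_pos
    rw [inv_one, sqrt_one, one_mul] at h
    exact h.symm
  have hone : 2 * (theta 2 * theta₂ 2) = theta₄ 1 ^ 2 := by
    have h := theta_pow_four one_pos
    rw [hD] at h
    have hp := mul_pos (theta_pos two_pos) (theta₂_pos two_pos)
    refine (pow_left_inj₀ (by positivity) (by positivity) two_ne_zero).mp ?_
    linear_combination h - (theta 1 ^ 2 + theta 2 ^ 2 + theta₂ 2 ^ 2) * h₁ +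
      (theta₄ 1 ^ 2 + theta 2 ^ 2 - theta₂ 2 ^ 2) * h₂
  have hthree : 2 * (theta (2 * 3) * theta₂ (2 * 3)) = theta₂ 3 ^ 2 := by
    have h := theta_pow_four three_pos
    have hp := mul_pos (theta_pos (by norm_num : (0 : ℝ) < 2 * 3))
      (theta₂_pos (by norm_num : (0 : ℝ) < 2 * 3))
    refine (pow_left_inj₀ (by positivity) (by positivity) two_ne_zero).mp ?_
    linear_combination h - (theta 3 ^ 2 + theta (2 * 3) ^ 2 + theta₂ (2 * 3) ^ 2) * h₃ +
      (theta₄ 3 ^ 2 + theta (2 * 3) ^ 2 - theta₂ (2 * 3) ^ 2) * h₄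
  rw [hexTheta, mul_comm (3 : ℝ) 2]
  linear_combination (-1 / 2 : ℝ) * (theta 3 ^ 2 * h₁ +
    (theta 2 ^ 2 + theta₂ 2 ^ 2) * h₃ + theta₄ 3 ^ 2 * h₂ + (theta 2 ^ 2 - theta₂ 2 ^ 2) * h₄ -
    2 * (theta (2 * 3) * theta₂ (2 * 3)) * hone - theta₄ 1 ^ 2 * hthree)

lemma theta_one_cube : theta 1 ^ 3 = theta 3 * hexTheta 2 * (3 - √3) := by
  have h := theta_cube one_pos
  have hinv := theta_inv three_pos
  have h3 : √3 ^ 2 = 3 := sq_sqrt (by norm_num)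
  rw [mul_one, mul_one, hexTheta_two_thirds, one_div, hinv] at h
  linear_combination h + theta 3 * hexTheta 2 / 2 * h3

lemma theta₄_one_cube :
    theta₄ 1 ^ 3 = hexTheta 2 * (3 - √3) / 2 * (theta₂ 3 + theta₄ 3) := by
  have h := theta₄_cube one_pos
  have hinv := theta₄_inv three_pos
  have h3 : √3 ^ 2 = 3 := sq_sqrt (by norm_num)
  rw [mul_one, mul_one, hexTheta_two_thirds, one_div, hinv] at h
  linear_combination h + theta₂ 3 * hexTheta 2 / 2 * h3

/-- The points of the circle `b + c = 2^{1/4}` on the quartic `b⁴ + c⁴ = 1`. -/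
lemma mul_eq_of_add_pow_four {r b c : ℝ} (hr : r ^ 4 = 2) (hadd : b + c = r)
    (hpow : b ^ 4 + c ^ 4 = 1) : b * c = r ^ 2 * (1 - √3 / 2) := by
  have h3 : √3 ^ 2 = 3 := sq_sqrt (by norm_num)
  have h3' : 0 ≤ √3 := sqrt_nonneg 3
  have hr2 : 0 < r ^ 2 := by
    refine lt_of_le_of_ne (sq_nonneg r) fun h => ?_
    have : r ^ 4 = (r ^ 2) ^ 2 := by ring
    rw [← h, hr] at this
    norm_num at this
  have hquad : (b * c - r ^ 2 * (1 - √3 / 2)) * (b * c - r ^ 2 * (1 + √3 / 2)) = 0 := by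
    subst hadd
    linear_combination hpow / 2 - (1 / 4 : ℝ) * hr - (b + c) ^ 4 / 4 * h3
  rcases mul_eq_zero.mp hquad with h | h
  · linarith
  · nlinarith [sq_nonneg (b - c)]

/-- The modulus relations between the theta constants at `1` and at `3`, with `r = 2^{1/4}`. -/
lemma theta_three_relations : ∃ r : ℝ, 0 < r ∧ r ^ 4 = 2 ∧
    theta₂ 3 + theta₄ 3 = r * theta 3 ∧
    theta₂ 3 * theta₄ 3 = r ^ 2 * (1 - √3 / 2) * theta 3 ^ 2 ∧
    theta 1 ^ 4 = (6 * √3 - 9) * theta 3 ^ 4 := by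
  have hA := theta_pos three_pos
  have hT := theta_pos one_pos
  have hD := theta₄_pos one_pos
  have h3 : √3 ^ 2 = 3 := sq_sqrt (by norm_num)
  have hquad := theta_pow_four three_pos
  have hT3 := theta_one_cube
  have hD3 := theta₄_one_cube
  have ha2 := hexTheta_two_sq
  have hTD := theta_one_pow_four
  set T := theta 1
  set D := theta₄ 1
  set A := theta 3
  set B := theta₂ 3
  set C := theta₄ 3
  set a := hexTheta 2
  have hadd : B + C = 2 * D ^ 3 / T ^ 3 * A := by
    have h0 : a * (3 - √3) ≠ 0 := fun h0 => by
      have : T ^ 3 = 0 := by linear_combination hT3 + A * h0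
      exact hT.ne' (pow_eq_zero_iff three_ne_zero |>.mp this)
    field_simp
    refine mul_left_cancel₀ h0 ?_
    linear_combination (-2 * T ^ 3) * hD3 + 2 * D ^ 3 * hT3
  have hr4 : (2 * D ^ 3 / T ^ 3) ^ 4 = 2 := by
    have : (2 * D ^ 3 / T ^ 3) ^ 4 = 16 * (D ^ 4) ^ 3 / (T ^ 4) ^ 3 := by ring
    rw [this, hTD]
    field_simp
    norm_num
  have hrD : (2 * D ^ 3 / T ^ 3) ^ 2 * D ^ 2 = T ^ 2 := by
    have : (2 * D ^ 3 / T ^ 3) ^ 2 * D ^ 2 = (2 * D ^ 4) ^ 2 / T ^ 6 := by ring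
    rw [this, ← hTD]
    field_simp
  have hmul : B * C = (2 * D ^ 3 / T ^ 3) ^ 2 * (1 - √3 / 2) * A ^ 2 := by
    have h := mul_eq_of_add_pow_four (b := B / A) (c := C / A) hr4
      (by rw [← add_div, hadd, mul_div_cancel_right₀ _ hA.ne'])
      (by field_simp; linear_combination -hquad)
    rw [← h]
    field_simp
  set r := 2 * D ^ 3 / T ^ 3
  refine ⟨r, by positivity, hr4, hadd, hmul, ?_⟩
  have hsq : D ^ 2 * (B ^ 2 + C ^ 2) = T ^ 2 * A ^ 2 * (√3 - 1) := by
    linear_combination D ^ 2 * (B + C + r * A) * hadd - 2 * D ^ 2 * hmul +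
      (√3 - 1) * A ^ 2 * hrD
  refine mul_left_cancel₀ (pow_ne_zero 2 hT.ne') ?_
  linear_combination (T ^ 3 + A * a * (3 - √3)) * hT3 + A ^ 2 * (3 - √3) ^ 2 * ha2 +
    A ^ 2 * (3 - √3) ^ 2 / 2 * hsq + A ^ 4 * T ^ 2 * (√3 - 6) / 2 * h3

/-- The eta-type constant `∑ exp(-π (6k - 1)² / 24)`. -/
noncomputable def etaSum : ℝ := ∑' k : ℤ, exp (-π * (1 / 24) * ((6 * k - 1 : ℤ) : ℝ) ^ 2)

lemma injective_six_mul_sub_one : Function.Injective fun k : ℤ => 6 * k - 1 := fun a b h => by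
  have : 6 * a - 1 = 6 * b - 1 := h
  omega

lemma etaSum_eq_weightedTheta : etaSum =
    weightedTheta (fun n => residueIndicator 2 1 n * residueIndicator 3 2 n) (1 / 24) := by
  have hsupp : Function.support (fun n : ℤ => residueIndicator 2 1 n * residueIndicator 3 2 n *
      exp (-π * (1 / 24) * (n : ℝ) ^ 2)) ⊆ Set.range fun k : ℤ => 6 * k - 1 := fun n hn => by
    have h2 : (n : ZMod 2) = 1 := by
      by_contra h
      exact hn (by simp [residueIndicator, h])
    have h3 : (n : ZMod 3) = 2 := by
      by_contra h
      exact hn (by simp [residueIndicator, h])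
    have h2' := (ZMod.intCast_eq_intCast_iff_dvd_sub 1 n 2).mp (by simp [h2])
    have h3' := (ZMod.intCast_eq_intCast_iff_dvd_sub 2 n 3).mp (by simp [h3])
    exact ⟨(n + 1) / 6, by push_cast at h2' h3'; dsimp only; omega⟩
  rw [weightedTheta, ← injective_six_mul_sub_one.tsum_eq hsupp, etaSum]
  refine tsum_congr fun k => ?_
  have h2 : residueIndicator 2 1 (6 * k - 1) = 1 := by
    refine if_pos ?_
    push_cast
    rw [show (6 : ZMod 2) = 0 from rfl, zero_mul]
    rfl
  have h3 : residueIndicator 3 2 (6 * k - 1) = 1 := by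
    refine if_pos ?_
    push_cast
    rw [show (6 : ZMod 3) = 0 from rfl, zero_mul]
    rfl
  rw [h2, h3, one_mul, one_mul]

lemma etaSum_pos : 0 < etaSum :=
  ((summable_exp_neg_pi_mul_sq (by norm_num : (0 : ℝ) < 1 / 24)).comp_injective
    injective_six_mul_sub_one).tsum_pos (fun _ => (exp_pos _).le) 0 (exp_pos _)

lemma etaSum_eq_theta₄ : etaSum = √6 * theta₄ 6 / 2 - √(3 / 2)⁻¹ * theta₄ (2 / 3) / 2 := by
  have h6 : (0 : ℝ) < 6 := by norm_num
  have h32 : (0 : ℝ) < 2 / 3 := by norm_num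
  have h24 : (0 : ℝ) < 1 / 24 := by norm_num
  rw [etaSum_eq_weightedTheta, weightedTheta_mod_three_two (residueIndicator_two_neg 1),
    weightedTheta_mod_three_one (abs_residueIndicator_le 2 1) (residueIndicator_two_neg 1)
      (residueIndicator_two_three_mul 1) h24, weightedTheta_odd h24,
    weightedTheta_odd (by positivity), show (4 * (1 / 24) : ℝ) = 6⁻¹ by norm_num,
    show (4 * (9 * (1 / 24)) : ℝ) = (2 / 3)⁻¹ by norm_num, theta₂_inv h6, theta₂_inv h32,
    inv_div]
  ring

/-- The square of `etaSum` in terms of `theta 3`. -/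
theorem etaSum_sq : ∃ r : ℝ, r ^ 4 = 2 ∧ theta 1 ^ 4 = (6 * √3 - 9) * theta 3 ^ 4 ∧
    etaSum ^ 2 = theta 3 ^ 2 * r * (√(2 * √3 - 3) + √3 - 1) / 2 := by
  obtain ⟨r, hr, hr4, hadd, hmul, hT⟩ := theta_three_relations
  refine ⟨r, hr4, hT, ?_⟩
  have hA := theta_pos three_pos
  have hB := theta₂_pos three_pos
  have hC := theta₄_pos three_pos
  have hG := etaSum_pos
  have h6 : √6 ^ 2 = 6 := sq_sqrt (by norm_num)
  have h3 : √3 ^ 2 = 3 := sq_sqrt (by norm_num)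
  have h3lo : (1.73 : ℝ) < √3 := lt_sqrt_of_sq_lt (by norm_num)
  have h3hi : √3 < (1.74 : ℝ) := (sqrt_lt' (by norm_num)).mpr (by norm_num)
  have hs : √(2 * √3 - 3) ^ 2 = 2 * √3 - 3 := sq_sqrt (by linarith)
  have hs0 : 0 ≤ √(2 * √3 - 3) := sqrt_nonneg _
  have h23 : √(3 / 2)⁻¹ = √6 / 3 := by
    rw [sqrt_eq_iff_mul_self_eq (by norm_num) (by positivity)]
    linear_combination -h6 / 9
  have hE := etaSum_eq_theta₄
  have hP := theta_mul_theta₄ three_pos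
  have hQ := theta_mul_theta₄ (by norm_num : (0 : ℝ) < 3⁻¹)
  have hp := theta₄_pos (by norm_num : (0 : ℝ) < 2 * 3)
  have hq := theta₄_pos (by norm_num : (0 : ℝ) < 2 * 3⁻¹)
  rw [theta_inv three_pos, theta₄_inv three_pos] at hQ
  rw [h23, show (6 : ℝ) = 2 * 3 by norm_num, show (2 / 3 : ℝ) = 2 * 3⁻¹ by norm_num,
    show (2 * 3 : ℝ) = 6 by norm_num] at hE
  rw [show (2 * 3 : ℝ) = 6 by norm_num] at hp hP
  set A := theta 3
  set B := theta₂ 3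
  set C := theta₄ 3
  set p := theta₄ 6
  set q := theta₄ (2 * 3⁻¹)
  set s := √(2 * √3 - 3)
  have hpq : p * q = A ^ 2 * r * (3 - √3) / 2 := by
    have h0 : 0 ≤ A ^ 2 * r * (3 - √3) / 2 := by
      have : 0 ≤ 3 - √3 := by linarith
      positivity
    refine (pow_left_inj₀ (by positivity) h0 two_ne_zero).mp ?_
    linear_combination (-q ^ 2) * hP - A * C * hQ + A ^ 2 * C * B * h3 + 3 * A ^ 2 * hmul -
      A ^ 4 * r ^ 2 / 4 * h3
  have hlt : B < 3 * C := by
    have hlt' : q < 3 * p := by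
      have : 0 < √6 := sqrt_pos.mpr (by norm_num)
      have : 0 < √6 / 6 * (3 * p - q) := by linear_combination hG + hE
      have := (pos_iff_pos_of_mul_pos this).mp (by positivity)
      linarith
    have : q ^ 2 < (3 * p) ^ 2 := pow_lt_pow_left₀ hlt' hq.le two_ne_zero
    have : 0 < 3 * A * (3 * C - B) := by linear_combination this - 9 * hP + hQ - A * B * h3
    have := (pos_iff_pos_of_mul_pos this).mp (by positivity)
    linarith
  have hsub : C - B = r * s * A := by
    have h : (C - B - r * s * A) * (C - B + r * s * A) = 0 := by
      linear_combination (B + C + r * A) * hadd - 4 * hmul - r ^ 2 * A ^ 2 * hs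
    rcases mul_eq_zero.mp h with h | h
    · linarith
    · have hrA : 0 < r * A := by positivity
      have hs2 : (1 / 2 : ℝ) < s := lt_sqrt_of_sq_lt (by linarith)
      nlinarith
  rw [hE]
  linear_combination ((p - q / 3) ^ 2 / 4) * h6 - (3 / 2) * hP - (1 / 6) * hQ - hpq +
    A * B / 6 * h3 + A * hadd + A / 2 * hsub

lemma half_mul_sqrt_eq : 1 / 2 * √(2048 / 243 + 3584 / (243 * √3)) =
    8 / 27 * (7 + 4 * √3) * √(2 * √3 - 3) * (√3 - 1) := by
  have h3 : √3 ^ 2 = 3 := sq_sqrt (by norm_num)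
  have h3lo : (1.73 : ℝ) < √3 := lt_sqrt_of_sq_lt (by norm_num)
  have hs : √(2 * √3 - 3) ^ 2 = 2 * √3 - 3 := sq_sqrt (by linarith)
  have hw : 0 ≤ √3 - 1 := by linarith
  have h : √(2048 / 243 + 3584 / (243 * √3)) =
      16 / 27 * (7 + 4 * √3) * √(2 * √3 - 3) * (√3 - 1) := by
    rw [sqrt_eq_iff_mul_self_eq (by positivity) (by positivity)]
    have e : 3584 / (243 * √3) = 3584 * √3 / 729 := by
      field_simp
      linear_combination -243 * h3
    rw [e]
    linear_combination (-256 / 729 * (7 + 4 * √3) ^ 2 * (√3 - 1) ^ 2) * hs -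
      256 / 729 * (32 * √3 ^ 3 - 70 * √3 + 57) * h3
  rw [h]
  ring

lemma sixteen_mul_etaSum_pow : 16 * etaSum ^ 8 / theta 1 ^ 8 =
    14 / 27 + 8 / (3 * √3) + 1 / 2 * √(2048 / 243 + 3584 / (243 * √3)) := by
  obtain ⟨r, hr4, hT, hG⟩ := etaSum_sq
  have hA := theta_pos three_pos
  have h3 : √3 ^ 2 = 3 := sq_sqrt (by norm_num)
  have h3lo : (1.73 : ℝ) < √3 := lt_sqrt_of_sq_lt (by norm_num)
  have hs : √(2 * √3 - 3) ^ 2 = 2 * √3 - 3 := sq_sqrt (by linarith)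
  have hT8 : theta 1 ^ 8 = (6 * √3 - 9) ^ 2 * theta 3 ^ 8 := by
    linear_combination (theta 1 ^ 4 + (6 * √3 - 9) * theta 3 ^ 4) * hT
  have hG8 : etaSum ^ 8 = theta 3 ^ 8 * (√(2 * √3 - 3) + √3 - 1) ^ 4 / 8 := by
    have : etaSum ^ 8 = (etaSum ^ 2) ^ 4 := by ring
    rw [this, hG]
    linear_combination (theta 3 ^ 8 * (√(2 * √3 - 3) + √3 - 1) ^ 4 / 16) * hr4
  have h0 : 6 * √3 - 9 ≠ 0 := by linarith
  have h3' : 8 / (3 * √3) = 8 * √3 / 9 := by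
    field_simp
    linear_combination -3 * h3
  rw [half_mul_sqrt_eq, h3', hG8, hT8]
  set s := √(2 * √3 - 3)
  set w := √3
  have hst : (s + w - 1) ^ 4 = 56 * w - 95 + 4 * s * (w - 1) := by
    have hq : (s + w - 1) ^ 2 = 1 + 2 * s * (w - 1) := by linear_combination hs + h3
    linear_combination ((s + w - 1) ^ 2 + 1 + 2 * s * (w - 1)) * hq + 4 * (w - 1) ^ 2 * hs +
      (8 * w - 28) * h3
  have hinv : ((6 * w - 9) ^ 2)⁻¹ = (7 + 4 * w) / 27 := by
    rw [inv_eq_iff_eq_inv, inv_div, eq_div_iff (by positivity)]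
    linear_combination (144 * w - 180) * h3
  rw [hst]
  have : 16 * (theta 3 ^ 8 * (56 * w - 95 + 4 * s * (w - 1)) / 8) / ((6 * w - 9) ^ 2 * theta 3 ^ 8)
      = 2 * (56 * w - 95 + 4 * s * (w - 1)) * ((6 * w - 9) ^ 2)⁻¹ := by
    field_simp
    ring
  rw [this, hinv]
  linear_combination (448 / 27) * h3

lemma exp_neg_pi_mul_zpow (k : ℤ) : exp (-π) ^ ((1 : ℝ) / 24) * exp (-π) ^ (k * (3 * k - 1) / 2) =
    exp (-π * (1 / 24) * ((6 * k - 1 : ℤ) : ℝ) ^ 2) := by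
  have hdvd : 2 ∣ k * (3 * k - 1) := by
    rcases Int.even_or_odd k with ⟨m, rfl⟩ | ⟨m, rfl⟩
    · exact Dvd.dvd.mul_right ⟨m, by ring⟩ _
    · exact Dvd.dvd.mul_left ⟨3 * m + 1, by ring⟩ _
  obtain ⟨m, hm⟩ := hdvd
  have hm' : (k : ℝ) * (3 * k - 1) = 2 * m := by exact_mod_cast hm
  rw [hm, Int.mul_ediv_cancel_left m two_ne_zero, ← exp_mul, ← rpow_intCast, ← exp_mul, ← exp_add]
  congr 1
  push_cast
  linear_combination π / 2 * hm'

lemma summable_exp_neg_pi_pentagonal :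
    Summable fun k : ℤ => exp (-π) ^ (k * (3 * k - 1) / 2) := by
  have h := (summable_exp_neg_pi_mul_sq (by norm_num : (0 : ℝ) < 1 / 24)).comp_injective
    injective_six_mul_sub_one
  refine (summable_mul_left_iff (rpow_pos_of_pos (exp_pos (-π)) (1 / 24)).ne').mp ?_
  exact h.congr fun k => (exp_neg_pi_mul_zpow k).symm

lemma const_pow_eight : (2 * π ^ ((3 : ℝ) / 4) / Real.Gamma (1 / 4)) ^ 8 = 16 / theta 1 ^ 8 := by
  have hΓ : 0 < Real.Gamma (1 / 4) := Real.Gamma_pos_of_pos (by norm_num)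
  have hπ : (π ^ ((3 : ℝ) / 4)) ^ 8 = π ^ 6 := by
    rw [← rpow_natCast, ← rpow_mul pi_pos.le, ← rpow_natCast]
    norm_num
  have hsq : √π ^ 2 = π := sq_sqrt pi_pos.le
  have hs4 : √π ^ 4 = π ^ 2 := by linear_combination (√π ^ 2 + π) * hsq
  have h8 : theta 1 ^ 8 = (theta 1 ^ 2) ^ 4 := by ring
  rw [h8, theta_one_sq, div_pow, mul_pow, hπ, div_pow, mul_pow, hs4]
  field_simp
  norm_num

theorem theta_pentagonal_eval_at_exp_neg_pi :
    Summable (fun k : ℤ => (Real.exp (-π)) ^ (k * (3 * k - 1) / 2)) ∧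
      ((Real.exp (-π)) ^ ((1 : ℝ) / 24) * (2 * π ^ ((3 : ℝ) / 4) / Real.Gamma (1 / 4)) *
          ∑' k : ℤ, (Real.exp (-π)) ^ (k * (3 * k - 1) / 2)) ^ 8 =
        14 / 27 + 8 / (3 * Real.sqrt 3) +
          1 / 2 * Real.sqrt (2048 / 243 + 3584 / (243 * Real.sqrt 3)) := by
  refine ⟨summable_exp_neg_pi_pentagonal, ?_⟩
  have h : exp (-π) ^ ((1 : ℝ) / 24) * ∑' k : ℤ, exp (-π) ^ (k * (3 * k - 1) / 2) = etaSum := by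
    rw [← tsum_mul_left]
    exact tsum_congr exp_neg_pi_mul_zpow
  rw [mul_right_comm, h, mul_pow, const_pow_eight, ← sixteen_mul_etaSum_pow]
  ring
end

section
/- For every real q with 0 < q < 1 and every real c > 0, the generalized continued fraction 1/(1 + cq/(1 + c(q² − q)/(1 + cq³/(1 + c(q⁴ − q²)/(1 + ⋯))))) — with b₀ = 0, all partial denominators 1, first partial numerator 1, and subsequent partial numerators a_{2k+1} = c q^{2k+1} and a_{2k} = c(q^{2k} − qᵏ) for k ≥ 1 — converges, and its value equals the partial theta series ∑_{k=0}^∞ (−c)ᵏ q^{k(k+1)/2}. -/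
/-- The generalized continued fraction
`1/(1 + cq/(1 + c(q² − q)/(1 + cq³/(1 + c(q⁴ − q²)/(1 + ⋯)))))`:
head term `0`, all partial denominators `1`, first partial numerator `1`, and the
`m`-th subsequent partial numerator equal to `c·qᵐ` for odd `m` and
`c·(qᵐ − q^{m/2})` for even `m`. -/
noncomputable def partialThetaGCF (c q : ℝ) : GenContFract ℝ :=
  ⟨0, Stream'.Seq.ofStream (fun m : ℕ =>
    ⟨if m = 0 then 1
      else if m % 2 = 1 then c * q ^ m
      else c * (q ^ m - q ^ (m / 2)), 1⟩)⟩

namespace PartialTheta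

/-- The Rogers–Szegő polynomials, through the recurrence `Hₖ₊₁(x) = Hₖ(qx) + x Hₖ(x)`. -/
noncomputable def rogersSzego (q : ℝ) : ℕ → ℝ → ℝ
  | 0, _ => 1
  | k + 1, x => rogersSzego q k (q * x) + x * rogersSzego q k x

theorem one_le_rogersSzego {q : ℝ} (hq : 0 ≤ q) (k : ℕ) {x : ℝ} (hx : 0 ≤ x) :
    1 ≤ rogersSzego q k x := by
  induction k generalizing x with
  | zero => simp [rogersSzego]
  | succ k ih =>
    have h₁ := ih (mul_nonneg hq hx)
    have h₂ := mul_nonneg hx (zero_le_one.trans (ih hx))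
    simp only [rogersSzego]
    linarith

theorem rogersSzego_succ_sub (q : ℝ) (k : ℕ) (x : ℝ) :
    rogersSzego q (k + 1) x - rogersSzego q (k + 1) (q * x)
      = (1 - q ^ (k + 1)) * x * rogersSzego q k x := by
  induction k generalizing x with
  | zero => simp [rogersSzego]; ring
  | succ k ih =>
    have h₁ := ih x
    have h₂ := ih (q * x)
    have h₃ : rogersSzego q (k + 1) x = rogersSzego q k (q * x) + x * rogersSzego q k x := rfl
    rw [show rogersSzego q (k + 2) x
        = rogersSzego q (k + 1) (q * x) + x * rogersSzego q (k + 1) x from rfl,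
      show rogersSzego q (k + 2) (q * x)
        = rogersSzego q (k + 1) (q * (q * x)) + q * x * rogersSzego q (k + 1) (q * x) from rfl]
    linear_combination h₂ + q * x * h₁ - (1 - q ^ (k + 1)) * q * x * h₃

theorem rogersSzego_succ_mul (q : ℝ) (k : ℕ) (x : ℝ) :
    rogersSzego q (k + 1) (q * x)
      = rogersSzego q k (q * x) + q ^ (k + 1) * x * rogersSzego q k x := by
  have h₁ := rogersSzego_succ_sub q k x
  have h₂ : rogersSzego q (k + 1) x = rogersSzego q k (q * x) + x * rogersSzego q k x := rfl
  linear_combination h₂ - h₁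

theorem triangle_succ (k : ℕ) : (k + 1) * (k + 1 + 1) / 2 = k * (k + 1) / 2 + k + 1 := by
  have h : (k + 1) * (k + 1 + 1) = k * (k + 1) + (k + 1) * 2 := by ring
  rw [h, Nat.add_mul_div_right _ _ two_pos, add_assoc]

theorem pow_triangle_succ (q : ℝ) (k : ℕ) :
    q ^ ((k + 1) * (k + 1 + 1) / 2) = q ^ (k * (k + 1) / 2) * q ^ (k + 1) := by
  rw [triangle_succ, add_assoc, pow_add]

theorem summable_pow_mul_pow_triangle {q : ℝ} (hq0 : 0 < q) (hq1 : q < 1) (c : ℝ) :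
    Summable fun k : ℕ => c ^ k * q ^ (k * (k + 1) / 2) := by
  rcases eq_or_ne c 0 with rfl | hc
  · exact summable_of_ne_finset_zero (s := {0}) fun k hk => by
      simp [zero_pow (by simpa using hk : k ≠ 0)]
  refine summable_of_ratio_test_tendsto_lt_one (l := 0) one_pos
    (Filter.Eventually.of_forall fun k => by positivity) ?_
  have h : Filter.Tendsto (fun k : ℕ => |c| * q ^ (k + 1)) Filter.atTop (nhds (|c| * 0)) :=
    ((tendsto_pow_atTop_nhds_zero_of_lt_one hq0.le hq1).comp
      (Filter.tendsto_add_atTop_nat 1)).const_mul _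
  rw [mul_zero] at h
  refine h.congr fun k => ?_
  rw [pow_triangle_succ, pow_succ c, ← norm_div, eq_comm]
  have : c ^ k * c * (q ^ (k * (k + 1) / 2) * q ^ (k + 1)) / (c ^ k * q ^ (k * (k + 1) / 2))
      = c * q ^ (k + 1) := by field_simp
  rw [this, norm_mul, Real.norm_eq_abs, Real.norm_eq_abs, abs_of_pos (pow_pos hq0 _)]

/-- The `q`-Pochhammer product `(q^{s+1}; q)ₖ`. -/
noncomputable def qPoch (q : ℝ) (k s : ℕ) : ℝ := ∏ l ∈ Finset.range k, (1 - q ^ (s + l + 1))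

theorem qPoch_succ (q : ℝ) (k s : ℕ) :
    qPoch q (k + 1) s = qPoch q k s * (1 - q ^ (s + k + 1)) :=
  Finset.prod_range_succ _ _

theorem qPoch_succ' (q : ℝ) (k s : ℕ) :
    qPoch q (k + 1) s = qPoch q k (s + 1) * (1 - q ^ (s + 1)) := by
  simp only [qPoch, Finset.prod_range_succ', add_zero]
  congr 1
  exact Finset.prod_congr rfl fun l _ => by ring_nf

theorem abs_qPoch_le_one {q : ℝ} (hq0 : 0 < q) (hq1 : q < 1) (k s : ℕ) : |qPoch q k s| ≤ 1 := by
  rw [qPoch, Finset.abs_prod]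
  refine Finset.prod_le_one (fun _ _ => abs_nonneg _) fun l _ => ?_
  have h₁ := pow_pos hq0 (s + l + 1)
  have h₂ := pow_le_one₀ (n := s + l + 1) hq0.le hq1.le
  rw [abs_le]
  constructor <;> linarith

/-- The terms of the series for the remainder at the denominator of index `2k`. -/
noncomputable def evenTerm (c q : ℝ) (k s : ℕ) : ℝ :=
  (-1) ^ k * (-c) ^ (2 * k + s)
    * (q ^ (k ^ 2 + k * s) * q ^ (k * (k + 1) / 2) * q ^ (s * (s + 1) / 2)) * qPoch q k s

/-- The terms of the series for the remainder at the denominator of index `2k + 1`. -/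
noncomputable def oddTerm (c q : ℝ) (k s : ℕ) : ℝ := -c * q ^ (2 * k + 1 + s) * evenTerm c q k s

theorem oddTerm_add_evenTerm_zero (c q : ℝ) (k : ℕ) :
    oddTerm c q k 0 + c * q ^ (2 * k + 1) * evenTerm c q k 0 = 0 := by
  simp [oddTerm]

theorem oddTerm_add_evenTerm_succ (c q : ℝ) (k s : ℕ) :
    oddTerm c q k (s + 1) + c * q ^ (2 * k + 1) * evenTerm c q k (s + 1)
      = evenTerm c q (k + 1) s := by
  simp only [oddTerm, evenTerm, qPoch_succ', pow_triangle_succ]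
  ring

theorem evenTerm_add_oddTerm (c q : ℝ) (k s : ℕ) :
    evenTerm c q (k + 1) s + c * (q ^ (2 * k + 2) - q ^ (k + 1)) * oddTerm c q k s
      = (-1) ^ (k + 1) * (-c) ^ (2 * k + 2 + s) * (q ^ ((k + 1) ^ 2 + (k + 1) * s)
        * q ^ (k * (k + 1) / 2) * q ^ (2 * k + 2) * q ^ (s * (s + 1) / 2))
        * (qPoch q k s * (1 - q ^ s)) := by
  simp only [oddTerm, evenTerm, qPoch_succ, pow_triangle_succ]
  ring

theorem evenTerm_add_oddTerm_zero (c q : ℝ) (k : ℕ) :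
    evenTerm c q (k + 1) 0 + c * (q ^ (2 * k + 2) - q ^ (k + 1)) * oddTerm c q k 0 = 0 := by
  rw [evenTerm_add_oddTerm]
  simp

theorem evenTerm_add_oddTerm_succ (c q : ℝ) (k s : ℕ) :
    evenTerm c q (k + 1) (s + 1) + c * (q ^ (2 * k + 2) - q ^ (k + 1)) * oddTerm c q k (s + 1)
      = oddTerm c q (k + 1) s := by
  rw [evenTerm_add_oddTerm, ← qPoch_succ']
  simp only [oddTerm, evenTerm, pow_triangle_succ]
  ring

theorem abs_evenTerm_le {c q : ℝ} (hc : 0 < c) (hq0 : 0 < q) (hq1 : q < 1) (k s : ℕ) :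
    |evenTerm c q k s|
      ≤ (c ^ 2) ^ k * q ^ (k * (k + 1) / 2) * (c ^ s * q ^ (s * (s + 1) / 2)) := by
  have h₁ := abs_qPoch_le_one hq0 hq1 k s
  have h₂ := pow_le_one₀ (n := k ^ 2 + k * s) hq0.le hq1.le
  have h₃ : q ^ (k ^ 2 + k * s) * |qPoch q k s| ≤ 1 :=
    mul_le_one₀ h₂ (abs_nonneg _) h₁
  have h₄ : 0 ≤ (c ^ 2) ^ k * q ^ (k * (k + 1) / 2) * (c ^ s * q ^ (s * (s + 1) / 2)) := by
    positivity
  calc |evenTerm c q k s|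
      = (c ^ 2) ^ k * q ^ (k * (k + 1) / 2) * (c ^ s * q ^ (s * (s + 1) / 2))
          * (q ^ (k ^ 2 + k * s) * |qPoch q k s|) := by
        simp only [evenTerm, abs_mul, abs_pow, abs_neg, abs_one, one_pow, abs_of_pos hc,
          abs_of_pos hq0]
        ring
    _ ≤ _ := mul_le_of_le_one_right h₄ h₃

theorem abs_oddTerm_le {c q : ℝ} (hc : 0 < c) (hq0 : 0 < q) (hq1 : q < 1) (k s : ℕ) :
    |oddTerm c q k s| ≤ c * |evenTerm c q k s| := by
  have h := pow_le_one₀ (n := 2 * k + 1 + s) hq0.le hq1.le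
  rw [oddTerm, abs_mul, abs_mul, abs_neg, abs_pow, abs_of_pos hc, abs_of_pos hq0]
  gcongr
  exact mul_le_of_le_one_right hc.le h

section Remainder

variable {c q : ℝ}

theorem summable_evenTerm (hc : 0 < c) (hq0 : 0 < q) (hq1 : q < 1) (k : ℕ) :
    Summable (evenTerm c q k) :=
  Summable.of_norm_bounded ((summable_pow_mul_pow_triangle hq0 hq1 c).mul_left _)
    (abs_evenTerm_le hc hq0 hq1 k)

theorem summable_oddTerm (hc : 0 < c) (hq0 : 0 < q) (hq1 : q < 1) (k : ℕ) :
    Summable (oddTerm c q k) :=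
  Summable.of_norm_bounded ((summable_evenTerm hc hq0 hq1 k).abs.mul_left c)
    (abs_oddTerm_le hc hq0 hq1 k)

theorem abs_tsum_evenTerm_le (hc : 0 < c) (hq0 : 0 < q) (hq1 : q < 1) (k : ℕ) :
    |∑' s, evenTerm c q k s|
      ≤ (c ^ 2) ^ k * q ^ (k * (k + 1) / 2) * ∑' s : ℕ, c ^ s * q ^ (s * (s + 1) / 2) := by
  rw [← Real.norm_eq_abs]
  exact tsum_of_norm_bounded ((summable_pow_mul_pow_triangle hq0 hq1 c).hasSum.mul_left _)
    (abs_evenTerm_le hc hq0 hq1 k)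

theorem abs_tsum_oddTerm_le (hc : 0 < c) (hq0 : 0 < q) (hq1 : q < 1) (k : ℕ) :
    |∑' s, oddTerm c q k s|
      ≤ c * ((c ^ 2) ^ k * q ^ (k * (k + 1) / 2)
        * ∑' s : ℕ, c ^ s * q ^ (s * (s + 1) / 2)) := by
  rw [← Real.norm_eq_abs]
  exact tsum_of_norm_bounded
    (((summable_pow_mul_pow_triangle hq0 hq1 c).hasSum.mul_left _).mul_left c)
    fun s => (abs_oddTerm_le hc hq0 hq1 k s).trans
      (mul_le_mul_of_nonneg_left (abs_evenTerm_le hc hq0 hq1 k s) hc.le)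

theorem tsum_evenTerm_succ (hc : 0 < c) (hq0 : 0 < q) (hq1 : q < 1) (k : ℕ) :
    ∑' s, evenTerm c q (k + 1) s
      = ∑' s, oddTerm c q k s + c * q ^ (2 * k + 1) * ∑' s, evenTerm c q k s := by
  have ho := summable_oddTerm hc hq0 hq1 k
  have he := (summable_evenTerm hc hq0 hq1 k).mul_left (c * q ^ (2 * k + 1))
  rw [← tsum_mul_left, ← ho.tsum_add he, (ho.add he).tsum_eq_zero_add,
    oddTerm_add_evenTerm_zero, zero_add]
  exact tsum_congr fun s => (oddTerm_add_evenTerm_succ c q k s).symm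

theorem tsum_oddTerm_succ (hc : 0 < c) (hq0 : 0 < q) (hq1 : q < 1) (k : ℕ) :
    ∑' s, oddTerm c q (k + 1) s = ∑' s, evenTerm c q (k + 1) s
      + c * (q ^ (2 * k + 2) - q ^ (k + 1)) * ∑' s, oddTerm c q k s := by
  have he := summable_evenTerm hc hq0 hq1 (k + 1)
  have ho := (summable_oddTerm hc hq0 hq1 k).mul_left (c * (q ^ (2 * k + 2) - q ^ (k + 1)))
  rw [← tsum_mul_left, ← he.tsum_add ho, (he.add ho).tsum_eq_zero_add,
    evenTerm_add_oddTerm_zero, zero_add]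
  exact tsum_congr fun s => (evenTerm_add_oddTerm_succ c q k s).symm

theorem tsum_evenTerm_zero (c q : ℝ) :
    ∑' s, evenTerm c q 0 s = ∑' k : ℕ, (-c) ^ k * q ^ (k * (k + 1) / 2) :=
  tsum_congr fun s => by simp [evenTerm, qPoch]

theorem tsum_oddTerm_zero (hq0 : 0 < q) (hq1 : q < 1) :
    ∑' s, oddTerm c q 0 s = ∑' k : ℕ, (-c) ^ k * q ^ (k * (k + 1) / 2) - 1 := by
  rw [(summable_pow_mul_pow_triangle hq0 hq1 (-c)).tsum_eq_zero_add]
  simp only [pow_zero, zero_mul, Nat.zero_div, mul_one, add_sub_cancel_left]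
  refine tsum_congr fun s => ?_
  rw [pow_triangle_succ]
  simp only [oddTerm, evenTerm, qPoch, Finset.range_zero, Finset.prod_empty]
  simp
  ring

end Remainder

section Continuants

variable (c q : ℝ)

theorem dens_zero : (partialThetaGCF c q).dens 0 = 1 := GenContFract.zeroth_den_eq_one

theorem nums_zero : (partialThetaGCF c q).nums 0 = 0 := GenContFract.zeroth_num_eq_h

theorem dens_one : (partialThetaGCF c q).dens 1 = 1 :=
  GenContFract.first_den_eq (gp := ⟨1, 1⟩) rfl

theorem nums_one : (partialThetaGCF c q).nums 1 = 1 := by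
  rw [GenContFract.first_num_eq (g := partialThetaGCF c q) (gp := ⟨1, 1⟩) rfl]
  simp [partialThetaGCF]

theorem partialNumerator_odd (k : ℕ) :
    (partialThetaGCF c q).s.get? (2 * k + 1) = some ⟨c * q ^ (2 * k + 1), 1⟩ := by
  change some _ = some _
  simp [Stream'.get, Nat.add_mod]

theorem partialNumerator_even (k : ℕ) : (partialThetaGCF c q).s.get? (2 * k + 2)
    = some ⟨c * (q ^ (2 * k + 2) - q ^ (k + 1)), 1⟩ := by
  change some _ = some _
  have h : (2 * k + 2) / 2 = k + 1 := by omega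
  simp [Stream'.get, h]

theorem dens_even_succ (k : ℕ) : (partialThetaGCF c q).dens (2 * k + 2)
    = (partialThetaGCF c q).dens (2 * k + 1)
      + c * q ^ (2 * k + 1) * (partialThetaGCF c q).dens (2 * k) := by
  simpa using GenContFract.dens_recurrence (partialNumerator_odd c q k) rfl rfl

theorem nums_even_succ (k : ℕ) : (partialThetaGCF c q).nums (2 * k + 2)
    = (partialThetaGCF c q).nums (2 * k + 1)
      + c * q ^ (2 * k + 1) * (partialThetaGCF c q).nums (2 * k) := by
  simpa using GenContFract.nums_recurrence (partialNumerator_odd c q k) rfl rfl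

theorem dens_odd_succ (k : ℕ) : (partialThetaGCF c q).dens (2 * k + 3)
    = (partialThetaGCF c q).dens (2 * k + 2)
      + c * (q ^ (2 * k + 2) - q ^ (k + 1)) * (partialThetaGCF c q).dens (2 * k + 1) := by
  simpa using GenContFract.dens_recurrence (partialNumerator_even c q k) rfl rfl

theorem nums_odd_succ (k : ℕ) : (partialThetaGCF c q).nums (2 * k + 3)
    = (partialThetaGCF c q).nums (2 * k + 2)
      + c * (q ^ (2 * k + 2) - q ^ (k + 1)) * (partialThetaGCF c q).nums (2 * k + 1) := by
  simpa using GenContFract.nums_recurrence (partialNumerator_even c q k) rfl rfl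

theorem dens_eq_rogersSzego (k : ℕ) :
    (partialThetaGCF c q).dens (2 * k) = rogersSzego q k (c * q ^ k) ∧
      (partialThetaGCF c q).dens (2 * k + 1) = rogersSzego q k (c * q ^ (k + 1)) := by
  induction k with
  | zero => exact ⟨dens_zero c q, dens_one c q⟩
  | succ k ih =>
    have hpow (j : ℕ) : c * q ^ (j + 1) = q * (c * q ^ j) := by ring
    have he : (partialThetaGCF c q).dens (2 * k + 2)
        = rogersSzego q (k + 1) (c * q ^ (k + 1)) := by
      rw [dens_even_succ, ih.1, ih.2, hpow k, rogersSzego_succ_mul]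
      ring
    refine ⟨he, ?_⟩
    have h := rogersSzego_succ_sub q k (c * q ^ (k + 1))
    rw [show 2 * (k + 1) + 1 = 2 * k + 3 by ring, dens_odd_succ, he, ih.2, hpow (k + 1)]
    linear_combination h

theorem one_le_dens {c q : ℝ} (hc : 0 ≤ c) (hq : 0 ≤ q) (n : ℕ) :
    1 ≤ (partialThetaGCF c q).dens n := by
  obtain ⟨k, rfl | rfl⟩ := n.even_or_odd'
  · rw [(dens_eq_rogersSzego c q k).1]
    exact one_le_rogersSzego hq k (by positivity)
  · rw [(dens_eq_rogersSzego c q k).2]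
    exact one_le_rogersSzego hq k (by positivity)

theorem remainder_eq_tsum {c q : ℝ} (hc : 0 < c) (hq0 : 0 < q) (hq1 : q < 1) (k : ℕ) :
    (∑' j : ℕ, (-c) ^ j * q ^ (j * (j + 1) / 2)) * (partialThetaGCF c q).dens (2 * k)
        - (partialThetaGCF c q).nums (2 * k) = ∑' s, evenTerm c q k s ∧
      (∑' j : ℕ, (-c) ^ j * q ^ (j * (j + 1) / 2)) * (partialThetaGCF c q).dens (2 * k + 1)
        - (partialThetaGCF c q).nums (2 * k + 1) = ∑' s, oddTerm c q k s := by
  induction k with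
  | zero =>
    simp only [mul_zero, zero_add, dens_zero, nums_zero, dens_one, nums_one]
    rw [tsum_evenTerm_zero, tsum_oddTerm_zero hq0 hq1]
    constructor <;> ring
  | succ k ih =>
    obtain ⟨ihe, iho⟩ := ih
    rw [show 2 * (k + 1) + 1 = 2 * k + 3 by ring, show 2 * (k + 1) = 2 * k + 2 by ring,
      dens_odd_succ, nums_odd_succ, dens_even_succ, nums_even_succ,
      tsum_oddTerm_succ hc hq0 hq1, tsum_evenTerm_succ hc hq0 hq1, ← ihe, ← iho]
    constructor <;> ring

theorem abs_remainder_le {c q : ℝ} (hc : 0 < c) (hq0 : 0 < q) (hq1 : q < 1) (n : ℕ) :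
    |(∑' j : ℕ, (-c) ^ j * q ^ (j * (j + 1) / 2)) * (partialThetaGCF c q).dens n
        - (partialThetaGCF c q).nums n|
      ≤ (1 + c) * ((c ^ 2) ^ (n / 2) * q ^ (n / 2 * (n / 2 + 1) / 2)
        * ∑' s : ℕ, c ^ s * q ^ (s * (s + 1) / 2)) := by
  have hpos (k : ℕ) : 0 ≤ (c ^ 2) ^ k * q ^ (k * (k + 1) / 2)
      * ∑' s : ℕ, c ^ s * q ^ (s * (s + 1) / 2) :=
    (abs_nonneg _).trans (abs_tsum_evenTerm_le hc hq0 hq1 k)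
  obtain ⟨k, rfl | rfl⟩ := n.even_or_odd'
  · rw [(remainder_eq_tsum hc hq0 hq1 k).1, show 2 * k / 2 = k by omega]
    refine (abs_tsum_evenTerm_le hc hq0 hq1 k).trans ?_
    exact le_mul_of_one_le_left (hpos k) (by linarith)
  · rw [(remainder_eq_tsum hc hq0 hq1 k).2, show (2 * k + 1) / 2 = k by omega]
    refine (abs_tsum_oddTerm_le hc hq0 hq1 k).trans ?_
    exact mul_le_mul_of_nonneg_right (by linarith) (hpos k)

end Continuants

end PartialTheta

open PartialTheta in
theorem partialThetaGCF_tendsto (c q : ℝ) (hc : 0 < c) (hq0 : 0 < q) (hq1 : q < 1) :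
    Filter.Tendsto (partialThetaGCF c q).convs Filter.atTop
      (nhds (∑' k : ℕ, (-c) ^ k * q ^ (k * (k + 1) / 2))) := by
  have hlim := ((((summable_pow_mul_pow_triangle hq0 hq1 (c ^ 2)).tendsto_atTop_zero.comp
    (Nat.tendsto_div_const_atTop two_ne_zero)).mul_const
      (∑' s : ℕ, c ^ s * q ^ (s * (s + 1) / 2))).const_mul (1 + c))
  rw [zero_mul, mul_zero] at hlim
  refine tendsto_iff_dist_tendsto_zero.mpr ?_
  refine squeeze_zero (fun _ => dist_nonneg) (fun n => ?_) hlim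
  have hd := one_le_dens hc.le hq0.le n
  have hd0 : 0 < (partialThetaGCF c q).dens n := zero_lt_one.trans_le hd
  refine le_trans ?_ (abs_remainder_le hc hq0 hq1 n)
  change dist ((partialThetaGCF c q).nums n / (partialThetaGCF c q).dens n) _ ≤ _
  rw [dist_comm, Real.dist_eq, sub_div' hd0.ne', abs_div,
    abs_of_pos hd0]
  exact div_le_self (abs_nonneg _) hd
end

section
/- For every real q with 0 < q < 1, the generalized continued fraction 1/((1 + q) + q²/((1 + q³) + q⁴/((1 + q⁵) + ⋯))) — with b₀ = 0, first partial numerator 1, n-th partial denominator 1 + q^{2n−1}, and (n+1)-st partial numerator q^{2n} — converges, and its value equals ∏_{n=1}^∞ [(1 − q^{8n−7})(1 − q^{8n−1})] / [(1 − q^{8n−5})(1 − q^{8n−3})]. -/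
/-- The Ramanujan–Göllnitz–Gordon generalized continued fraction
`1/((1 + q) + q²/((1 + q³) + q⁴/((1 + q⁵) + ⋯)))`:
head term `0`, `n`-th partial numerator `q^{2(n-1)}` (so the first is `1`) and
`n`-th partial denominator `1 + q^{2n-1}`. -/
noncomputable def gollnitzGordonGCF (q : ℝ) : GenContFract ℝ :=
  ⟨0, Stream'.Seq.ofStream (fun n : ℕ => ⟨q ^ (2 * n), 1 + q ^ (2 * n + 1)⟩)⟩

open Filter Topology Finset

namespace GenContFract

variable {g : GenContFract ℝ} {a b : ℕ → ℝ}

/-- The continuants of a continued fraction with head term `0` express every solution of its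
three-term recurrence through the first two values. -/
theorem contsAux_mul_add_eq_of_recurrence (hh : g.h = 0)
    (hs : ∀ n, g.s.get? n = some ⟨a n, b n⟩) {f : ℕ → ℝ}
    (hf : ∀ n, f (n + 2) = b n * f (n + 1) + a n * f n) (n : ℕ) :
    (g.contsAux n).a * f 0 + (g.contsAux n).b * f 1 = f n := by
  induction n using Nat.twoStepInduction with
  | zero => simp
  | one => simp [hh]
  | more n ih₁ ih₂ =>
    rw [contsAux_recurrence (hs n) rfl rfl, hf]
    linear_combination b n * ih₂ + a n * ih₁

theorem one_le_dens (hs : ∀ n, g.s.get? n = some ⟨a n, b n⟩) (ha : ∀ n, 0 ≤ a n)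
    (hb : ∀ n, 1 ≤ b n) (n : ℕ) : 1 ≤ g.dens n := by
  suffices h : 0 ≤ (g.contsAux n).b ∧ 1 ≤ (g.contsAux (n + 1)).b from h.2
  induction n with
  | zero => simp
  | succ n ih =>
    refine ⟨zero_le_one.trans ih.2, ?_⟩
    rw [contsAux_recurrence (hs n) rfl rfl]
    nlinarith [mul_nonneg (ha n) ih.1, mul_le_mul (hb n) ih.2 zero_le_one
      (zero_le_one.trans (hb n))]

/-- If the recurrence of a continued fraction with nonnegative numerators and with denominators at
least `1` has a solution that tends to zero, then the continued fraction converges to minus the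
quotient of the first two values of that solution. -/
theorem tendsto_convs_of_recurrence (hh : g.h = 0)
    (hs : ∀ n, g.s.get? n = some ⟨a n, b n⟩) (ha : ∀ n, 0 ≤ a n) (hb : ∀ n, 1 ≤ b n)
    {f : ℕ → ℝ} (hf : ∀ n, f (n + 2) = b n * f (n + 1) + a n * f n)
    (hf₀ : f 0 ≠ 0) (hlim : Tendsto f atTop (𝓝 0)) :
    Tendsto g.convs atTop (𝓝 (-f 1 / f 0)) := by
  have hB := one_le_dens hs ha hb
  have herr : Tendsto (fun n => f (n + 1) / (g.dens n * f 0)) atTop (𝓝 0) := by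
    have h1 := ((hlim.comp (tendsto_add_atTop_nat 1)).div_const (f 0)).norm
    rw [zero_div, norm_zero] at h1
    refine squeeze_zero_norm (fun n => ?_) h1
    have := hB n
    simp only [Function.comp_apply, norm_div, norm_mul]
    gcongr
    exact le_mul_of_one_le_left (norm_nonneg _) (this.trans (le_abs_self _))
  have heq : ∀ n, g.convs n = f (n + 1) / (g.dens n * f 0) + -f 1 / f 0 := fun n => by
    have h := contsAux_mul_add_eq_of_recurrence hh hs hf (n + 1)
    have hn : g.dens n ≠ 0 := (zero_lt_one.trans_le (hB n)).ne'
    rw [conv_eq_num_div_den, ← h]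
    change g.nums n / g.dens n = (g.nums n * f 0 + g.dens n * f 1) / _ + _
    field_simp
    ring
  simpa only [← heq, zero_add] using herr.add_const (-f 1 / f 0)

end GenContFract

/-- The reciprocal of `∏_{j=1}^k (1 - pʲ)`, extended by zero to negative `k`. -/
noncomputable def invQFactorial (p : ℝ) (k : ℤ) : ℝ :=
  if k < 0 then 0 else (∏ j ∈ range k.toNat, (1 - p ^ (j + 1)))⁻¹

theorem invQFactorial_natCast (p : ℝ) (n : ℕ) :
    invQFactorial p n = (∏ j ∈ range n, (1 - p ^ (j + 1)))⁻¹ := by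
  simp [invQFactorial]

theorem invQFactorial_of_neg (p : ℝ) {k : ℤ} (hk : k < 0) : invQFactorial p k = 0 := by
  simp [invQFactorial, hk]

theorem invQFactorial_sub_one {p : ℝ} (hp0 : 0 < p) (hp1 : p < 1) (k : ℤ) :
    invQFactorial p (k - 1) = (1 - p ^ k) * invQFactorial p k := by
  rcases lt_trichotomy k 0 with hk | rfl | hk
  · rw [invQFactorial_of_neg p hk, invQFactorial_of_neg p (by lia), mul_zero]
  · rw [invQFactorial_of_neg p (by lia)]; simp
  · obtain ⟨n, rfl⟩ : ∃ n : ℕ, k = (n + 1 : ℕ) := ⟨(k - 1).toNat, by lia⟩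
    have h : (1 - p ^ (n + 1)) ≠ 0 := (sub_pos.2 (pow_lt_one₀ hp0.le hp1 n.succ_ne_zero)).ne'
    rw [show ((n + 1 : ℕ) : ℤ) - 1 = (n : ℕ) by lia, invQFactorial_natCast, invQFactorial_natCast,
      prod_range_succ, zpow_natCast]
    field_simp

theorem exists_pos_le_prod_one_sub_pow {p : ℝ} (hp0 : 0 < p) (hp1 : p < 1) :
    ∃ δ, 0 < δ ∧ (∀ n, δ ≤ ∏ j ∈ range n, (1 - p ^ (j + 1))) ∧
      Tendsto (fun n => ∏ j ∈ range n, (1 - p ^ (j + 1))) atTop (𝓝 δ) := by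
  have hpos : ∀ j : ℕ, 0 < 1 - p ^ (j + 1) := fun j =>
    sub_pos.2 (pow_lt_one₀ hp0.le hp1 j.succ_ne_zero)
  have hsum : Summable fun j : ℕ => ‖-p ^ (j + 1)‖ := by
    simpa only [norm_neg, pow_succ] using
      ((summable_geometric_of_lt_one hp0.le hp1).mul_right p).norm
  have hlim := (multipliable_one_add_of_summable hsum).tendsto_prod_tprod_nat
  have hne := tprod_one_add_ne_zero_of_summable
    (f := fun j : ℕ => -p ^ (j + 1)) (fun j => by simpa [← sub_eq_add_neg] using (hpos j).ne') hsum
  simp only [← sub_eq_add_neg] at hlim hne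
  have hanti : Antitone fun n => ∏ j ∈ range n, (1 - p ^ (j + 1)) :=
    antitone_nat_of_succ_le fun n => by
      rw [prod_range_succ]
      exact mul_le_of_le_one_right (prod_nonneg fun j _ => (hpos j).le)
        (sub_le_self _ (pow_nonneg hp0.le _))
  refine ⟨_, lt_of_le_of_ne ?_ hne.symm, hanti.le_of_tendsto hlim, hlim⟩
  exact ge_of_tendsto' hlim fun n => prod_nonneg fun j _ => (hpos j).le

/-- The summand `(-1)ʳ s^(r²) wʳ` of the theta series. -/
noncomputable def thetaTerm (s w : ℝ) (r : ℤ) : ℝ := (-1) ^ r * s ^ (r ^ 2) * w ^ r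

theorem thetaTerm_natCast (s w : ℝ) (n : ℕ) :
    thetaTerm s w n = (-1) ^ n * (s ^ n ^ 2 * w ^ n) := by
  simp only [thetaTerm, zpow_natCast, mul_assoc]
  norm_cast

theorem thetaTerm_neg_add_one (s w : ℝ) (n : ℕ) :
    thetaTerm s w (-(n + 1)) = -((-1) ^ n * (s ^ (n + 1) ^ 2 * (w ^ (n + 1))⁻¹)) := by
  have h : ((-1 : ℝ)) ^ (-((n : ℤ) + 1)) = -(-1) ^ n := by
    rw [zpow_neg, ← inv_zpow, inv_neg, inv_one, zpow_add_one₀ (by norm_num), zpow_natCast]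
    ring
  rw [thetaTerm, h, neg_sq, zpow_neg, neg_mul, neg_mul, mul_assoc]
  norm_cast

theorem abs_thetaTerm_natCast_le {s w : ℝ} (hs0 : 0 < s) (hs1 : s < 1) (hw0 : 0 < w) (hw : w ≤ 1)
    (n : ℕ) : |thetaTerm s w n| ≤ s ^ n := by
  rw [thetaTerm_natCast, abs_mul, abs_pow, abs_neg, abs_one, one_pow, one_mul,
    abs_of_nonneg (by positivity)]
  calc s ^ n ^ 2 * w ^ n ≤ s ^ n * 1 := by
        gcongr ?_ * ?_
        · exact pow_le_pow_of_le_one hs0.le hs1.le (by nlinarith)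
        · exact pow_le_one₀ hw0.le hw
    _ = s ^ n := mul_one _

theorem abs_thetaTerm_neg_add_one_le {s w : ℝ} (hs0 : 0 < s) (hs1 : s < 1) (hsw : s ≤ w) (n : ℕ) :
    |thetaTerm s w (-(n + 1))| ≤ s ^ n := by
  have hw0 : 0 < w := hs0.trans_le hsw
  rw [thetaTerm_neg_add_one, abs_neg, abs_mul, abs_pow, abs_neg, abs_one, one_pow, one_mul,
    abs_of_nonneg (by positivity)]
  calc s ^ (n + 1) ^ 2 * (w ^ (n + 1))⁻¹ ≤ s ^ (n + 1) ^ 2 * (s ^ (n + 1))⁻¹ := by gcongr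
    _ = s ^ (n * (n + 1)) := by
        rw [← div_eq_mul_inv, div_eq_iff (by positivity), ← pow_add]
        ring_nf
    _ ≤ s ^ n := pow_le_pow_of_le_one hs0.le hs1.le (by nlinarith)

theorem summable_abs_thetaTerm {s w : ℝ} (hs0 : 0 < s) (hs1 : s < 1) (hsw : s ≤ w) (hw : w ≤ 1) :
    Summable fun r => |thetaTerm s w r| := by
  have hg := summable_geometric_of_lt_one hs0.le hs1
  refine Summable.of_nat_of_neg_add_one ?_ ?_
  · exact hg.of_nonneg_of_le (fun _ => abs_nonneg _)
      (abs_thetaTerm_natCast_le hs0 hs1 (hs0.trans_le hsw) hw)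
  · exact hg.of_nonneg_of_le (fun _ => abs_nonneg _) (abs_thetaTerm_neg_add_one_le hs0 hs1 hsw)

/-- The finite form of the Jacobi triple product identity. -/
theorem hasSum_thetaTerm_mul_invQFactorial {s w : ℝ} (hs0 : 0 < s) (hs1 : s < 1) (hw : w ≠ 0)
    (N : ℕ) :
    HasSum (fun r : ℤ => thetaTerm s w r *
        (invQFactorial (s ^ 2) (N - r) * invQFactorial (s ^ 2) (N + r)))
      ((∏ j ∈ range N, (1 - w * s ^ (2 * j + 1)) * (1 - s ^ (2 * j + 1) / w)) *
        invQFactorial (s ^ 2) (2 * N)) := by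
  have hs : s ≠ 0 := hs0.ne'
  have hp1 : s ^ 2 < 1 := pow_lt_one₀ hs0.le hs1 two_ne_zero
  have hI := invQFactorial_sub_one (pow_pos hs0 2) hp1
  set I := invQFactorial (s ^ 2) with hI_def
  induction N with
  | zero =>
    convert hasSum_single (0 : ℤ) ?_ using 1
    · simp [thetaTerm, hI_def, invQFactorial]
    · intro r hr
      rcases lt_or_gt_of_ne hr with h | h
      · simp [hI_def, invQFactorial_of_neg _ h]
      · simp [hI_def, invQFactorial_of_neg (s ^ 2) (k := -r) (by lia)]
  | succ N ih =>
    have hup := (Equiv.addRight (1 : ℤ)).hasSum_iff.2 ih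
    have hdown := (Equiv.addRight (-1 : ℤ)).hasSum_iff.2 ih
    have hD : (1 - s ^ (4 * N + 2)) * (1 - s ^ (4 * N + 4)) ≠ 0 :=
      mul_ne_zero (sub_pos.2 (pow_lt_one₀ hs0.le hs1 (by lia))).ne'
        (sub_pos.2 (pow_lt_one₀ hs0.le hs1 (by lia))).ne'
    have key := ((ih.mul_left (1 + s ^ (4 * N + 2))).sub
      ((hdown.mul_left (s ^ (2 * N + 1) * w)).add (hup.mul_left (s ^ (2 * N + 1) / w)))).div_const
        ((1 - s ^ (4 * N + 2)) * (1 - s ^ (4 * N + 4)))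
    convert key using 1
    · rfl
    · funext r
      rw [eq_div_iff hD]
      simp only [Function.comp_apply, Equiv.coe_addRight]
      set u := s ^ ((N : ℤ) + 1 - r) with hu
      set v := s ^ ((N : ℤ) + 1 + r) with hv
      have hu2 : (s ^ 2) ^ ((N : ℤ) + 1 - r) = u ^ 2 := by
        rw [hu, ← zpow_natCast s, ← zpow_natCast (s ^ _), ← zpow_mul, ← zpow_mul, mul_comm]
      have hv2 : (s ^ 2) ^ ((N : ℤ) + 1 + r) = v ^ 2 := by
        rw [hv, ← zpow_natCast s, ← zpow_natCast (s ^ _), ← zpow_mul, ← zpow_mul, mul_comm]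
      have huv : u * v = s ^ (2 * N + 2) := by
        rw [hu, hv, ← zpow_add₀ hs, ← zpow_natCast]; congr 1; push_cast; ring
      have hdec (k : ℤ) : (s ^ 2) ^ (k - 1) = (s ^ 2) ^ k / s ^ 2 := by
        rw [zpow_sub_one₀ (pow_ne_zero 2 hs), div_eq_mul_inv]
      have h1 : I (N - r) = (1 - u ^ 2) * I (N + 1 - r) := by
        rw [← hu2, ← hI]; congr 1; ring
      have h2 : I (N + r) = (1 - v ^ 2) * I (N + 1 + r) := by
        rw [← hv2, ← hI]; congr 1; ring
      have h3 : I (N - (r + 1)) = (1 - u ^ 2 / s ^ 2) * ((1 - u ^ 2) * I (N + 1 - r)) := by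
        rw [← hu2, ← hI, ← hdec, ← hI]; congr 1; ring
      have h4 : I (N + (r + -1)) = (1 - v ^ 2 / s ^ 2) * ((1 - v ^ 2) * I (N + 1 + r)) := by
        rw [← hv2, ← hI, ← hdec, ← hI]; congr 1; ring
      have h5 : I (N + (r + 1)) = I (N + 1 + r) := by congr 1; ring
      have h6 : I (N - (r + -1)) = I (N + 1 - r) := by congr 1; ring
      have h7 : s ^ (2 * N + 1) / w * thetaTerm s w (r + 1) = -(v ^ 2 * thetaTerm s w r) := by
        rw [thetaTerm, thetaTerm, zpow_add₀ (by norm_num), zpow_add₀ hw, ← hv2,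
          show (r + 1) ^ 2 = r ^ 2 + (2 * r + 1) by ring, zpow_add₀ hs,
          ← zpow_natCast s 2, ← zpow_mul, ← zpow_natCast s,
          show ((2 : ℕ) : ℤ) * (N + 1 + r) = ((2 * N + 1 : ℕ) : ℤ) + (2 * r + 1) by push_cast; ring,
          zpow_add₀ hs ((2 * N + 1 : ℕ) : ℤ)]
        field_simp
      have h8 : s ^ (2 * N + 1) * w * thetaTerm s w (r + -1) = -(u ^ 2 * thetaTerm s w r) := by
        rw [thetaTerm, thetaTerm, zpow_add₀ (by norm_num), zpow_add₀ hw, ← hu2,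
          show (r + -1) ^ 2 = r ^ 2 + (-2 * r + 1) by ring, zpow_add₀ hs,
          ← zpow_natCast s 2, ← zpow_mul, ← zpow_natCast s,
          show ((2 : ℕ) : ℤ) * (N + 1 - r) = ((2 * N + 1 : ℕ) : ℤ) + (-2 * r + 1) by
            push_cast; ring,
          zpow_add₀ hs ((2 * N + 1 : ℕ) : ℤ)]
        simp only [zpow_neg_one]
        field_simp
      have h9 : s ^ (4 * N + 2) = u ^ 2 * v ^ 2 / s ^ 2 := by
        rw [← mul_pow, huv, eq_div_iff (pow_ne_zero 2 hs)]; ring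
      have h10 : s ^ (4 * N + 4) = u ^ 2 * v ^ 2 := by rw [← mul_pow, huv]; ring
      rw [← mul_assoc (_ * w), ← mul_assoc (_ / w), h7, h8, h1, h2, h3, h4, h5, h6, h9, h10]
      push_cast
      field_simp
      ring
    · rw [eq_div_iff hD, prod_range_succ]
      have h1 : I (2 * N) = (1 - s ^ (4 * N + 2)) * (1 - s ^ (4 * N + 4)) *
          I (2 * (N + 1 : ℕ)) := by
        have e1 : (s ^ 2) ^ (2 * (N : ℤ) + 2) = s ^ (4 * N + 4) := by
          rw [← zpow_natCast s 2, ← zpow_mul, ← zpow_natCast]; congr 1; push_cast; ring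
        have e2 : (s ^ 2) ^ (2 * (N : ℤ) + 1) = s ^ (4 * N + 2) := by
          rw [← zpow_natCast s 2, ← zpow_mul, ← zpow_natCast]; congr 1; push_cast; ring
        rw [← e1, ← e2, mul_assoc, show (2 * (N + 1 : ℕ) : ℤ) = 2 * N + 2 by push_cast; ring,
          ← hI, show (2 * (N : ℤ) + 2 - 1) = 2 * N + 1 by ring, ← hI]
        congr 1; ring
      rw [h1]
      field_simp
      ring

/-- A limit form of the Jacobi triple product identity. -/
theorem exists_tendsto_prod_mul_invQFactorial {s : ℝ} (hs0 : 0 < s) (hs1 : s < 1) :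
    ∃ c, 0 < c ∧ ∀ w, s ≤ w → w ≤ 1 →
      Tendsto (fun N : ℕ =>
        (∏ j ∈ range N, (1 - w * s ^ (2 * j + 1)) * (1 - s ^ (2 * j + 1) / w)) *
          invQFactorial (s ^ 2) (2 * N)) atTop (𝓝 ((∑' r, thetaTerm s w r) * c)) := by
  obtain ⟨δ, hδ, hle, hlim⟩ := exists_pos_le_prod_one_sub_pow (pow_pos hs0 2)
    (pow_lt_one₀ hs0.le hs1 two_ne_zero)
  have hI0 (k : ℤ) : 0 ≤ invQFactorial (s ^ 2) k := by
    rw [invQFactorial]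
    split_ifs
    · rfl
    · exact inv_nonneg.2 (hδ.le.trans (hle _))
  have hIle (k : ℤ) : invQFactorial (s ^ 2) k ≤ δ⁻¹ := by
    rw [invQFactorial]
    split_ifs
    · exact inv_nonneg.2 hδ.le
    · exact inv_anti₀ hδ (hle _)
  have hIlim : Tendsto (invQFactorial (s ^ 2)) atTop (𝓝 δ⁻¹) := by
    have hnat : Tendsto Int.toNat atTop atTop :=
      tendsto_atTop_atTop.2 fun n => ⟨n, fun k hk => by lia⟩
    have h := (hlim.inv₀ hδ.ne').comp hnat
    refine h.congr' ?_
    filter_upwards [eventually_ge_atTop 0] with k hk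
    simp [invQFactorial, not_lt.2 hk]
  refine ⟨δ⁻¹ * δ⁻¹, by positivity, fun w hsw hw => ?_⟩
  have hcast : Tendsto (fun N : ℕ => (N : ℤ)) atTop atTop := tendsto_natCast_atTop_atTop
  have hfin := fun N => (hasSum_thetaTerm_mul_invQFactorial hs0 hs1 (hs0.trans_le hsw).ne' N).tsum_eq
  simp only [← hfin]
  rw [← tsum_mul_right]
  refine tendsto_tsum_of_dominated_convergence
    ((summable_abs_thetaTerm hs0 hs1 hsw hw).mul_right (δ⁻¹ * δ⁻¹)) (fun r => ?_)
    (Eventually.of_forall fun N r => ?_)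
  · exact ((hIlim.comp (tendsto_atTop_add_const_right _ (-r) hcast)).mul
      (hIlim.comp (tendsto_atTop_add_const_right _ r hcast))).const_mul _
  · rw [norm_mul, Real.norm_eq_abs, Real.norm_of_nonneg (mul_nonneg (hI0 _) (hI0 _))]
    have := hI0 (N - r)
    have := hI0 (N + r)
    gcongr <;> exact hIle _

theorem tsum_thetaTerm_pos {s w : ℝ} (hs0 : 0 < s) (hsw : s < w) (hw : w ≤ 1) :
    0 < ∑' r, thetaTerm s w r := by
  have hs1 : s < 1 := hsw.trans_le hw
  have hw0 : 0 < w := hs0.trans hsw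
  obtain ⟨c, hc, hlim⟩ := exists_tendsto_prod_mul_invQFactorial hs0 hs1
  have hsw1 : s / w < 1 := (div_lt_one hw0).2 hsw
  have hsw0 : 0 < s / w := by positivity
  have hss : s ≤ s / w := le_div_self hs0.le hw0 hw
  obtain ⟨δ, hδ, hle, -⟩ := exists_pos_le_prod_one_sub_pow hsw0 hsw1
  have hp1 : s ^ 2 < 1 := pow_lt_one₀ hs0.le hs1 two_ne_zero
  refine pos_of_mul_pos_left ((mul_pos hδ hδ).trans_le
    (ge_of_tendsto' (hlim w hsw.le hw) fun N => ?_)) hc.le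
  have hpow (j : ℕ) : s ^ (2 * j + 1) ≤ (s / w) ^ (j + 1) :=
    (pow_le_pow_left₀ hs0.le hss _).trans (pow_le_pow_of_le_one hsw0.le hsw1.le (by lia))
  have h1 (j : ℕ) : 1 - (s / w) ^ (j + 1) ≤ 1 - w * s ^ (2 * j + 1) :=
    sub_le_sub_left ((mul_le_of_le_one_left (by positivity) hw).trans (hpow j)) _
  have h2 (j : ℕ) : 1 - (s / w) ^ (j + 1) ≤ 1 - s ^ (2 * j + 1) / w := by
    refine sub_le_sub_left ?_ _
    calc s ^ (2 * j + 1) / w = s ^ (2 * j) * (s / w) := by ring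
      _ ≤ (s / w) ^ (2 * j) * (s / w) := by gcongr
      _ = (s / w) ^ (2 * j + 1) := (pow_succ _ _).symm
      _ ≤ (s / w) ^ (j + 1) := pow_le_pow_of_le_one hsw0.le hsw1.le (by lia)
  have h0 (j : ℕ) : 0 ≤ 1 - (s / w) ^ (j + 1) :=
    sub_nonneg.2 (pow_le_one₀ hsw0.le hsw1.le)
  have hI1 : 1 ≤ invQFactorial (s ^ 2) (2 * N) := by
    rw [show (2 * N : ℤ) = (2 * N : ℕ) by push_cast; rfl, invQFactorial_natCast]
    refine (one_le_inv₀ (prod_pos fun j _ => sub_pos.2 ?_)).2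
      (prod_le_one (fun j _ => sub_nonneg.2 ?_) fun j _ => sub_le_self _ (by positivity))
    · exact pow_lt_one₀ (by positivity) hp1 j.succ_ne_zero
    · exact pow_le_one₀ (by positivity) hp1.le
  have hprod : δ * δ ≤ ∏ j ∈ range N, (1 - w * s ^ (2 * j + 1)) * (1 - s ^ (2 * j + 1) / w) := by
    rw [prod_mul_distrib]
    exact mul_le_mul ((hle N).trans (prod_le_prod (fun j _ => h0 j) fun j _ => h1 j))
      ((hle N).trans (prod_le_prod (fun j _ => h0 j) fun j _ => h2 j)) hδ.le
      (prod_nonneg fun j _ => (h0 j).trans (h1 j))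
  exact hprod.trans (le_mul_of_one_le_right ((mul_pos hδ hδ).le.trans hprod) hI1)

theorem tendsto_prod_div_prod_thetaTerm {s v w : ℝ} (hs0 : 0 < s) (hsv : s ≤ v) (hv : v ≤ 1)
    (hsw : s < w) (hw : w ≤ 1) :
    Tendsto (fun N => ∏ j ∈ range N, (1 - v * s ^ (2 * j + 1)) * (1 - s ^ (2 * j + 1) / v) /
        ((1 - w * s ^ (2 * j + 1)) * (1 - s ^ (2 * j + 1) / w))) atTop
      (𝓝 ((∑' r, thetaTerm s v r) / ∑' r, thetaTerm s w r)) := by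
  have hs1 : s < 1 := hsw.trans_le hw
  have hp1 : s ^ 2 < 1 := pow_lt_one₀ hs0.le hs1 two_ne_zero
  obtain ⟨c, hc, hlim⟩ := exists_tendsto_prod_mul_invQFactorial hs0 hs1
  have hθ := tsum_thetaTerm_pos hs0 hsw hw
  have h := (hlim v hsv hv).div (hlim w hsw.le hw) (mul_pos hθ hc).ne'
  rw [mul_div_mul_right _ _ hc.ne'] at h
  refine h.congr fun N => ?_
  have hI : invQFactorial (s ^ 2) (2 * N) ≠ 0 := by
    rw [show (2 * N : ℤ) = (2 * N : ℕ) by push_cast; rfl, invQFactorial_natCast]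
    exact inv_ne_zero (prod_ne_zero_iff.2 fun j _ =>
      (sub_pos.2 (pow_lt_one₀ (by positivity) hp1 j.succ_ne_zero)).ne')
  rw [Pi.div_apply, mul_div_mul_right _ _ hI, prod_div_distrib]

/-- The common weight of the two series in `ggSeries` and `ggShiftedSeries`. -/
noncomputable def ggWeight (q : ℝ) (m n : ℕ) : ℝ :=
  (-1) ^ n * q ^ (4 * m * n + 4 * n ^ 2 + n) *
    ((∏ j ∈ range n, (1 + q ^ (2 * j + 1))) / ∏ j ∈ range (n + m + 1), (1 + q ^ (2 * j + 1))) *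
    ((∏ j ∈ range (n + m), (1 - q ^ (2 * j + 2))) / ∏ j ∈ range n, (1 - q ^ (2 * j + 2)))

theorem ggWeight_succ_left {q : ℝ} (hq0 : 0 < q) (hq1 : q < 1) (m n : ℕ) :
    ggWeight q (m + 1) n * (1 + q ^ (2 * m + 2 * n + 3)) =
      q ^ (4 * n) * (1 - q ^ (2 * m + 2 * n + 2)) * ggWeight q m n := by
  have h1 : (∏ j ∈ range (n + m + 1), (1 + q ^ (2 * j + 1))) ≠ 0 :=
    (prod_pos fun j _ => by positivity).ne'
  have h2 : (∏ j ∈ range n, (1 - q ^ (2 * j + 2))) ≠ 0 :=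
    (prod_pos fun j _ => sub_pos.2 (pow_lt_one₀ hq0.le hq1 (by lia))).ne'
  have h3 : 1 + q ^ (2 * (n + m + 1) + 1) ≠ 0 := by positivity
  rw [ggWeight, ggWeight, ← add_assoc, prod_range_succ _ (n + m + 1),
    prod_range_succ (fun j => 1 - q ^ (2 * j + 2)) (n + m)]
  field_simp
  ring

theorem ggWeight_succ_right {q : ℝ} (hq0 : 0 < q) (hq1 : q < 1) (m n : ℕ) :
    ggWeight q m (n + 1) * (1 - q ^ (2 * n + 2)) =
      -q ^ (4 * m + 4 * n + 5) * (1 + q ^ (2 * n + 1)) * ggWeight q (m + 1) n := by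
  have h1 : (∏ j ∈ range (n + m + 1 + 1), (1 + q ^ (2 * j + 1))) ≠ 0 :=
    (prod_pos fun j _ => by positivity).ne'
  have h2 : (∏ j ∈ range n, (1 - q ^ (2 * j + 2))) ≠ 0 :=
    (prod_pos fun j _ => sub_pos.2 (pow_lt_one₀ hq0.le hq1 (by lia))).ne'
  have h3 : 1 - q ^ (2 * n + 2) ≠ 0 := (sub_pos.2 (pow_lt_one₀ hq0.le hq1 (by lia))).ne'
  rw [ggWeight, ggWeight, ← add_assoc, add_right_comm n 1 m, prod_range_succ _ n,
    prod_range_succ _ n]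
  field_simp
  ring_nf

theorem abs_ggWeight_le {q : ℝ} (hq0 : 0 < q) (hq1 : q < 1)
    (m n : ℕ) : |ggWeight q m n| ≤ q ^ n := by
  have hd (j : ℕ) : 0 < 1 - q ^ (2 * j + 2) := sub_pos.2 (pow_lt_one₀ hq0.le hq1 (by lia))
  have h1 : (∏ j ∈ range n, (1 + q ^ (2 * j + 1))) / ∏ j ∈ range (n + m + 1), (1 + q ^ (2 * j + 1))
      ≤ 1 := by
    rw [add_assoc, prod_range_add]
    refine (div_le_one (by positivity)).2 (le_mul_of_one_le_right (by positivity) ?_)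
    exact one_le_prod fun j _ => le_add_of_nonneg_right (by positivity)
  have h2 : (∏ j ∈ range (n + m), (1 - q ^ (2 * j + 2))) / ∏ j ∈ range n, (1 - q ^ (2 * j + 2))
      ≤ 1 := by
    have hpos : 0 < ∏ j ∈ range n, (1 - q ^ (2 * j + 2)) := prod_pos fun j _ => hd j
    rw [prod_range_add]
    refine (div_le_one hpos).2 (mul_le_of_le_one_right hpos.le ?_)
    exact prod_le_one (fun j _ => (hd _).le) fun j _ => sub_le_self _ (by positivity)
  have h3 : 0 ≤ (∏ j ∈ range (n + m), (1 - q ^ (2 * j + 2))) / ∏ j ∈ range n, (1 - q ^ (2 * j + 2)) :=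
    div_nonneg (prod_nonneg fun j _ => (hd j).le) (prod_nonneg fun j _ => (hd j).le)
  rw [ggWeight, abs_mul, abs_mul, abs_mul, abs_pow, abs_neg, abs_one, one_pow, one_mul,
    abs_of_nonneg h3, abs_of_nonneg (by positivity), abs_of_nonneg (by positivity)]
  calc _ ≤ q ^ n * 1 * 1 := by
        gcongr ?_ * ?_ * ?_
        exact pow_le_pow_of_le_one hq0.le hq1.le (Nat.le_add_left n _)
    _ = q ^ n := by ring

theorem summable_ggWeight_mul {q : ℝ} (hq0 : 0 < q) (hq1 : q < 1) (m : ℕ)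
    {c : ℕ → ℝ} {C : ℝ} (hc : ∀ n, |c n| ≤ C) :
    Summable fun n => ggWeight q m n * c n := by
  refine Summable.of_norm_bounded ((summable_geometric_of_lt_one hq0.le hq1).mul_right C)
    fun n => ?_
  rw [norm_mul]
  exact mul_le_mul (abs_ggWeight_le hq0 hq1 m n) (hc n) (abs_nonneg _) (by positivity)

/-- The value at `x = q ^ (2 * m)` of the Göllnitz–Gordon function
`∑ (-q; q²)ₙ q^(n²) xⁿ / (q²; q²)ₙ`, as a theta-like series and up to a factor independent of
`m`. -/
noncomputable def ggSeries (q : ℝ) (m : ℕ) : ℝ :=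
  ∑' n, ggWeight q m n *
    ((1 - q ^ (4 * m + 8 * n + 4)) + q ^ (2 * m + 2 * n + 1) * (1 - q ^ (2 * m + 4 * n + 2)))

/-- A second theta-like series for `ggSeries q (m + 1)`. -/
noncomputable def ggShiftedSeries (q : ℝ) (m : ℕ) : ℝ :=
  ∑' n, ggWeight q m n * (q ^ (2 * n) * (1 - q ^ (2 * m + 4 * n + 2)))

theorem pow_mem_Icc {q : ℝ} (hq0 : 0 < q) (hq1 : q < 1) (k : ℕ) : 0 ≤ q ^ k ∧ q ^ k ≤ 1 :=
  ⟨pow_nonneg hq0.le k, pow_le_one₀ hq0.le hq1.le⟩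

theorem abs_ggSeries_coeff_le {q : ℝ} (hq0 : 0 < q) (hq1 : q < 1) (m n : ℕ) :
    |(1 - q ^ (4 * m + 8 * n + 4)) + q ^ (2 * m + 2 * n + 1) * (1 - q ^ (2 * m + 4 * n + 2))|
      ≤ 2 := by
  obtain ⟨h1, h2⟩ := pow_mem_Icc hq0 hq1 (4 * m + 8 * n + 4)
  obtain ⟨h3, h4⟩ := pow_mem_Icc hq0 hq1 (2 * m + 2 * n + 1)
  obtain ⟨h5, h6⟩ := pow_mem_Icc hq0 hq1 (2 * m + 4 * n + 2)
  rw [abs_le]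
  constructor <;> nlinarith

theorem abs_ggShiftedSeries_coeff_le {q : ℝ} (hq0 : 0 < q) (hq1 : q < 1) (m n : ℕ) :
    |q ^ (2 * n) * (1 - q ^ (2 * m + 4 * n + 2))| ≤ 1 := by
  obtain ⟨h3, h4⟩ := pow_mem_Icc hq0 hq1 (2 * n)
  obtain ⟨h5, h6⟩ := pow_mem_Icc hq0 hq1 (2 * m + 4 * n + 2)
  rw [abs_le]
  constructor <;> nlinarith

theorem hasSum_ggSeries {q : ℝ} (hq0 : 0 < q) (hq1 : q < 1) (m : ℕ) :
    HasSum (fun n => ggWeight q m n * ((1 - q ^ (4 * m + 8 * n + 4)) +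
      q ^ (2 * m + 2 * n + 1) * (1 - q ^ (2 * m + 4 * n + 2)))) (ggSeries q m) :=
  (summable_ggWeight_mul hq0 hq1 m (abs_ggSeries_coeff_le hq0 hq1 m)).hasSum

theorem hasSum_ggShiftedSeries {q : ℝ} (hq0 : 0 < q) (hq1 : q < 1) (m : ℕ) :
    HasSum (fun n => ggWeight q m n * (q ^ (2 * n) * (1 - q ^ (2 * m + 4 * n + 2))))
      (ggShiftedSeries q m) :=
  (summable_ggWeight_mul hq0 hq1 m (abs_ggShiftedSeries_coeff_le hq0 hq1 m)).hasSum

theorem abs_ggSeries_le {q : ℝ} (hq0 : 0 < q) (hq1 : q < 1) (m : ℕ) :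
    |ggSeries q m| ≤ (1 - q)⁻¹ * 2 := by
  rw [ggSeries, ← Real.norm_eq_abs]
  refine tsum_of_norm_bounded ((hasSum_geometric_of_lt_one hq0.le hq1).mul_right 2) fun n => ?_
  rw [norm_mul]
  exact mul_le_mul (abs_ggWeight_le hq0 hq1 m n) (abs_ggSeries_coeff_le hq0 hq1 m n)
    (abs_nonneg _) (by positivity)

theorem ggShiftedSeries_eq {q : ℝ} (hq0 : 0 < q) (hq1 : q < 1) (m : ℕ) :
    ggShiftedSeries q m = ggSeries q (m + 1) := by
  have hT : Summable fun n => ggWeight q m n * (q ^ (2 * n) * (1 - q ^ (2 * n))) := by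
    refine summable_ggWeight_mul hq0 hq1 m (C := 1) fun n => ?_
    obtain ⟨h3, h4⟩ := pow_mem_Icc hq0 hq1 (2 * n)
    rw [abs_le]
    constructor <;> nlinarith
  have hT' := (hasSum_nat_add_iff' 1).2 hT.hasSum
  rw [range_one, sum_singleton, mul_zero, pow_zero, sub_self, mul_zero, mul_zero, sub_zero] at hT'
  have h := ((hasSum_ggSeries hq0 hq1 (m + 1)).sub hT').add hT.hasSum
  rw [sub_add_cancel] at h
  refine (tsum_congr fun n => ?_).trans h.tsum_eq
  have e1 := ggWeight_succ_left hq0 hq1 m n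
  have e2 := ggWeight_succ_right hq0 hq1 m n
  linear_combination (-1) * e1 + q ^ (2 * n + 2) * e2

theorem ggSeries_eq_add_ggShiftedSeries {q : ℝ} (hq0 : 0 < q) (hq1 : q < 1) (m : ℕ) :
    ggSeries q m = (1 + q ^ (2 * m + 1)) * ggShiftedSeries q m +
      q ^ (2 * m + 2) * ggShiftedSeries q (m + 1) := by
  have hT : Summable fun n => ggWeight q m n * (1 - q ^ (2 * n)) := by
    refine summable_ggWeight_mul hq0 hq1 m (C := 1) fun n => ?_
    obtain ⟨h3, h4⟩ := pow_mem_Icc hq0 hq1 (2 * n)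
    rw [abs_le]
    constructor <;> nlinarith
  have hT' := (hasSum_nat_add_iff' 1).2 hT.hasSum
  rw [range_one, sum_singleton, mul_zero, pow_zero, sub_self, mul_zero, sub_zero] at hT'
  have h := ((((hasSum_ggShiftedSeries hq0 hq1 m).mul_left (1 + q ^ (2 * m + 1))).add
    ((hasSum_ggShiftedSeries hq0 hq1 (m + 1)).mul_left (q ^ (2 * m + 2)))).sub hT').add hT.hasSum
  rw [sub_add_cancel] at h
  refine (tsum_congr fun n => ?_).trans h.tsum_eq
  have e1 := ggWeight_succ_left hq0 hq1 m n
  have e2 := ggWeight_succ_right hq0 hq1 m n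
  linear_combination (-q ^ (2 * m + 2 * n + 2)) * e1 + e2

theorem ggSeries_recurrence {q : ℝ} (hq0 : 0 < q) (hq1 : q < 1) (m : ℕ) :
    ggSeries q m = (1 + q ^ (2 * m + 1)) * ggSeries q (m + 1) +
      q ^ (2 * m + 2) * ggSeries q (m + 2) := by
  rw [ggSeries_eq_add_ggShiftedSeries hq0 hq1, ggShiftedSeries_eq hq0 hq1,
    ggShiftedSeries_eq hq0 hq1]

theorem ggWeight_zero_mul {q : ℝ} (hq0 : 0 < q) (hq1 : q < 1) (n : ℕ) :
    ggWeight q 0 n * (1 + q ^ (2 * n + 1)) = (-1) ^ n * q ^ (4 * n ^ 2 + n) := by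
  have h1 : (∏ j ∈ range n, (1 + q ^ (2 * j + 1))) ≠ 0 :=
    (prod_pos fun j _ => by positivity).ne'
  have h2 : (∏ j ∈ range n, (1 - q ^ (2 * j + 2))) ≠ 0 :=
    (prod_pos fun j _ => sub_pos.2 (pow_lt_one₀ hq0.le hq1 (by lia))).ne'
  rw [ggWeight, add_zero, prod_range_succ]
  field_simp
  simp

theorem tsum_thetaTerm_eq {q : ℝ} (hq0 : 0 < q) (hq1 : q < 1) {w : ℝ} (hsw : q ^ 4 ≤ w) (hw : w ≤ 1) :
    ∑' r, thetaTerm (q ^ 4) w r =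
      ∑' n : ℕ, (-1) ^ n * (q ^ (4 * n ^ 2) * w ^ n -
        q ^ (4 * (n + 1) ^ 2) * (w ^ (n + 1))⁻¹) := by
  have hs0 : 0 < q ^ 4 := pow_pos hq0 4
  have hs1 : q ^ 4 < 1 := pow_lt_one₀ hq0.le hq1 four_ne_zero
  have hg := summable_geometric_of_lt_one hs0.le hs1
  have h1 : Summable fun n : ℕ => thetaTerm (q ^ 4) w n :=
    hg.of_norm_bounded (abs_thetaTerm_natCast_le hs0 hs1 (hs0.trans_le hsw) hw)
  have h2 : Summable fun n : ℕ => thetaTerm (q ^ 4) w (-(n + 1)) :=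
    hg.of_norm_bounded (abs_thetaTerm_neg_add_one_le hs0 hs1 hsw)
  rw [tsum_of_nat_of_neg_add_one h1 h2, ← h1.tsum_add h2]
  refine tsum_congr fun n => ?_
  rw [thetaTerm_natCast, thetaTerm_neg_add_one, ← pow_mul, ← pow_mul]
  ring

theorem tsum_thetaTerm_one {q : ℝ} (hq0 : 0 < q) (hq1 : q < 1) :
    ∑' r, thetaTerm (q ^ 4) q r = ggSeries q 0 := by
  rw [tsum_thetaTerm_eq hq0 hq1 (pow_le_of_le_one hq0.le hq1.le four_ne_zero) hq1.le]
  refine tsum_congr fun n => ?_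
  have hpow : q ^ (4 * (n + 1) ^ 2) * (q ^ (n + 1))⁻¹ = q ^ (4 * n ^ 2 + n) * q ^ (6 * n + 3) := by
    rw [← div_eq_mul_inv, div_eq_iff (pow_ne_zero _ hq0.ne'), ← pow_add, ← pow_add]
    congr 1
    ring
  rw [hpow]
  linear_combination (q ^ (6 * n + 3) - 1) * ggWeight_zero_mul hq0 hq1 n

theorem tsum_thetaTerm_three {q : ℝ} (hq0 : 0 < q) (hq1 : q < 1) :
    ∑' r, thetaTerm (q ^ 4) (q ^ 3) r = ggShiftedSeries q 0 := by
  rw [tsum_thetaTerm_eq hq0 hq1 (pow_le_pow_of_le_one hq0.le hq1.le (by norm_num))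
    (pow_le_one₀ hq0.le hq1.le)]
  refine tsum_congr fun n => ?_
  have hpow : q ^ (4 * (n + 1) ^ 2) * ((q ^ 3) ^ (n + 1))⁻¹ =
      q ^ (4 * n ^ 2 + n) * q ^ (4 * n + 1) := by
    rw [← div_eq_mul_inv, div_eq_iff (by positivity), ← pow_mul, ← pow_add, ← pow_add]
    congr 1
    ring
  rw [hpow]
  linear_combination (q ^ (4 * n + 1) - q ^ (2 * n)) * ggWeight_zero_mul hq0 hq1 n

theorem multipliable_gollnitzGordon {q : ℝ} (hq0 : 0 < q) (hq1 : q < 1) :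
    Multipliable fun n : ℕ => (1 - q ^ (8 * n + 1)) * (1 - q ^ (8 * n + 7)) /
      ((1 - q ^ (8 * n + 3)) * (1 - q ^ (8 * n + 5))) := by
  have hle (n k : ℕ) (h : n ≤ k) : q ^ k ≤ q ^ n := pow_le_pow_of_le_one hq0.le hq1.le h
  have hsum : Summable fun n : ℕ => (1 - q ^ (8 * n + 1)) * (1 - q ^ (8 * n + 7)) /
      ((1 - q ^ (8 * n + 3)) * (1 - q ^ (8 * n + 5))) - 1 := by
    refine Summable.of_norm_bounded
      ((summable_geometric_of_lt_one hq0.le hq1).mul_right (4 / ((1 - q) * (1 - q)))) fun n => ?_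
    have hq : 0 < 1 - q := sub_pos.2 hq1
    have h3 : 1 - q ≤ 1 - q ^ (8 * n + 3) :=
      sub_le_sub_left (by simpa using hle 1 (8 * n + 3) (by lia)) _
    have h5 : 1 - q ≤ 1 - q ^ (8 * n + 5) :=
      sub_le_sub_left (by simpa using hle 1 (8 * n + 5) (by lia)) _
    have hD : (1 - q) * (1 - q) ≤ (1 - q ^ (8 * n + 3)) * (1 - q ^ (8 * n + 5)) :=
      mul_le_mul h3 h5 hq.le (hq.le.trans h3)
    have hD0 := (mul_pos hq hq).trans_le hD
    rw [div_sub_one hD0.ne', norm_div, Real.norm_of_nonneg hD0.le, ← mul_div_assoc]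
    refine div_le_div₀ (by positivity) ?_ (mul_pos hq hq) hD
    have e : q ^ (8 * n + 1) * q ^ (8 * n + 7) = q ^ (8 * n + 3) * q ^ (8 * n + 5) := by ring
    have e' : (1 - q ^ (8 * n + 1)) * (1 - q ^ (8 * n + 7)) -
        (1 - q ^ (8 * n + 3)) * (1 - q ^ (8 * n + 5)) =
        q ^ (8 * n + 3) + q ^ (8 * n + 5) - (q ^ (8 * n + 1) + q ^ (8 * n + 7)) := by
      linear_combination e
    have p (k : ℕ) : 0 < q ^ k := pow_pos hq0 k
    rw [e', Real.norm_eq_abs, abs_le]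
    constructor <;> linarith [hle n (8 * n + 1) (by lia), hle n (8 * n + 3) (by lia),
      hle n (8 * n + 5) (by lia), hle n (8 * n + 7) (by lia), p n, p (8 * n + 1), p (8 * n + 3),
      p (8 * n + 5), p (8 * n + 7)]
  simpa using Real.multipliable_one_add_of_summable hsum

theorem tprod_gollnitzGordon_eq {q : ℝ} (hq0 : 0 < q) (hq1 : q < 1) :
    ∏' n : ℕ, (1 - q ^ (8 * n + 1)) * (1 - q ^ (8 * n + 7)) /
      ((1 - q ^ (8 * n + 3)) * (1 - q ^ (8 * n + 5))) = ggSeries q 1 / ggSeries q 0 := by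
  have hs : q ^ 4 < q := pow_lt_self_of_lt_one₀ hq0 hq1 (by norm_num)
  have h := tendsto_prod_div_prod_thetaTerm (pow_pos hq0 4)
    (pow_le_pow_of_le_one hq0.le hq1.le (by norm_num : 3 ≤ 4)) (pow_le_one₀ hq0.le hq1.le)
    hs hq1.le
  rw [tsum_thetaTerm_one hq0 hq1, tsum_thetaTerm_three hq0 hq1, ggShiftedSeries_eq hq0 hq1] at h
  refine tendsto_nhds_unique (multipliable_gollnitzGordon hq0 hq1).tendsto_prod_tprod_nat
    (h.congr fun N => prod_congr rfl fun j _ => ?_)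
  have e1 : (q ^ 4) ^ (2 * j + 1) / q ^ 3 = q ^ (8 * j + 1) := by field_simp; ring
  have e2 : (q ^ 4) ^ (2 * j + 1) / q = q ^ (8 * j + 3) := by field_simp; ring
  rw [e1, e2]
  ring

/-- A solution tending to zero of the recurrence of `gollnitzGordonGCF q`. -/
noncomputable def ggMinimalSolution (q : ℝ) (n : ℕ) : ℝ :=
  (-1) ^ n * (∏ j ∈ range n, q ^ (2 * j)) * ggSeries q n

theorem ggMinimalSolution_recurrence {q : ℝ} (hq0 : 0 < q) (hq1 : q < 1) (n : ℕ) :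
    ggMinimalSolution q (n + 2) = (1 + q ^ (2 * n + 1)) * ggMinimalSolution q (n + 1) +
      q ^ (2 * n) * ggMinimalSolution q n := by
  rw [ggMinimalSolution, ggMinimalSolution, ggMinimalSolution, ggSeries_recurrence hq0 hq1 n,
    prod_range_succ _ (n + 1), prod_range_succ _ n]
  ring

theorem tendsto_ggMinimalSolution {q : ℝ} (hq0 : 0 < q) (hq1 : q < 1) :
    Tendsto (ggMinimalSolution q) atTop (𝓝 0) := by
  refine (tendsto_add_atTop_iff_nat 1).1 ?_
  have hgeom := (tendsto_pow_atTop_nhds_zero_of_lt_one hq0.le hq1).mul_const ((1 - q)⁻¹ * 2)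
  rw [zero_mul] at hgeom
  refine squeeze_zero_norm (fun n => ?_) hgeom
  rw [ggMinimalSolution, norm_mul, norm_mul, norm_pow, norm_neg, norm_one, one_pow, one_mul,
    Real.norm_of_nonneg (by positivity), prod_range_succ]
  have hprod : ∏ j ∈ range n, q ^ (2 * j) ≤ 1 :=
    prod_le_one (fun j _ => by positivity) fun j _ => pow_le_one₀ hq0.le hq1.le
  refine mul_le_mul ?_ (abs_ggSeries_le hq0 hq1 (n + 1)) (norm_nonneg _) (by positivity)
  exact (mul_le_of_le_one_left (by positivity) hprod).trans
    (pow_le_pow_of_le_one hq0.le hq1.le (by lia))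

theorem gollnitzGordonGCF_tendsto (q : ℝ) (hq0 : 0 < q) (hq1 : q < 1) :
    Filter.Tendsto (gollnitzGordonGCF q).convs Filter.atTop
      (nhds (∏' n : ℕ,
        (1 - q ^ (8 * n + 1)) * (1 - q ^ (8 * n + 7)) /
          ((1 - q ^ (8 * n + 3)) * (1 - q ^ (8 * n + 5))))) := by
  have h0 : ggSeries q 0 ≠ 0 := by
    rw [← tsum_thetaTerm_one hq0 hq1]
    exact (tsum_thetaTerm_pos (pow_pos hq0 4) (pow_lt_self_of_lt_one₀ hq0 hq1 (by norm_num))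
      hq1.le).ne'
  have h := GenContFract.tendsto_convs_of_recurrence (g := gollnitzGordonGCF q) rfl
    (fun _ => rfl) (fun n => by positivity) (fun n => le_add_of_nonneg_right (by positivity))
    (ggMinimalSolution_recurrence hq0 hq1) (by simpa [ggMinimalSolution] using h0)
    (tendsto_ggMinimalSolution hq0 hq1)
  rw [tprod_gollnitzGordon_eq hq0 hq1]
  simpa [ggMinimalSolution] using h
end
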